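/- Let H satisfy the Hurst hypotheses with 0 < H(x) < 1 and Leb(D) > 0, and let μ be a centered Gaussian measure on the real Hilbert space L²(0,1) with covariance kernel G(x,y) = C_*(H(x))·C_*(H(y)) · ∫_ℝ Re[(e^{ixξ} − 1)(e^{−iyξ} − 1)] · |ξ|^{−(H(x)+H(y)+1)} dξ (the covariance of the multifractional Brownian motion with functional Hurst parameter H). Then, with M := Leb(D), lim_{ε→0⁺} ε^{1/H_min} · log μ({f ∈ L²(0,1) : ‖f‖_{L²(0,1)} ≤ ε}) = − (H_min·M)/((2H_min+1)·sin(π/(2H_min+1))) · (Γ(2H_min+1)·sin(πH_min)·M/((2H_min+1)·sin(π/(2H_min+1))))^{1/(2H_min)}. -/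

import Mathlib

open MeasureTheory Set Filter Metric
open scoped ENNReal NNReal Real

noncomputable section

/-- `C_*(H) = (Γ(2H+1) sin(πH) / (2π))^{1/2}`. -/
def Cstar (H : ℝ) : ℝ :=
  Real.sqrt (Real.Gamma (2 * H + 1) * Real.sin (Real.pi * H) / (2 * Real.pi))

/-- Covariance kernel of the multifractional Brownian motion with functional Hurst
parameter `H`. -/
def GmBM (H : ℝ → ℝ) (x y : ℝ) : ℝ :=
  Cstar (H x) * Cstar (H y) *
    ∫ ξ : ℝ, ((Complex.exp (Complex.I * x * ξ) - 1) *
      (Complex.exp (-Complex.I * y * ξ) - 1)).re * |ξ| ^ (-(H x + H y + 1))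

/-- Hölder continuity of exponent `r` on a set. -/
def HolderOn (f : ℝ → ℝ) (r : ℝ) (s : Set ℝ) : Prop :=
  ∃ C : ℝ, ∀ x ∈ s, ∀ y ∈ s, |f x - f y| ≤ C * |x - y| ^ r

section
open Real
section
open ProbabilityTheory in
abbrev gaussPi (ι : Type*) [Fintype ι] : Measure (ι → ℝ) :=
  Measure.pi (fun _ : ι => gaussianReal 0 1)
open ProbabilityTheory in
lemma gauss_sq (c : ℝ) (hc : 0 ≤ c) :
    ∫ z, exp (-(c / 2) * z ^ 2) ∂(gaussianReal 0 1) = (√(1 + c))⁻¹ := by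
  rw [integral_gaussianReal_eq_integral_smul one_ne_zero]
  simp only [gaussianPDFReal, NNReal.coe_one, mul_one, sub_zero, smul_eq_mul]
  have : ∀ x : ℝ, (√(2 * π))⁻¹ * exp (-x ^ 2 / 2) * exp (-(c / 2) * x ^ 2)
      = (√(2 * π))⁻¹ * exp (-((1 + c) / 2) * x ^ 2) := by
    intro x
    rw [mul_assoc, ← exp_add]; ring_nf
  simp_rw [this]
  rw [integral_const_mul, integral_gaussian]
  have h2 : π / ((1 + c) / 2) = (2 * π) * (1 + c)⁻¹ := by field_simp
  rw [h2, sqrt_mul (x := 2 * π) (by positivity), sqrt_inv]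
  have : √(2 * π) ≠ 0 := by positivity
  field_simp
open ProbabilityTheory in
lemma gauss_char (c : ℝ) :
    ∫ z, Complex.exp (Complex.I * ((c * z : ℝ) : ℂ)) ∂(gaussianReal 0 1)
      = (exp (-(c ^ 2) / 2) : ℂ) := by
  have h := charFun_gaussianReal (μ := 0) (v := 1) c
  rw [charFun_apply_real] at h
  rw [show (exp (-(c ^ 2) / 2) : ℂ) = Complex.exp (c * (0:ℝ) * Complex.I - (1:ℝ≥0) * c ^ 2 / 2) by
    push_cast; congr 1; simp; ring]
  rw [← h]
  congr 1; ext z; congr 1; push_cast; ring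
lemma gauss_dual {ι Ω V : Type*} [Fintype ι] [MeasurableSpace Ω] (P : Measure Ω)
    [IsProbabilityMeasure P] [NormedAddCommGroup V] [InnerProductSpace ℝ V]
    (X : ι → Ω → ℝ) (hX : ∀ i, Measurable (X i)) (g : ι → V)
    (hchar : ∀ z : ι → ℝ, ∫ ω, Complex.exp (Complex.I * ((∑ i, z i * X i ω : ℝ) : ℂ)) ∂P
      = (exp (-(‖∑ i, z i • g i‖ ^ 2) / 2) : ℂ)) (s : ℝ) (hs : 0 ≤ s) :
    ∫ ω, exp (-(s / 2) * ∑ i, (X i ω) ^ 2) ∂P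
      = ∫ Z, exp (-(s / 2) * ‖∑ i, Z i • g i‖ ^ 2) ∂(gaussPi ι) := by
  have key : (∫ ω, (exp (-(s / 2) * ∑ i, (X i ω) ^ 2) : ℂ) ∂P)
      = ∫ Z, (exp (-(s / 2) * ‖∑ i, Z i • g i‖ ^ 2) : ℂ) ∂(gaussPi ι) := by
    have h1 : ∀ ω, (exp (-(s / 2) * ∑ i, (X i ω) ^ 2) : ℂ)
        = ∫ Z, Complex.exp (Complex.I * ((√s * ∑ i, Z i * X i ω : ℝ) : ℂ)) ∂(gaussPi ι) := by
      intro ω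
      have : ∀ Z : ι → ℝ, Complex.exp (Complex.I * ((√s * ∑ i, Z i * X i ω : ℝ) : ℂ))
          = ∏ i, Complex.exp (Complex.I * (((√s * X i ω) * Z i : ℝ) : ℂ)) := by
        intro Z
        rw [← Complex.exp_sum, ← Finset.mul_sum, ← Complex.ofReal_sum, Finset.mul_sum]
        congr 4; ext i; ring
      simp_rw [this]
      rw [integral_fintype_prod_eq_prod
        (f := fun i z => Complex.exp (Complex.I * (((√s * X i ω) * z : ℝ) : ℂ)))]
      simp_rw [gauss_char]
      rw [← Complex.ofReal_prod, ← exp_sum]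
      congr 2
      rw [Finset.mul_sum]
      congr 1; ext i
      rw [mul_pow, Real.sq_sqrt hs]; ring
    simp_rw [h1]
    rw [integral_integral_swap]
    · congr 1; ext Z
      have := hchar (fun i => √s * Z i)
      have e : ∀ ω, (∑ i, √s * Z i * X i ω) = √s * ∑ i, Z i * X i ω := by
        intro ω; rw [Finset.mul_sum]; congr 1; ext i; ring
      simp_rw [e] at this
      rw [this]
      congr 2
      simp_rw [mul_smul]
      rw [← Finset.smul_sum, norm_smul, mul_pow, Real.norm_of_nonneg (sqrt_nonneg _),
        Real.sq_sqrt hs]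
      ring
    · apply Integrable.of_bound (C := 1)
      · apply Measurable.aestronglyMeasurable
        have : ∀ i, Measurable (X i) := hX
        simp only [Function.uncurry_def]
        fun_prop
      · refine Eventually.of_forall fun p => ?_
        simp only [Function.uncurry_def]
        rw [mul_comm, Complex.norm_exp_ofReal_mul_I]
  rw [integral_complex_ofReal, integral_complex_ofReal] at key
  exact_mod_cast key
lemma gauss_orth {ι V : Type*} [Fintype ι] [NormedAddCommGroup V] [InnerProductSpace ℝ V]
    (g : ι → V) (horth : ∀ i j, i ≠ j → inner ℝ (g i) (g j) = 0) (s : ℝ) (hs : 0 ≤ s) :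
    ∫ Z, exp (-(s / 2) * ‖∑ i, Z i • g i‖ ^ 2) ∂(gaussPi ι)
      = ∏ i, (√(1 + s * ‖g i‖ ^ 2))⁻¹ := by
  classical
  have h1 : ∀ Z : ι → ℝ, exp (-(s / 2) * ‖∑ i, Z i • g i‖ ^ 2)
      = ∏ i, exp (-((s * ‖g i‖ ^ 2) / 2) * (Z i) ^ 2) := by
    intro Z
    rw [← exp_sum]
    congr 1
    rw [← real_inner_self_eq_norm_sq, sum_inner, Finset.mul_sum]
    congr 1; ext i
    rw [inner_sum, Finset.sum_eq_single i]
    · rw [real_inner_smul_left, real_inner_smul_right, real_inner_self_eq_norm_sq]; ring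
    · intro j _ hj
      rw [real_inner_smul_left, real_inner_smul_right, horth i j hj.symm]; ring
    · simp
  simp_rw [h1]
  rw [integral_fintype_prod_eq_prod (f := fun i z => exp (-((s * ‖g i‖ ^ 2) / 2) * z ^ 2))]
  congr 1; ext i
  exact gauss_sq _ (by positivity)
lemma gauss_hadamard {ι V : Type*} [Fintype ι] [NormedAddCommGroup V] [InnerProductSpace ℝ V]
    (g : ι → V) (s : ℝ) (hs : 0 ≤ s) :
    ∏ i, (√(1 + s * ‖g i‖ ^ 2))⁻¹ ≤
    ∫ Z, exp (-(s / 2) * ‖∑ i, Z i • g i‖ ^ 2) ∂(gaussPi ι) := by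
  classical
  set w : (ι → ℝ) → ℝ := fun Z => ∏ i, exp (-((s * ‖g i‖ ^ 2) / 2) * (Z i) ^ 2) with hw
  have hwint : ∫ Z, w Z ∂(gaussPi ι) = ∏ i, (√(1 + s * ‖g i‖ ^ 2))⁻¹ := by
    rw [hw, integral_fintype_prod_eq_prod
      (f := fun i z => exp (-((s * ‖g i‖ ^ 2) / 2) * z ^ 2))]
    congr 1; ext i
    exact gauss_sq _ (by positivity)
  have hw0 : ∀ Z, 0 ≤ w Z := fun Z => Finset.prod_nonneg fun i _ => (exp_pos _).le
  have hw1 : ∀ Z, w Z ≤ 1 := fun Z => Finset.prod_le_one (fun i _ => (exp_pos _).le)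
    fun i _ => by
      rw [exp_le_one_iff, neg_mul, neg_nonpos]; positivity
  have hwm : Measurable w := by
    rw [hw]; fun_prop
  have hzint : ∀ i : ι, Integrable (fun Z : ι → ℝ => (Z i) ^ 2) (gaussPi ι) := by
    intro i
    have h2 : Integrable (fun z : ℝ => z ^ 2) (ProbabilityTheory.gaussianReal 0 1) :=
      (ProbabilityTheory.memLp_id_gaussianReal (μ := 0) (v := 1) 2).integrable_sq
    exact (measurePreserving_eval (fun _ : ι => ProbabilityTheory.gaussianReal 0 1) i).integrable_comp_of_integrable h2
  have hcrossint : ∀ i j : ι, Integrable (fun Z : ι → ℝ => w Z * (Z i * Z j)) (gaussPi ι) := by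
    intro i j
    apply Integrable.mono' ((hzint i).add (hzint j))
    · exact (hwm.mul ((measurable_pi_apply i).mul (measurable_pi_apply j))).aestronglyMeasurable
    · refine Eventually.of_forall fun Z => ?_
      simp only [Pi.add_apply]
      rw [norm_mul, Real.norm_of_nonneg (hw0 Z), Real.norm_eq_abs, abs_mul]
      have := hw1 Z
      have h0 := hw0 Z
      have h3 : |Z i| * |Z j| ≤ Z i ^ 2 + Z j ^ 2 := by
        nlinarith [sq_nonneg (|Z i| - |Z j|), sq_abs (Z i), sq_abs (Z j), sq_nonneg (Z i), sq_nonneg (Z j)]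
      calc w Z * (|Z i| * |Z j|) ≤ 1 * (|Z i| * |Z j|) := by gcongr
        _ ≤ _ := by rw [one_mul]; exact h3
  have hcross : ∀ i j : ι, i ≠ j → ∫ Z, w Z * (Z i * Z j) ∂(gaussPi ι) = 0 := by
    intro i j hij
    have : ∀ Z : ι → ℝ, w Z * (Z i * Z j)
        = ∏ k, (exp (-((s * ‖g k‖ ^ 2) / 2) * (Z k) ^ 2) *
            (if k = i then Z k else if k = j then Z k else 1)) := by
      intro Z
      rw [Finset.prod_mul_distrib]
      congr 1
      rw [← Finset.mul_prod_erase Finset.univ _ (Finset.mem_univ i)]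
      rw [← Finset.mul_prod_erase (Finset.univ.erase i) _ (a := j) (by simp [hij.symm])]
      rw [Finset.prod_eq_one]
      · simp [hij.symm]
      · intro k hk
        simp only [Finset.mem_erase, Finset.mem_univ, and_true] at hk
        simp [hk.1, hk.2]
    simp_rw [this]
    rw [integral_fintype_prod_eq_prod (f := fun k z => exp (-((s * ‖g k‖ ^ 2) / 2) * z ^ 2) *
            (if k = i then z else if k = j then z else 1))]
    apply Finset.prod_eq_zero (Finset.mem_univ i)
    simp only [if_true]
    set c := -((s * ‖g i‖ ^ 2) / 2)
    have hmap := ProbabilityTheory.gaussianReal_map_neg (μ := 0) (v := 1)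
    rw [neg_zero] at hmap
    have h1 : ∫ z, exp (c * z ^ 2) * z ∂(ProbabilityTheory.gaussianReal 0 1)
        = ∫ z, exp (c * (-z) ^ 2) * (-z) ∂(ProbabilityTheory.gaussianReal 0 1) := by
      conv_lhs => rw [← hmap]
      rw [integral_map (by fun_prop) (by fun_prop)]
    simp only [neg_sq, mul_neg] at h1
    rw [integral_neg] at h1
    linarith
  set R : (ι → ℝ) → ℝ := fun Z => ∑ i, ∑ j ∈ Finset.univ.erase i,
    (-(s / 2) * inner ℝ (g i) (g j)) * (w Z * (Z i * Z j)) with hR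
  have hRint : Integrable R (gaussPi ι) := by
    apply integrable_finsetSum; intro i _
    apply integrable_finsetSum; intro j _
    exact (hcrossint i j).const_mul _
  have hR0 : ∫ Z, R Z ∂(gaussPi ι) = 0 := by
    rw [hR, integral_finsetSum]
    · apply Finset.sum_eq_zero; intro i _
      rw [integral_finsetSum]
      · apply Finset.sum_eq_zero; intro j hj
        rw [integral_const_mul, hcross i j (Finset.ne_of_mem_erase hj).symm, mul_zero]
      · intro j _; exact (hcrossint i j).const_mul _
    · intro i _
      apply integrable_finsetSum; intro j _
      exact (hcrossint i j).const_mul _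
  have hwI : Integrable w (gaussPi ι) := by
    apply Integrable.of_bound (C := 1) hwm.aestronglyMeasurable
    refine Eventually.of_forall fun Z => ?_
    rw [Real.norm_of_nonneg (hw0 Z)]; exact hw1 Z
  rw [← hwint, ← add_zero (∫ Z, w Z ∂(gaussPi ι)), ← hR0, ← integral_add hwI hRint]
  apply integral_mono (hwI.add hRint)
  · apply Integrable.of_bound (C := 1)
    · apply Continuous.aestronglyMeasurable; fun_prop
    · refine Eventually.of_forall fun Z => ?_
      rw [Real.norm_of_nonneg (exp_pos _).le, exp_le_one_iff, neg_mul, neg_nonpos]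
      positivity
  · intro Z
    simp only [Pi.add_apply]
    have hexp : -(s / 2) * ‖∑ i, Z i • g i‖ ^ 2
        = (∑ i, -((s * ‖g i‖ ^ 2) / 2) * (Z i) ^ 2) +
          ∑ i, ∑ j ∈ Finset.univ.erase i, (-(s / 2) * inner ℝ (g i) (g j)) * (Z i * Z j) := by
      rw [← real_inner_self_eq_norm_sq, sum_inner, Finset.mul_sum, ← Finset.sum_add_distrib]
      congr 1; ext i
      rw [inner_sum, ← Finset.add_sum_erase Finset.univ _ (Finset.mem_univ i), mul_add,
        Finset.mul_sum]
      congr 1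
      · rw [real_inner_smul_left, real_inner_smul_right, real_inner_self_eq_norm_sq]; ring
      · congr 1; ext j
        rw [real_inner_smul_left, real_inner_smul_right]; ring
    rw [hexp, exp_add, exp_sum]
    have hRw : R Z = w Z * ∑ i, ∑ j ∈ Finset.univ.erase i,
        (-(s / 2) * inner ℝ (g i) (g j)) * (Z i * Z j) := by
      rw [hR, Finset.mul_sum]
      refine Finset.sum_congr rfl fun i _ => ?_
      rw [Finset.mul_sum]
      refine Finset.sum_congr rfl fun j _ => ?_
      ring
    rw [hRw]
    set y := ∑ i, ∑ j ∈ Finset.univ.erase i, (-(s / 2) * inner ℝ (g i) (g j)) * (Z i * Z j)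
    have := add_one_le_exp y
    have h0 := hw0 Z
    calc w Z + w Z * y = w Z * (y + 1) := by ring
      _ ≤ w Z * exp y := by gcongr
end
section
lemma gaussPi_char {ι : Type*} [Fintype ι] (c : ι → ℝ) :
    ∫ Z, Complex.exp (Complex.I * ((∑ i, Z i * c i : ℝ) : ℂ)) ∂(gaussPi ι)
      = (exp (-(∑ i, c i ^ 2) / 2) : ℂ) := by
  have : ∀ Z : ι → ℝ, Complex.exp (Complex.I * ((∑ i, Z i * c i : ℝ) : ℂ))
      = ∏ i, Complex.exp (Complex.I * ((c i * Z i : ℝ) : ℂ)) := by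
    intro Z
    rw [← Complex.exp_sum, ← Finset.mul_sum, ← Complex.ofReal_sum]
    congr 4; ext i; ring
  simp_rw [this]
  rw [integral_fintype_prod_eq_prod
    (f := fun i z => Complex.exp (Complex.I * ((c i * z : ℝ) : ℂ)))]
  simp_rw [gauss_char]
  rw [← Complex.ofReal_prod, ← exp_sum]
  congr 2
  rw [neg_div, Finset.sum_div, ← Finset.sum_neg_distrib]
  congr 1; ext i; ring
lemma gauss_primal {ι ρ : Type*} [Fintype ι] [Fintype ρ] (c : ι → ρ → ℝ) (s : ℝ) (hs : 0 ≤ s) :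
    ∫ γ, exp (-(s / 2) * ∑ i, (∑ r, γ r * c i r) ^ 2) ∂(gaussPi ρ)
      = ∫ Z, exp (-(s / 2) * ‖∑ i, Z i • (WithLp.toLp 2 (c i) : EuclideanSpace ℝ ρ)‖ ^ 2)
        ∂(gaussPi ι) := by
  refine gauss_dual (gaussPi ρ) (fun (i : ι) (γ : ρ → ℝ) => ∑ r, γ r * c i r) (fun i => by fun_prop)
    (fun i => (WithLp.toLp 2 (c i) : EuclideanSpace ℝ ρ)) ?_ s hs
  intro z
  have : ∀ γ : ρ → ℝ, ∑ i, z i * ∑ r, γ r * c i r = ∑ r, γ r * ∑ i, z i * c i r := by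
    intro γ
    simp_rw [Finset.mul_sum]
    rw [Finset.sum_comm]
    congr 1; ext r; congr 1; ext i; ring
  simp_rw [this]
  rw [gaussPi_char]
  congr 3
  rw [EuclideanSpace.norm_sq_eq]
  congr 1
  refine Finset.sum_congr rfl fun r _ => ?_
  simp
lemma gauss_compare {ι κ V : Type*} [Fintype ι] [Countable κ] [NormedAddCommGroup V]
    [InnerProductSpace ℝ V] (g : ι → V) (b : κ → V) (s : ℝ) (hs : 0 ≤ s)
    (hle : ∀ ζ : V, Summable (fun k => inner ℝ (b k) ζ ^ 2) ∧
      ∑ i, inner ℝ (g i) ζ ^ 2 ≤ ∑' k, inner ℝ (b k) ζ ^ 2)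
    (R : ℝ) (hR : ∀ K : Finset κ, ∑ k ∈ K, log (1 + s * ‖b k‖ ^ 2) ≤ R) :
    exp (-R / 2) ≤ ∫ Z, exp (-(s / 2) * ‖∑ i, Z i • g i‖ ^ 2) ∂(gaussPi ι) := by
  classical
  set F : Submodule ℝ V := Submodule.span ℝ (Set.range g) with hF
  have : FiniteDimensional ℝ F := FiniteDimensional.span_of_finite ℝ (Set.finite_range g)
  set e := stdOrthonormalBasis ℝ F
  set ζ : (Fin (Module.finrank ℝ F) → ℝ) → V := fun γ => ∑ r, γ r • (e r : V) with hζ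
  have hinner : ∀ v γ, inner ℝ v (ζ γ) = ∑ r, γ r * inner ℝ v (e r : V) := by
    intro v γ
    rw [hζ, inner_sum]; congr 1; ext r; rw [real_inner_smul_right]
  have hon : Orthonormal ℝ (fun r => (e r : V)) := by
    have := e.orthonormal
    exact this.comp_linearIsometry F.subtypeₗᵢ
  have h1 : ∫ Z, exp (-(s / 2) * ‖∑ i, Z i • g i‖ ^ 2) ∂(gaussPi ι)
      = ∫ γ, exp (-(s / 2) * ∑ i, inner ℝ (g i) (ζ γ) ^ 2) ∂(gaussPi _) := by
    simp_rw [hinner]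
    rw [gauss_primal (fun i r => inner ℝ (g i) (e r : V)) s hs]
    congr 1; ext Z; congr 2
    have hv : (∑ i, Z i • g i) ∈ F :=
      Submodule.sum_mem _ fun i _ => Submodule.smul_mem _ _ (Submodule.subset_span ⟨i, rfl⟩)
    have h2 := e.sum_sq_norm_inner_right ⟨_, hv⟩
    rw [EuclideanSpace.norm_sq_eq]
    have h3 : ‖(⟨_, hv⟩ : F)‖ = ‖∑ i, Z i • g i‖ := rfl
    rw [← h3, ← h2]
    refine Finset.sum_congr rfl fun r _ => ?_
    congr 2
    simp only [WithLp.ofLp_sum, Finset.sum_apply, PiLp.smul_apply, smul_eq_mul]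
    rw [Submodule.coe_inner, inner_sum]
    refine Finset.sum_congr rfl fun i _ => ?_
    rw [real_inner_smul_right, real_inner_comm]
  have h2 : ∀ K : Finset κ, exp (-R / 2) ≤
      ∫ γ, exp (-(s / 2) * ∑ k ∈ K, inner ℝ (b k) (ζ γ) ^ 2) ∂(gaussPi _) := by
    intro K
    have e1 : ∫ γ, exp (-(s / 2) * ∑ k ∈ K, inner ℝ (b k) (ζ γ) ^ 2) ∂(gaussPi _)
      = ∫ γ, exp (-(s / 2) * ∑ k : K, (∑ r, γ r * inner ℝ (b k) (e r : V)) ^ 2) ∂(gaussPi _) := by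
      simp_rw [hinner]
      congr 1; ext γ
      rw [Finset.sum_coe_sort K (fun k => (∑ r, γ r * inner ℝ (b k) (e r : V)) ^ 2)]
    rw [e1, gauss_primal (fun (k : K) r => inner ℝ (b k) (e r : V)) s hs]
    refine le_trans ?_ (gauss_hadamard _ s hs)
    have e2 : ∏ k : K, (√(1 + s * ‖b k‖ ^ 2))⁻¹ ≤ ∏ k : K, (√(1 + s *
        ‖(WithLp.toLp 2 (fun r => inner ℝ (b k) (e r : V)) : EuclideanSpace ℝ _)‖ ^ 2))⁻¹ := by
      apply Finset.prod_le_prod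
      · intro k _; positivity
      · intro k _
        have : ‖(WithLp.toLp 2 (fun r => inner ℝ (b k) (e r : V)) : EuclideanSpace ℝ _)‖ ^ 2
            ≤ ‖b k‖ ^ 2 := by
          rw [EuclideanSpace.norm_sq_eq]
          have := hon.sum_inner_products_le (b k) (s := Finset.univ)
          refine le_trans (le_of_eq ?_) this
          refine Finset.sum_congr rfl fun r _ => ?_
          simp only
          rw [real_inner_comm]
        gcongr
    refine le_trans ?_ e2
    have e3 : ∏ k : K, (√(1 + s * ‖b k‖ ^ 2))⁻¹
        = exp (-(∑ k ∈ K, log (1 + s * ‖b k‖ ^ 2)) / 2) := by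
      rw [neg_div, Finset.sum_div, ← Finset.sum_neg_distrib, exp_sum,
        Finset.prod_coe_sort K (fun k => (√(1 + s * ‖b k‖ ^ 2))⁻¹)]
      refine Finset.prod_congr rfl fun k _ => ?_
      have hp : 0 < 1 + s * ‖b k‖ ^ 2 := by positivity
      rw [exp_neg, ← log_sqrt hp.le, exp_log (by positivity)]
    rw [e3]
    have := hR K
    apply exp_le_exp.mpr; linarith
  have h3 : Tendsto (fun K : Finset κ => ∫ γ, exp (-(s / 2) * ∑ k ∈ K, inner ℝ (b k) (ζ γ) ^ 2)
      ∂(gaussPi _)) atTop (nhds (∫ γ, exp (-(s / 2) * ∑' k, inner ℝ (b k) (ζ γ) ^ 2)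
      ∂(gaussPi _))) := by
    apply tendsto_integral_filter_of_dominated_convergence (fun _ => (1:ℝ))
    · refine Eventually.of_forall fun K => ?_
      apply Measurable.aestronglyMeasurable
      simp_rw [hinner]
      fun_prop
    · refine Eventually.of_forall fun K => Eventually.of_forall fun γ => ?_
      rw [Real.norm_of_nonneg (exp_pos _).le, exp_le_one_iff, neg_mul, neg_nonpos]
      positivity
    · exact integrable_const _
    · refine Eventually.of_forall fun γ => ?_
      exact (Real.continuous_exp.tendsto _).comp (((hle (ζ γ)).1.hasSum).const_mul _)
  have h4 := ge_of_tendsto' h3 h2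
  rw [h1]
  refine h4.trans ?_
  apply integral_mono_of_nonneg
  · exact Eventually.of_forall fun γ => (exp_pos _).le
  · apply Integrable.of_bound (C := 1)
    · apply Measurable.aestronglyMeasurable
      simp_rw [hinner]
      fun_prop
    · refine Eventually.of_forall fun γ => ?_
      rw [Real.norm_of_nonneg (exp_pos _).le, exp_le_one_iff, neg_mul, neg_nonpos]
      positivity
  · refine Eventually.of_forall fun γ => ?_
    simp only
    apply exp_le_exp.mpr
    have := (hle (ζ γ)).2
    rw [neg_mul, neg_mul]
    apply neg_le_neg
    gcongr
end
section
lemma taub_aux {Φ : ℝ → ℝ} (hpos : ∀ t, 0 < t → 0 < Φ t) {α A : ℝ} (hα : 0 < α)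
    (hΦ : Tendsto (fun t => log (Φ t) / t ^ α) atTop (nhds (-A)))
    {ρ q : ℝ} (hρ : 0 < ρ) (hq : q * A + A - ρ ^ α * A < 0) :
    ∀ᶠ t in atTop, exp (q * A * t ^ α) * Φ (ρ * t) ≤ Φ t / 4 := by
  have h1 : Tendsto (fun t : ℝ => ρ * t) atTop atTop := tendsto_id.const_mul_atTop hρ
  have h2 := (hΦ.comp h1).const_mul (ρ ^ α)
  have h3 : Tendsto (fun t : ℝ => log 4 / t ^ α) atTop (nhds 0) :=
    (tendsto_rpow_atTop hα).const_div_atTop _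
  have h4 := ((h2.sub hΦ).add h3).const_add (q * A)
  have h5 : q * A + (ρ ^ α * -A - -A + 0) < 0 := by linarith
  filter_upwards [h4.eventually_lt_const h5, eventually_gt_atTop 0] with t ht ht0
  have hta : 0 < t ^ α := rpow_pos_of_pos ht0 _
  simp only [Function.comp] at ht
  rw [Real.mul_rpow hρ.le ht0.le] at ht
  have hra : 0 < ρ ^ α := rpow_pos_of_pos hρ _
  have e : q * A + (ρ ^ α * (log (Φ (ρ * t)) / (ρ ^ α * t ^ α)) - log (Φ t) / t ^ α
      + log 4 / t ^ α)
      = (q * A * t ^ α + log (Φ (ρ * t)) - log (Φ t) + log 4) / t ^ α := by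
    field_simp
    ring
  rw [e, div_lt_iff₀ hta, zero_mul] at ht
  have h6 : exp (q * A * t ^ α) * Φ (ρ * t)
      = exp (q * A * t ^ α + log (Φ (ρ * t))) := by
    rw [exp_add, exp_log (hpos _ (by positivity))]
  have h7 : Φ t / 4 = exp (log (Φ t) - log 4) := by
    rw [exp_sub, exp_log (hpos _ ht0), exp_log (by norm_num)]
  rw [h6, h7]
  apply exp_le_exp.mpr; linarith
lemma exists_small_neg {f : ℝ → ℝ} {f' : ℝ} (hf : HasDerivAt f f' 0) (h0 : f 0 = 0) (hf' : f' < 0) :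
    ∃ η, 0 < η ∧ η < 1 ∧ f η < 0 := by
  have h := hf.tendsto_slope_zero_right
  simp only [zero_add, h0, sub_zero, smul_eq_mul] at h
  have h2 := h.eventually_lt_const hf'
  have h3 : ∀ᶠ η : ℝ in nhdsWithin 0 (Ioi 0), η < 1 :=
    nhdsWithin_le_nhds (eventually_lt_nhds one_pos)
  obtain ⟨η, ⟨h4, h5⟩, h6⟩ := ((h2.and h3).and self_mem_nhdsWithin).exists
  refine ⟨η, h6, h5, ?_⟩
  have h6' : 0 < η := h6
  by_contra hc
  push Not at hc
  have : 0 ≤ η⁻¹ * f η := by positivity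
  linarith
lemma taub_lower {Ω : Type*} [MeasurableSpace Ω] (μ : Measure Ω) [IsProbabilityMeasure μ]
    (Y : Ω → ℝ) (hY : Measurable Y) (hY0 : ∀ ω, 0 ≤ Y ω) {α A : ℝ} (hα : 0 < α)
    (hA : 0 < A)
    (hΦ : Tendsto (fun t => log (∫ ω, exp (-t * Y ω) ∂μ) / t ^ α) atTop (nhds (-A)))
    (δ : ℝ) (hδ : 0 < δ) :
    ∀ᶠ t in atTop, exp (t ^ α * ((1 - δ) * α * A - A - δ)) ≤
      μ.real {ω | Y ω ≤ (1 + δ) * α * A * t ^ (α - 1)} := by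
  set Φ : ℝ → ℝ := fun t => ∫ ω, exp (-t * Y ω) ∂μ with hΦdef
  have hint : ∀ t, 0 ≤ t → Integrable (fun ω => exp (-t * Y ω)) μ := by
    intro t ht
    apply Integrable.of_bound (C := 1)
    · exact Measurable.aestronglyMeasurable (by fun_prop)
    · refine Eventually.of_forall fun ω => ?_
      rw [Real.norm_of_nonneg (exp_pos _).le, exp_le_one_iff, neg_mul, neg_nonpos]
      have := hY0 ω
      positivity
  have hpos : ∀ t, 0 < t → 0 < Φ t := fun t ht => integral_exp_pos (hint t ht.le)
  obtain ⟨η₁, h10, h11, h12⟩ : ∃ η, 0 < η ∧ η < 1 ∧ -η * (1 + δ) * α + 1 - (1 - η) ^ α < 0 := by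
    apply exists_small_neg (f := fun η => -η * (1 + δ) * α + 1 - (1 - η) ^ α) (f' := -δ * α)
    · have h1 : HasDerivAt (fun η : ℝ => (1 - η)) (-1) 0 := by
        simpa using (hasDerivAt_id (0:ℝ)).const_sub 1
      have h2 := h1.rpow_const (p := α) (Or.inl (by norm_num))
      have h3 : HasDerivAt (fun η : ℝ => -η * (1 + δ) * α + 1) (-1 * (1 + δ) * α) 0 :=
        ((((hasDerivAt_id (0:ℝ)).neg).mul_const _).mul_const _).add_const _
      refine (h3.sub h2).congr_deriv ?_
      norm_num
      try ring
    · simp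
    · have := mul_pos hδ hα; linarith
  obtain ⟨η₂, h20, h21, h22⟩ : ∃ η, 0 < η ∧ η < 1 ∧ η * (1 - δ) * α + 1 - (1 + η) ^ α < 0 := by
    apply exists_small_neg (f := fun η => η * (1 - δ) * α + 1 - (1 + η) ^ α) (f' := -δ * α)
    · have h1 : HasDerivAt (fun η : ℝ => (1 + η)) 1 0 := by
        simpa using (hasDerivAt_id (0:ℝ)).const_add 1
      have h2 := h1.rpow_const (p := α) (Or.inl (by norm_num))
      have h3 : HasDerivAt (fun η : ℝ => η * (1 - δ) * α + 1) (1 * (1 - δ) * α) 0 :=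
        ((((hasDerivAt_id (0:ℝ))).mul_const _).mul_const _).add_const _
      refine (h3.sub h2).congr_deriv ?_
      norm_num
      try ring
    · simp
    · have := mul_pos hδ hα; linarith
  have k1 := taub_aux hpos hα hΦ (ρ := 1 - η₁) (q := -η₁ * (1 + δ) * α) (by linarith)
    (by have := mul_neg_of_neg_of_pos h12 hA; linarith)
  have k2 := taub_aux hpos hα hΦ (ρ := 1 + η₂) (q := η₂ * (1 - δ) * α) (by linarith)
    (by have := mul_neg_of_neg_of_pos h22 hA; linarith)
  have h3 : Tendsto (fun t : ℝ => log 2 / t ^ α) atTop (nhds 0) :=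
    (tendsto_rpow_atTop hα).const_div_atTop _
  have h4 := hΦ.sub h3
  have h5 : -A - δ < -A - 0 := by linarith
  filter_upwards [k1, k2, h4.eventually_const_lt h5, eventually_gt_atTop 0] with t t1 t2 t3 t0
  have hta : 0 < t ^ α := rpow_pos_of_pos t0 _
  have htt : t * t ^ (α - 1) = t ^ α := by
    rw [rpow_sub_one t0.ne']; field_simp
  set b := (1 + δ) * α * A * t ^ (α - 1) with hb
  obtain ⟨c, hc⟩ : ∃ c, c = (1 - δ) * α * A * t ^ (α - 1) := ⟨_, rfl⟩
  have htb : t * b = (1 + δ) * α * A * t ^ α := by rw [hb, ← htt]; ring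
  have htc : t * c = (1 - δ) * α * A * t ^ α := by rw [hc, ← htt]; ring
  set S := {ω | Y ω ≤ b} with hS
  have hSm : MeasurableSet S := measurableSet_le hY measurable_const
  have hpt : ∀ ω, exp (-t * Y ω) ≤
      exp (-η₁ * (1 + δ) * α * A * t ^ α) * exp (-((1 - η₁) * t) * Y ω)
      + exp (η₂ * (1 - δ) * α * A * t ^ α) * exp (-((1 + η₂) * t) * Y ω)
      + exp (-(t * c)) * S.indicator (fun _ => (1:ℝ)) ω := by
    intro ω
    rw [← exp_add, ← exp_add]
    have i0 : 0 ≤ S.indicator (fun _ => (1:ℝ)) ω := indicator_nonneg (fun _ _ => zero_le_one) _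
    by_cases hY1 : b < Y ω
    · have : exp (-t * Y ω) ≤ exp (-η₁ * (1 + δ) * α * A * t ^ α + -((1 - η₁) * t) * Y ω) := by
        apply exp_le_exp.mpr
        have : t * b ≤ t * Y ω := by gcongr
        rw [htb] at this
        have := mul_le_mul_of_nonneg_left this h10.le
        linarith
      have := (exp_pos (η₂ * (1 - δ) * α * A * t ^ α + -((1 + η₂) * t) * Y ω)).le
      have : 0 ≤ exp (-(t * c)) * S.indicator (fun _ => (1:ℝ)) ω := by positivity
      linarith
    · push Not at hY1
      have i1 : S.indicator (fun _ => (1:ℝ)) ω = 1 := indicator_of_mem (s := S) (by simpa [hS] using hY1) _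
      rw [i1]
      have p1 := (exp_pos (-η₁ * (1 + δ) * α * A * t ^ α + -((1 - η₁) * t) * Y ω)).le
      have p2 := (exp_pos (η₂ * (1 - δ) * α * A * t ^ α + -((1 + η₂) * t) * Y ω)).le
      have p3 := (exp_pos (-(t * c))).le
      by_cases hY2 : Y ω < c
      · have : exp (-t * Y ω) ≤ exp (η₂ * (1 - δ) * α * A * t ^ α + -((1 + η₂) * t) * Y ω) := by
          apply exp_le_exp.mpr
          have : t * Y ω ≤ t * c := by gcongr
          rw [htc] at this
          have := mul_le_mul_of_nonneg_left this h20.le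
          linarith
        linarith
      · push Not at hY2
        have : exp (-t * Y ω) ≤ exp (-(t * c)) := by
          apply exp_le_exp.mpr
          have : t * c ≤ t * Y ω := by gcongr
          linarith
        linarith
  have j1 := (hint ((1 - η₁) * t) (mul_nonneg (by linarith) t0.le)).const_mul (exp (-η₁ * (1 + δ) * α * A * t ^ α))
  have j2 := (hint ((1 + η₂) * t) (mul_nonneg (by linarith) t0.le)).const_mul (exp (η₂ * (1 - δ) * α * A * t ^ α))
  have j3 : Integrable (fun ω => exp (-(t * c)) * S.indicator (fun _ => (1:ℝ)) ω) μ :=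
    ((integrable_const (1:ℝ)).indicator hSm).const_mul _
  have hI := integral_mono (hint t t0.le) ((j1.add j2).add j3) hpt
  simp only [Pi.add_apply] at hI
  rw [integral_add (f := fun ω => _ + _) (j1.add j2) j3, integral_add j1 j2, integral_const_mul,
    integral_const_mul, integral_const_mul,
    integral_indicator_const _ hSm] at hI
  simp only [smul_eq_mul, mul_one] at hI
  have hI2 : Φ t ≤ Φ t / 4 + Φ t / 4 + exp (-(t * c)) * μ.real S := by
    refine hI.trans ?_
    exact add_le_add (add_le_add t1 t2) le_rfl
  have hI3 : exp (t * c) * (Φ t / 2) ≤ μ.real S := by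
    have : exp (t * c) * (Φ t / 2) ≤ exp (t * c) * (exp (-(t * c)) * μ.real S) := by
      gcongr; linarith
    rwa [← mul_assoc, ← exp_add, add_neg_cancel, exp_zero, one_mul] at this
  refine le_trans ?_ hI3
  have h7 : exp (t * c) * (Φ t / 2) = exp (t * c + (log (Φ t) - log 2)) := by
    rw [exp_add, exp_sub, exp_log (hpos _ t0), exp_log (by norm_num)]
  rw [h7]
  apply exp_le_exp.mpr
  rw [htc]
  rw [← sub_div, lt_div_iff₀ hta] at t3
  change (-A - δ) * t ^ α < log (Φ t) - log 2 at t3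
  linarith
lemma tauberian {Ω : Type*} [MeasurableSpace Ω] (μ : Measure Ω) [IsProbabilityMeasure μ]
    (Y : Ω → ℝ) (hY : Measurable Y) (hY0 : ∀ ω, 0 ≤ Y ω) {α A : ℝ} (hα : 0 < α) (hα1 : α < 1)
    (hA : 0 < A)
    (hΦ : Tendsto (fun t => log (∫ ω, exp (-t * Y ω) ∂μ) / t ^ α) atTop (nhds (-A))) :
    Tendsto (fun y : ℝ => y ^ (α / (1 - α)) * log (μ.real {ω | Y ω ≤ y}))
      (nhdsWithin 0 (Ioi 0)) (nhds (-((1 - α) * A * (α * A) ^ (α / (1 - α))))) := by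
  set γ := α / (1 - α) with hγ
  have h1α : 0 < 1 - α := by linarith
  have hγ0 : 0 < γ := by positivity
  set T : ℝ → ℝ → ℝ := fun K y => (K / y) ^ (1 / (1 - α)) with hT
  have hTtop : ∀ K, 0 < K → Tendsto (T K) (nhdsWithin 0 (Ioi 0)) atTop := by
    intro K hK
    have : Tendsto (fun y : ℝ => K / y) (nhdsWithin 0 (Ioi 0)) atTop := by
      simp_rw [div_eq_mul_inv]
      exact tendsto_inv_nhdsGT_zero.const_mul_atTop hK
    exact (tendsto_rpow_atTop (by positivity)).comp this
  have hT1 : ∀ K y, 0 < K → 0 < y → K * T K y ^ (α - 1) = y := by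
    intro K y hK hy
    rw [hT]; simp only
    rw [← rpow_mul (by positivity), show 1 / (1 - α) * (α - 1) = -1 by field_simp; ring,
      rpow_neg_one]
    field_simp
  have hT2 : ∀ K y, 0 < K → 0 < y → y ^ γ * T K y ^ α = K ^ γ := by
    intro K y hK hy
    rw [hT]; simp only
    rw [← rpow_mul (by positivity), show 1 / (1 - α) * α = γ by rw [hγ]; ring,
      Real.div_rpow hK.le hy.le]
    have := rpow_pos_of_pos hy γ
    field_simp
  have hlow : ∀ δ, 0 < δ → ∀ᶠ y in nhdsWithin 0 (Ioi 0), 0 < μ.real {ω | Y ω ≤ y} ∧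
      ((1 + δ) * α * A) ^ γ * ((1 - δ) * α * A - A - δ) ≤
        y ^ γ * log (μ.real {ω | Y ω ≤ y}) := by
    intro δ hδ
    have hK : 0 < (1 + δ) * α * A := by positivity
    have := (hTtop _ hK).eventually (taub_lower μ Y hY hY0 hα hA hΦ δ hδ)
    filter_upwards [this, self_mem_nhdsWithin] with y hy hy0
    rw [hT1 _ y hK hy0] at hy
    have hp : 0 < μ.real {ω | Y ω ≤ y} := lt_of_lt_of_le (exp_pos _) hy
    refine ⟨hp, ?_⟩
    have := (Real.le_log_iff_exp_le hp).mpr hy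
    rw [← hT2 _ y hK hy0, mul_assoc]
    have hy0' : 0 < y := hy0
    gcongr
  have hup : ∀ᶠ y in nhdsWithin 0 (Ioi 0), y ^ γ * log (μ.real {ω | Y ω ≤ y}) ≤
      (α * A) ^ γ * (α * A + log (∫ ω, exp (-(T (α * A) y) * Y ω) ∂μ) / (T (α * A) y) ^ α) := by
    have hK : 0 < α * A := by positivity
    filter_upwards [hlow 1 one_pos, self_mem_nhdsWithin, (hTtop _ hK).eventually_gt_atTop 0]
      with y hy hy0 hTy
    have hy0' : 0 < y := hy0
    set t := T (α * A) y with ht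
    have hm : MeasurableSet {ω | Y ω ≤ y} := measurableSet_le hY measurable_const
    have hint : Integrable (fun ω => exp (-t * Y ω)) μ := by
      apply Integrable.of_bound (C := 1)
      · exact Measurable.aestronglyMeasurable (by fun_prop)
      · refine Eventually.of_forall fun ω => ?_
        rw [Real.norm_of_nonneg (exp_pos _).le, exp_le_one_iff, neg_mul, neg_nonpos]
        have := hY0 ω
        positivity
    have h1 : exp (-(t * y)) * μ.real {ω | Y ω ≤ y} ≤ ∫ ω, exp (-t * Y ω) ∂μ := by
      have e : exp (-(t * y)) * μ.real {ω | Y ω ≤ y}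
          = ∫ ω, {ω | Y ω ≤ y}.indicator (fun _ => exp (-(t * y))) ω ∂μ := by
        rw [integral_indicator_const _ hm, smul_eq_mul, mul_comm]
      rw [e]
      apply integral_mono ((integrable_const _).indicator hm) hint
      intro ω
      by_cases hω : Y ω ≤ y
      · simp only [indicator, mem_ofPred_eq, hω, if_true]
        apply exp_le_exp.mpr
        have : t * Y ω ≤ t * y := by gcongr
        linarith
      · simp only [indicator, mem_ofPred_eq, hω, if_false]
        positivity
    have h2 : log (μ.real {ω | Y ω ≤ y}) ≤ t * y + log (∫ ω, exp (-t * Y ω) ∂μ) := by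
      have := log_le_log (mul_pos (exp_pos _) hy.1) h1
      rw [log_mul (exp_pos _).ne' hy.1.ne', log_exp] at this
      linarith
    have hta : 0 < t ^ α := rpow_pos_of_pos hTy _
    have hty : t * y = α * A * t ^ α := by
      conv_lhs => rw [← hT1 _ y hK hy0]
      change t * (α * A * t ^ (α - 1)) = _
      rw [rpow_sub_one hTy.ne']; field_simp
    rw [← hT2 _ y hK hy0, mul_assoc]
    change _ ≤ y ^ γ * (t ^ α * _)
    have : t ^ α * (α * A + log (∫ ω, exp (-t * Y ω) ∂μ) / t ^ α)
        = t * y + log (∫ ω, exp (-t * Y ω) ∂μ) := by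
      rw [hty]; field_simp
    rw [this]
    gcongr
  rw [tendsto_order]
  constructor
  · intro a ha
    have hc : Tendsto (fun δ : ℝ => ((1 + δ) * α * A) ^ γ * ((1 - δ) * α * A - A - δ))
        (nhdsWithin 0 (Ioi 0)) (nhds (((1 + 0) * α * A) ^ γ * ((1 - 0) * α * A - A - 0))) := by
      apply tendsto_nhdsWithin_of_tendsto_nhds
      apply Continuous.tendsto
        (f := fun δ : ℝ => ((1 + δ) * α * A) ^ γ * ((1 - δ) * α * A - A - δ))
      have : Continuous (fun δ : ℝ => ((1 + δ) * α * A) ^ γ) :=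
        (by fun_prop : Continuous (fun δ : ℝ => (1 + δ) * α * A)).rpow_const (fun _ => Or.inr hγ0.le)
      fun_prop
    have e : ((1 + 0) * α * A) ^ γ * ((1 - 0) * α * A - A - 0) = -((1 - α) * A * (α * A) ^ γ) := by
      simp; ring
    rw [e] at hc
    obtain ⟨δ, h1, h2⟩ := ((hc.eventually_const_lt ha).and self_mem_nhdsWithin).exists
    filter_upwards [hlow δ h2] with y hy
    exact lt_of_lt_of_le h1 hy.2
  · intro a ha
    have h1 := (((hΦ.comp (hTtop (α * A) (by positivity))).const_add (α * A)).const_mul ((α * A) ^ γ))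
    have e : (α * A) ^ γ * (α * A + -A) = -((1 - α) * A * (α * A) ^ γ) := by ring
    rw [e] at h1
    filter_upwards [hup, h1.eventually_lt_const ha] with y h2 h3
    exact lt_of_le_of_lt h2 h3
end
section
lemma lint_exp_neg (q : ℝ) (hq : 0 < q) :
    ∫⁻ u in Ioi (0:ℝ), ENNReal.ofReal (exp (-(q * u))) = ENNReal.ofReal (1 / q) := by
  have h := Real.integral_rpow_mul_exp_neg_mul_Ioi (a := 1) (r := q) one_pos hq
  simp only [sub_self, rpow_zero, one_mul, rpow_one, Real.Gamma_one, mul_one] at h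
  rw [← h, ofReal_integral_eq_lintegral_ofReal]
  · by_contra hc
    have := integral_undef hc
    rw [h] at this
    have : 0 < 1 / q := by positivity
    linarith
  · exact Eventually.of_forall fun u => (exp_pos _).le
lemma lint_of_integral_pos {α : Type*} [MeasurableSpace α] {μ : Measure α} {f : α → ℝ} {c : ℝ}
    (h : ∫ x, f x ∂μ = c) (hc : 0 < c) (h0 : 0 ≤ᵐ[μ] f) :
    ∫⁻ x, ENNReal.ofReal (f x) ∂μ = ENNReal.ofReal c := by
  rw [← h, ofReal_integral_eq_lintegral_ofReal _ h0]
  by_contra hc'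
  have := integral_undef hc'
  rw [h] at this
  linarith
lemma log_lint (x p : ℝ) (hx : 0 < x) :
    ENNReal.ofReal (log (1 + x ^ (-p)))
      = ∫⁻ s in Ioo (0:ℝ) 1, ENNReal.ofReal (1 / (x ^ p + s)) := by
  have hxp : 0 < x ^ p := rpow_pos_of_pos hx _
  have h1 : ∫ s in (0:ℝ)..1, 1 / (x ^ p + s) = log (1 + x ^ (-p)) := by
    rw [intervalIntegral.integral_comp_add_left (fun s => 1 / s), integral_one_div_of_pos
      (by linarith) (by linarith)]
    congr 1
    rw [rpow_neg hx.le]; field_simp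
    ring
  rw [intervalIntegral.integral_of_le zero_le_one, integral_Ioc_eq_integral_Ioo] at h1
  symm
  apply lint_of_integral_pos h1
  · apply log_pos
    have := rpow_pos_of_pos hx (-p)
    linarith
  · filter_upwards [ae_restrict_mem measurableSet_Ioo] with s hs
    have := hs.1
    simp only [Pi.zero_apply]
    positivity
lemma J_lint (p : ℝ) (hp : 1 < p) :
    ∫⁻ x in Ioi (0:ℝ), ENNReal.ofReal (log (1 + x ^ (-p)))
      = ENNReal.ofReal (π / sin (π / p)) := by
  have hp0 : 0 < p := by linarith
  have hip : 1 / p < 1 := by rw [div_lt_one hp0]; exact hp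
  have hip0 : 0 < 1 / p := by positivity
  have hG1 : 0 < Real.Gamma (1 / p) := Real.Gamma_pos_of_pos hip0
  have hG2 : 0 < Real.Gamma (1 - 1 / p) := Real.Gamma_pos_of_pos (by linarith)
  have s1 : ∫⁻ x in Ioi (0:ℝ), ENNReal.ofReal (log (1 + x ^ (-p)))
      = ∫⁻ x in Ioi (0:ℝ), ∫⁻ s in Ioo (0:ℝ) 1, ENNReal.ofReal (1 / (x ^ p + s)) :=
    setLIntegral_congr_fun measurableSet_Ioi fun x hx => log_lint x p hx
  rw [s1, lintegral_lintegral_swap (by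
    apply Measurable.aemeasurable; simp only [Function.uncurry_def]; fun_prop)]
  have s2 : ∀ s ∈ Ioo (0:ℝ) 1, ∫⁻ x in Ioi (0:ℝ), ENNReal.ofReal (1 / (x ^ p + s))
      = ENNReal.ofReal (s ^ (1 / p - 1) * ((1 / p) * Real.Gamma (1 / p) * Real.Gamma (1 - 1 / p))) := by
    intro s hs
    have hs0 := hs.1
    have e1 : ∫⁻ x in Ioi (0:ℝ), ENNReal.ofReal (1 / (x ^ p + s))
        = ∫⁻ x in Ioi (0:ℝ), ∫⁻ u in Ioi (0:ℝ), ENNReal.ofReal (exp (-((x ^ p + s) * u))) := by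
      refine setLIntegral_congr_fun measurableSet_Ioi fun x hx => ?_
      have hx0 : 0 < x := hx
      have := rpow_pos_of_pos hx0 p
      exact (lint_exp_neg _ (by positivity)).symm
    rw [e1, lintegral_lintegral_swap (by
      apply Measurable.aemeasurable; simp only [Function.uncurry_def]; fun_prop)]
    have e2 : ∀ u ∈ Ioi (0:ℝ), ∫⁻ x in Ioi (0:ℝ), ENNReal.ofReal (exp (-((x ^ p + s) * u)))
        = ENNReal.ofReal ((1 / p) * Real.Gamma (1 / p)) *
          ENNReal.ofReal (u ^ ((1 - 1 / p) - 1) * exp (-(s * u))) := by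
      intro u hu
      have hu0 : 0 < u := hu
      have h := integral_rpow_mul_exp_neg_mul_rpow (p := p) (q := 0) (b := u) hp0 (by norm_num) hu0
      simp only [rpow_zero, one_mul, zero_add] at h
      have h' := lint_of_integral_pos h (by positivity)
        (Eventually.of_forall fun x => (exp_pos _).le)
      have e3 : ∀ x : ℝ, ENNReal.ofReal (exp (-((x ^ p + s) * u)))
          = ENNReal.ofReal (exp (-(s * u))) * ENNReal.ofReal (exp (-u * x ^ p)) := by
        intro x
        rw [← ENNReal.ofReal_mul (exp_pos _).le, ← exp_add]
        congr 2; ring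
      simp_rw [e3]
      rw [lintegral_const_mul _ (by fun_prop), h', ← ENNReal.ofReal_mul (exp_pos _).le,
        ← ENNReal.ofReal_mul (by positivity)]
      congr 1
      rw [show 1 - 1 / p - 1 = -1 / p by ring]; ring
    rw [setLIntegral_congr_fun measurableSet_Ioi e2, lintegral_const_mul _ (by fun_prop)]
    have h := Real.integral_rpow_mul_exp_neg_mul_Ioi (a := 1 - 1 / p) (r := s) (by linarith) hs0
    rw [lint_of_integral_pos h (by positivity), ← ENNReal.ofReal_mul (by positivity)]
    · congr 1
      rw [one_div s, Real.inv_rpow hs0.le, ← rpow_neg hs0.le,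
        show -(1 - 1 / p) = 1 / p - 1 by ring]
      ring
    · filter_upwards [ae_restrict_mem measurableSet_Ioi] with u hu
      have hu0 : 0 < u := hu
      simp only [Pi.zero_apply]
      positivity
  rw [setLIntegral_congr_fun measurableSet_Ioo s2]
  apply lint_of_integral_pos
  · rw [integral_mul_const, ← integral_Ioc_eq_integral_Ioo,
      ← intervalIntegral.integral_of_le zero_le_one, integral_rpow (Or.inl (by linarith))]
    have hr := Real.Gamma_mul_Gamma_one_sub (1 / p)
    rw [mul_assoc, hr]
    simp only [sub_add_cancel, Real.one_rpow, Real.zero_rpow hip0.ne', sub_zero]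
    rw [mul_one_div]
    field_simp
  · apply div_pos pi_pos
    apply sin_pos_of_pos_of_lt_pi (by positivity)
    rw [div_lt_iff₀ hp0]
    nlinarith [pi_pos]
  · filter_upwards [ae_restrict_mem measurableSet_Ioo] with s hs
    have := hs.1
    simp only [Pi.zero_apply]
    positivity
lemma sin_pi_div_pos (p : ℝ) (hp : 1 < p) : 0 < sin (π / p) := by
  apply sin_pos_of_pos_of_lt_pi (by positivity)
  rw [div_lt_iff₀ (by linarith)]
  nlinarith [pi_pos]
lemma J_scaled (p c : ℝ) (hp : 1 < p) (hc : 0 < c) :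
    IntegrableOn (fun x : ℝ => log (1 + c * x ^ (-p))) (Ioi 0) ∧
    ∫ x in Ioi (0:ℝ), log (1 + c * x ^ (-p)) = c ^ (1 / p) * (π / sin (π / p)) := by
  have hp0 : 0 < p := by linarith
  have hpos : 0 < π / sin (π / p) := div_pos pi_pos (sin_pi_div_pos p hp)
  have h0 : 0 ≤ᵐ[volume.restrict (Ioi 0)] (fun x : ℝ => log (1 + x ^ (-p))) := by
    filter_upwards [ae_restrict_mem measurableSet_Ioi] with x hx
    have := rpow_pos_of_pos hx (-p)
    exact log_nonneg (by linarith)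
  have hm : Measurable (fun x : ℝ => log (1 + x ^ (-p))) := by fun_prop
  have hI : IntegrableOn (fun x : ℝ => log (1 + x ^ (-p))) (Ioi 0) := by
    refine ⟨hm.aestronglyMeasurable, ?_⟩
    rw [hasFiniteIntegral_iff_ofReal h0, J_lint p hp]
    exact ENNReal.ofReal_lt_top
  have hE : ∫ x in Ioi (0:ℝ), log (1 + x ^ (-p)) = π / sin (π / p) := by
    rw [integral_eq_lintegral_of_nonneg_ae h0 hm.aestronglyMeasurable, J_lint p hp,
      ENNReal.toReal_ofReal hpos.le]
  set k := c ^ (-(1 / p)) with hk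
  have hk0 : 0 < k := rpow_pos_of_pos hc _
  have hkp : k ^ (-p) = c := by
    rw [hk, ← rpow_mul hc.le]
    rw [show -(1 / p) * -p = 1 by field_simp, rpow_one]
  have e : ∀ x ∈ Ioi (0:ℝ), log (1 + (k * x) ^ (-p)) = log (1 + c * x ^ (-p)) := by
    intro x hx
    rw [Real.mul_rpow hk0.le (le_of_lt hx), hkp]
  constructor
  · have := (integrableOn_Ioi_comp_mul_left_iff (fun x : ℝ => log (1 + x ^ (-p))) 0 hk0).mpr
      (by simpa using hI)
    exact this.congr_fun e measurableSet_Ioi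
  · rw [← setIntegral_congr_fun measurableSet_Ioi e,
      integral_comp_mul_left_Ioi (fun x : ℝ => log (1 + x ^ (-p))) 0 hk0, mul_zero, hE, hk,
      rpow_neg hc.le, inv_inv, smul_eq_mul]
lemma J_sum (p c : ℝ) (hp : 1 < p) (hc : 0 < c) (K : Finset ℕ) :
    ∑ k ∈ K, log (1 + c * ((k:ℝ) + 1) ^ (-p)) ≤ c ^ (1 / p) * (π / sin (π / p)) := by
  obtain ⟨hI, hE⟩ := J_scaled p c hp hc
  set f := fun x : ℝ => log (1 + c * x ^ (-p)) with hf
  have hfnn : ∀ x : ℝ, 0 ≤ x → 0 ≤ f x := by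
    intro x hx
    apply log_nonneg
    have := rpow_nonneg hx (-p)
    nlinarith
  obtain ⟨n, hn⟩ := K.exists_nat_subset_range
  calc ∑ k ∈ K, f ((k:ℝ) + 1) ≤ ∑ k ∈ Finset.range n, f ((k:ℝ) + 1) :=
        Finset.sum_le_sum_of_subset_of_nonneg hn fun k _ _ => hfnn _ (by positivity)
    _ ≤ ∑ k ∈ Finset.range n, ∫ x in (k:ℝ)..((k+1:ℕ):ℝ), f x := by
        apply Finset.sum_le_sum
        intro k _
        have hk : (k:ℝ) ≤ ((k+1:ℕ):ℝ) := by push_cast; linarith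
        rw [intervalIntegral.integral_of_le hk]
        have hint : IntegrableOn f (Ioc (k:ℝ) ((k+1:ℕ):ℝ)) := hI.mono_set (by
          intro x hx; exact lt_of_le_of_lt (Nat.cast_nonneg k) hx.1)
        have : ∫ x in Ioc (k:ℝ) ((k+1:ℕ):ℝ), f ((k:ℝ) + 1) = f ((k:ℝ)+1) := by
          rw [setIntegral_const, Measure.real, Real.volume_Ioc]; simp
        rw [← this]
        apply setIntegral_mono_on (by simp) hint measurableSet_Ioc
        intro x hx
        have hx0 : 0 < x := lt_of_le_of_lt (Nat.cast_nonneg k) hx.1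
        apply log_le_log
        · have := rpow_nonneg (by positivity : (0:ℝ) ≤ (k:ℝ)+1) (-p)
          nlinarith
        · have : ((k:ℝ) + 1) ^ (-p) ≤ x ^ (-p) :=
            rpow_le_rpow_of_nonpos hx0 (by have := hx.2; push_cast at this; exact this) (by linarith)
          nlinarith
    _ = ∫ x in ((0:ℕ):ℝ)..(n:ℝ), f x := by
        apply intervalIntegral.sum_integral_adjacent_intervals (a := fun k : ℕ => (k:ℝ))
        intro k _
        rw [intervalIntegrable_iff_integrableOn_Ioc_of_le (by push_cast; linarith)]
        exact hI.mono_set (by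
          intro x hx; exact lt_of_le_of_lt (Nat.cast_nonneg k) hx.1)
    _ ≤ ∫ x in Ioi (0:ℝ), f x := by
        rw [intervalIntegral.integral_of_le (by simp)]
        apply setIntegral_mono_set hI
        · filter_upwards [ae_restrict_mem measurableSet_Ioi] with x hx
          exact hfnn x (le_of_lt hx)
        · apply LE.le.eventuallyLE
          intro x hx
          have := hx.1
          simpa using this
    _ = _ := hE
lemma integrable_abs_of {f : ℝ → ℝ} (hf : IntegrableOn f (Ioi 0)) :
    Integrable (fun x => f |x|) := by
  have hf' : IntegrableOn (fun x => f |x|) (Ioi 0) :=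
    hf.congr_fun (fun x hx => by rw [abs_of_pos hx]) measurableSet_Ioi
  have int_Iic : IntegrableOn (fun x ↦ f |x|) (Iic 0) := by
    rw [← Measure.map_neg_eq_self (volume : Measure ℝ)]
    let m : MeasurableEmbedding fun x : ℝ => -x := (Homeomorph.neg ℝ).measurableEmbedding
    rw [m.integrableOn_map_iff]
    simp_rw [Function.comp_def, abs_neg, neg_preimage, neg_Iic, neg_zero]
    exact Iff.mpr integrableOn_Ici_iff_integrableOn_Ioi hf'
  have := int_Iic.union hf'
  rwa [Iic_union_Ioi, integrableOn_univ] at this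
lemma J_line (p c : ℝ) (hp : 1 < p) (hc : 0 < c) :
    Integrable (fun x : ℝ => log (1 + c * |x| ^ (-p))) ∧
    ∫ x : ℝ, log (1 + c * |x| ^ (-p)) = 2 * (c ^ (1 / p) * (π / sin (π / p))) := by
  obtain ⟨hI, hE⟩ := J_scaled p c hp hc
  constructor
  · exact integrable_abs_of (f := fun x : ℝ => log (1 + c * x ^ (-p))) hI
  · rw [integral_comp_abs (f := fun x : ℝ => log (1 + c * x ^ (-p))), hE]
end
section
lemma diag_lemma {E V : Type*} [NormedAddCommGroup E] [InnerProductSpace ℝ E] [CompleteSpace E]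
    [NormedAddCommGroup V] [InnerProductSpace ℝ V] [CompleteSpace V] {n : ℕ}
    (h : Fin n → E) (hh : Orthonormal ℝ h) (A : E →L[ℝ] V) :
    ∃ e : Fin n → E, Orthonormal ℝ e ∧ (∀ v, ∑ i, inner ℝ (e i) v ^ 2 = ∑ i, inner ℝ (h i) v ^ 2) ∧
      (∀ i j, i ≠ j → inner ℝ (A (e i)) (A (e j)) = 0) ∧ Antitone (fun i => ‖A (e i)‖ ^ 2) := by
  classical
  set F : Submodule ℝ E := Submodule.span ℝ (Set.range h) with hF
  have : FiniteDimensional ℝ F := FiniteDimensional.span_of_finite ℝ (Set.finite_range h)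
  have hn : Module.finrank ℝ F = n := by
    rw [hF, finrank_span_eq_card hh.linearIndependent, Fintype.card_fin]
  set B : F →L[ℝ] V := A ∘L F.subtypeL with hB
  set T : F →ₗ[ℝ] F := ((ContinuousLinearMap.adjoint B) ∘L B).toLinearMap with hT
  have hTin : ∀ x y : F, inner ℝ (T x) y = inner ℝ (A x) (A y) := by
    intro x y
    change inner ℝ ((ContinuousLinearMap.adjoint B) (B x)) y = _
    rw [ContinuousLinearMap.adjoint_inner_left]; rfl
  have hTs : T.IsSymmetric := by
    intro x y
    rw [hTin, real_inner_comm, ← hTin, real_inner_comm]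
  set b := hTs.eigenvectorBasis hn with hb
  have hAA : ∀ i j, inner ℝ (A (b i)) (A (b j)) = hTs.eigenvalues hn i * inner ℝ (b i) (b j) := by
    intro i j
    rw [← hTin, hTs.apply_eigenvectorBasis hn i, real_inner_smul_left]
    rfl
  have hlam : ∀ i, ‖A (b i)‖ ^ 2 = hTs.eigenvalues hn i := by
    intro i
    rw [← real_inner_self_eq_norm_sq, hAA, real_inner_self_eq_norm_sq, b.orthonormal.1 i]; simp
  set h' : Fin n → F := fun i => ⟨h i, Submodule.subset_span ⟨i, rfl⟩⟩ with hh'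
  have hon' : Orthonormal ℝ h' := by
    refine ⟨fun i => hh.1 i, fun i j hij => hh.2 hij⟩
  have hspan : ⊤ ≤ Submodule.span ℝ (Set.range h') := by
    have := hon'.linearIndependent.span_eq_top_of_card_eq_finrank' (by rw [Fintype.card_fin, hn])
    rw [this]
  set c := OrthonormalBasis.mk hon' hspan with hc
  refine ⟨fun i => (b i : E), b.orthonormal.comp_linearIsometry F.subtypeₗᵢ, ?_, ?_, ?_⟩
  · intro v
    set w := F.orthogonalProjectionOnto v with hw
    have hpr : ∀ x : F, inner ℝ (x : E) v = inner ℝ x w := by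
      intro x
      rw [hw, Submodule.inner_orthogonalProjectionOnto_eq_of_mem_left]
    have h1 := b.sum_sq_inner_right w
    have h2 := c.sum_sq_inner_right w
    have e1 : ∀ i, inner ℝ (b i : E) v = inner ℝ (b i) w := fun i => hpr _
    have e2 : ∀ i, inner ℝ (h i) v = inner ℝ (c i) w := by
      intro i
      rw [hc, OrthonormalBasis.coe_mk, ← hpr]
    simp_rw [e1, e2]
    rw [h1, h2]
  · intro i j hij
    rw [hAA, b.orthonormal.2 hij, mul_zero]
  · intro i j hij
    simp only
    rw [hlam, hlam]
    exact hTs.eigenvalues_antitone hn hij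
lemma rank_lemma {E V J : Type*} [NormedAddCommGroup E] [InnerProductSpace ℝ E]
    [NormedAddCommGroup V] [InnerProductSpace ℝ V] [Fintype J] {n : ℕ}
    (A : E →L[ℝ] V) (e : Fin n → E) (he : Orthonormal ℝ e)
    (horth : ∀ i j, i ≠ j → inner ℝ (A (e i)) (A (e j)) = 0)
    (hanti : Antitone (fun i => ‖A (e i)‖ ^ 2))
    (v : J → E) (ε : ℝ)
    (hq : ∀ (N : ℕ) (q : Fin N → E), Orthonormal ℝ q → (∀ i j, inner ℝ (v j) (q i) = 0) →
      ∑ i, ‖A (q i)‖ ^ 2 ≤ ε) (k : Fin n) :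
    (((k:ℕ):ℝ) + 1 - Fintype.card J) * ‖A (e k)‖ ^ 2 ≤ ε := by
  classical
  set ι : Fin (k + 1) → Fin n := fun i => ⟨i, by omega⟩ with hι
  have hιinj : Function.Injective ι := by
    intro i j hij
    simpa [hι, Fin.ext_iff] using hij
  set e' : Fin (k + 1) → E := fun i => e (ι i) with he'
  have hon' : Orthonormal ℝ e' := he.comp ι hιinj
  set L : EuclideanSpace ℝ (Fin (k + 1)) →ₗ[ℝ] E :=
    { toFun := fun z => ∑ i, z i • e' i
      map_add' := fun x y => by simp [add_smul, Finset.sum_add_distrib]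
      map_smul' := fun c x => by simp [mul_smul, Finset.smul_sum] } with hL
  have hLin : ∀ x y, inner ℝ (L x) (L y) = inner ℝ x y := by
    intro x y
    change inner ℝ (∑ i, x i • e' i) (∑ i, y i • e' i) = _
    rw [hon'.inner_sum x y Finset.univ, PiLp.inner_apply]
    refine Finset.sum_congr rfl fun i _ => ?_
    simp [mul_comm]
  have hAL : ∀ z, ‖A (L z)‖ ^ 2 = ∑ i, z i ^ 2 * ‖A (e' i)‖ ^ 2 := by
    intro z
    change ‖A (∑ i, z i • e' i)‖ ^ 2 = _
    rw [map_sum, ← real_inner_self_eq_norm_sq, sum_inner]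
    refine Finset.sum_congr rfl fun i _ => ?_
    rw [inner_sum, Finset.sum_eq_single i]
    · rw [map_smul, real_inner_smul_left, real_inner_smul_right, real_inner_self_eq_norm_sq]; ring
    · intro j _ hj
      rw [map_smul, map_smul, real_inner_smul_left, real_inner_smul_right,
        horth (ι i) (ι j) (fun hc => hj (hιinj hc).symm)]; ring
    · simp
  have hALge : ∀ z, ‖A (e k)‖ ^ 2 * ‖z‖ ^ 2 ≤ ‖A (L z)‖ ^ 2 := by
    intro z
    rw [hAL, EuclideanSpace.norm_sq_eq, Finset.mul_sum]
    refine Finset.sum_le_sum fun i _ => ?_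
    rw [Real.norm_eq_abs, sq_abs, mul_comm]
    have : ‖A (e k)‖ ^ 2 ≤ ‖A (e' i)‖ ^ 2 := hanti (a := ι i) (b := k) (by
      rw [Fin.le_def]; simp [hι]; omega)
    gcongr
  set W : EuclideanSpace ℝ (Fin (k + 1)) →ₗ[ℝ] (J → ℝ) :=
    LinearMap.pi fun j => (innerSL ℝ (v j) : E →ₗ[ℝ] ℝ) ∘ₗ L with hW
  set N := Module.finrank ℝ (LinearMap.ker W) with hN
  have hrn := LinearMap.finrank_range_add_finrank_ker W
  have hr : Module.finrank ℝ (LinearMap.range W) ≤ Fintype.card J := by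
    have := Submodule.finrank_le (LinearMap.range W)
    rwa [Module.finrank_fintype_fun_eq_card] at this
  rw [finrank_euclideanSpace, Fintype.card_fin] at hrn
  set b := stdOrthonormalBasis ℝ (LinearMap.ker W) with hb
  have h1 := hq N (fun i => L (b i)) (by
    rw [orthonormal_iff_ite]
    intro i j
    rw [hLin]
    exact orthonormal_iff_ite.mp b.orthonormal i j) (by
    intro i j
    have := (b i).2
    rw [LinearMap.mem_ker] at this
    exact congrFun this j)
  have h2 : (N:ℝ) * ‖A (e k)‖ ^ 2 ≤ ∑ i, ‖A (L (b i))‖ ^ 2 := by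
    have : ∑ i : Fin N, ‖A (e k)‖ ^ 2 = (N:ℝ) * ‖A (e k)‖ ^ 2 := by simp
    rw [← this]
    refine Finset.sum_le_sum fun i _ => ?_
    have h3 := hALge (b i)
    have h4 : ‖((b i : LinearMap.ker W) : EuclideanSpace ℝ (Fin (k + 1)))‖ = 1 := b.orthonormal.1 i
    rw [h4] at h3
    simpa using h3
  refine le_trans ?_ (h2.trans h1)
  gcongr
  have : ((k:ℕ) + 1 : ℕ) ≤ N + Fintype.card J := by omega
  have : (((k:ℕ) + 1 : ℕ):ℝ) ≤ ((N + Fintype.card J : ℕ):ℝ) := by exact_mod_cast this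
  push_cast at this
  linarith
end
section
abbrev nu : Measure ℝ := volume.restrict (Ioo (0:ℝ) 1)
abbrev EE := Lp ℝ 2 nu
abbrev HH := Lp ℂ 2 (volume : Measure ℝ)
instance fact_two_ne_top : Fact ((2:ℝ≥0∞) ≠ ∞) := ⟨by norm_num⟩
instance nu_prob : IsProbabilityMeasure nu := ⟨by simp⟩
lemma exists_onb (F : Type) [NormedAddCommGroup F] [InnerProductSpace ℝ F] [CompleteSpace F]
    [SecondCountableTopology F] :
    ∃ (ι : Type) (_ : Countable ι) (h : ι → F), Orthonormal ℝ h ∧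
      ∀ v, HasSum (fun i => inner ℝ (h i) v ^ 2) (‖v‖ ^ 2) := by
  obtain ⟨w, b, hb⟩ := exists_hilbertBasis ℝ F
  have hcount : Countable w := by
    rw [Set.countable_coe_iff]
    have hd : w.PairwiseDisjoint (fun x => Metric.ball x (1 / 2)) := by
      intro x hx y hy hxy
      apply Metric.ball_disjoint_ball
      have h1 := b.orthonormal
      rw [hb] at h1
      have h2 := h1.2 (i := ⟨x, hx⟩) (j := ⟨y, hy⟩) (by simpa using hxy)
      have h3 : ‖x - y‖ ^ 2 = 2 := by
        rw [norm_sub_sq_real]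
        have n1 : ‖x‖ = 1 := h1.1 ⟨x, hx⟩
        have n2 : ‖y‖ = 1 := h1.1 ⟨y, hy⟩
        simp only at h2
        rw [h2, n1, n2]; norm_num
      rw [dist_eq_norm]
      nlinarith [norm_nonneg (x - y)]
    exact hd.countable_of_isOpen (fun _ _ => Metric.isOpen_ball) (fun x _ => ⟨x, by simp⟩)
  refine ⟨w, hcount, b, b.orthonormal, fun v => ?_⟩
  have := b.hasSum_inner_mul_inner v v
  rw [real_inner_self_eq_norm_sq] at this
  have e : (fun i => inner ℝ (b i) v ^ 2) = fun i => inner ℝ v (b i) * inner ℝ (b i) v := by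
    ext i; rw [real_inner_comm (b i) v, sq]
  rw [e]; exact this
lemma ee_inner (u v : EE) : inner ℝ u v = ∫ x, u x * v x ∂nu := by
  rw [L2.inner_def]
  congr 1; ext x; simp [mul_comm]
lemma ee_sq_int (u : EE) : Integrable (fun x => u x ^ 2) nu := (Lp.memLp u).integrable_sq
lemma ee_norm_sq (u : EE) : ‖u‖ ^ 2 = ∫ x, u x ^ 2 ∂nu := by
  rw [← real_inner_self_eq_norm_sq, ee_inner]
  congr 1; ext x; ring
lemma ee_int (u : EE) : Integrable u nu := (Lp.memLp u).integrable (by norm_num)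
lemma ee_mul_int (u v : EE) : Integrable (fun x => u x * v x) nu :=
  (Lp.memLp u).integrable_mul (Lp.memLp v)
lemma ee_l1 (u : EE) : ∫ x, |u x| ∂nu ≤ ‖u‖ := by
  have h1 : (∫ x, |u x| ∂nu) ^ 2 ≤ ∫ x, |u x| ^ 2 ∂nu :=
    ConvexOn.map_integral_le (s := Set.univ) (f := fun x => |u x|) (g := fun x : ℝ => x ^ 2)
      (Even.convexOn_pow (by norm_num)) (by fun_prop) isClosed_univ
      (by simp) (ee_int u).abs (by
        have := ee_sq_int u
        simpa [Function.comp_def] using this)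
  simp_rw [sq_abs] at h1
  rw [← ee_norm_sq] at h1
  exact (abs_le_of_sq_le_sq' h1 (norm_nonneg _)).2
lemma hh_norm_sq {f : ℝ → ℂ} (hf : MemLp f 2 volume) : ‖hf.toLp f‖ ^ 2 = ∫ ξ, ‖f ξ‖ ^ 2 := by
  rw [← real_inner_self_eq_norm_sq, L2.inner_def]
  apply integral_congr_ae
  filter_upwards [hf.coeFn_toLp] with ξ hξ
  rw [hξ, real_inner_self_eq_norm_sq]
def indF (S : Set ℝ) (hS : MeasurableSet S) (u : EE) : EE :=
  ((Lp.memLp u).indicator hS).toLp (S.indicator u)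
lemma indF_coe (S : Set ℝ) (hS : MeasurableSet S) (u : EE) :
    indF S hS u =ᵐ[nu] S.indicator u := by
  unfold indF
  exact MemLp.coeFn_toLp _
lemma indF_add (S : Set ℝ) (hS : MeasurableSet S) (u v : EE) :
    indF S hS (u + v) = indF S hS u + indF S hS v := by
  apply Lp.ext
  filter_upwards [indF_coe S hS u, indF_coe S hS v, indF_coe S hS (u + v),
    Lp.coeFn_add u v, Lp.coeFn_add (indF S hS u) (indF S hS v)] with x h1 h2 h3 h4 h5
  rw [h5, h3, Pi.add_apply, h1, h2]
  by_cases h : x ∈ S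
  · rw [indicator_of_mem h, indicator_of_mem h, indicator_of_mem h, h4, Pi.add_apply]
  · rw [indicator_of_notMem h, indicator_of_notMem h, indicator_of_notMem h, add_zero]
lemma indF_smul (S : Set ℝ) (hS : MeasurableSet S) (c : ℝ) (u : EE) :
    indF S hS (c • u) = c • indF S hS u := by
  apply Lp.ext
  filter_upwards [indF_coe S hS u, indF_coe S hS (c • u),
    Lp.coeFn_smul c u, Lp.coeFn_smul c (indF S hS u)] with x h1 h3 h4 h5
  rw [h5, h3, Pi.smul_apply, h1]
  by_cases h : x ∈ S
  · rw [indicator_of_mem h, indicator_of_mem h, h4, Pi.smul_apply]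
  · rw [indicator_of_notMem h, indicator_of_notMem h, smul_zero]
lemma indF_norm (S : Set ℝ) (hS : MeasurableSet S) (u : EE) : ‖indF S hS u‖ ≤ ‖u‖ := by
  apply Lp.norm_le_norm_of_ae_le
  filter_upwards [indF_coe S hS u] with x hx
  rw [hx]
  exact norm_indicator_le_norm_self _ _
def ind (S : Set ℝ) (hS : MeasurableSet S) : EE →L[ℝ] EE :=
  LinearMap.mkContinuous
    { toFun := indF S hS
      map_add' := indF_add S hS
      map_smul' := indF_smul S hS } 1 (fun u => by
    rw [one_mul]
    exact indF_norm S hS u)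
lemma ind_coe (S : Set ℝ) (hS : MeasurableSet S) (u : EE) :
    ind S hS u =ᵐ[nu] S.indicator u := indF_coe S hS u
lemma ind_inner (S : Set ℝ) (hS : MeasurableSet S) (u v : EE) :
    inner ℝ (ind S hS u) v = ∫ x, S.indicator (fun x => u x * v x) x ∂nu := by
  rw [ee_inner]
  apply integral_congr_ae
  filter_upwards [ind_coe S hS u] with x hx
  rw [hx]
  by_cases h : x ∈ S <;> simp [h]
lemma ind_symm (S : Set ℝ) (hS : MeasurableSet S) (u v : EE) :
    inner ℝ (ind S hS u) v = inner ℝ u (ind S hS v) := by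
  rw [real_inner_comm _ u, ind_inner, ind_inner]
  simp_rw [mul_comm]
lemma ind_idem (S : Set ℝ) (hS : MeasurableSet S) (u : EE) : ind S hS (ind S hS u) = ind S hS u := by
  apply Lp.ext
  filter_upwards [ind_coe S hS u, ind_coe S hS (ind S hS u)] with x h1 h2
  rw [h2]
  by_cases h : x ∈ S <;> simp [h, h1]
lemma ind_norm_sq (S : Set ℝ) (hS : MeasurableSet S) (u : EE) :
    ‖ind S hS u‖ ^ 2 = ∫ x in S, u x ^ 2 ∂nu := by
  rw [ee_norm_sq, ← integral_indicator hS]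
  apply integral_congr_ae
  filter_upwards [ind_coe S hS u] with x hx
  rw [hx]
  by_cases h : x ∈ S <;> simp [h]
structure Ker (a : ℝ → ℝ → ℂ) (g : ℝ → ℝ) : Prop where
  meas : Measurable (Function.uncurry a)
  bd : ∀ x ∈ Ioo (0:ℝ) 1, ∀ ξ, ‖a x ξ‖ ≤ g ξ
  g2 : MemLp g 2 volume
def KT (a : ℝ → ℝ → ℂ) (u : EE) (ξ : ℝ) : ℂ := ∫ x, (u x : ℂ) * a x ξ ∂nu
section
variable {a : ℝ → ℝ → ℂ} {g : ℝ → ℝ}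
lemma Ker.int (hk : Ker a g) (u : EE) (ξ : ℝ) : Integrable (fun x => (u x : ℂ) * a x ξ) nu := by
  apply Integrable.mono' ((ee_int u).abs.mul_const (g ξ))
  · apply AEStronglyMeasurable.mul
    · exact Complex.continuous_ofReal.comp_aestronglyMeasurable (Lp.aestronglyMeasurable u)
    · have := hk.meas
      exact (this.comp (measurable_id.prodMk measurable_const)).aestronglyMeasurable
  · filter_upwards [ae_restrict_mem measurableSet_Ioo] with x hx
    rw [norm_mul, Complex.norm_real, Real.norm_eq_abs]
    gcongr
    exact hk.bd x hx ξ
lemma Ker.g_nonneg (hk : Ker a g) (ξ : ℝ) : 0 ≤ g ξ :=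
  (norm_nonneg _).trans (hk.bd (1 / 2) (by norm_num) ξ)
lemma Ker.norm_le (hk : Ker a g) (u : EE) (ξ : ℝ) : ‖KT a u ξ‖ ≤ ‖u‖ * g ξ := by
  unfold KT
  refine (norm_integral_le_integral_norm _).trans ?_
  calc ∫ x, ‖(u x : ℂ) * a x ξ‖ ∂nu ≤ ∫ x, |u x| * g ξ ∂nu := by
        apply integral_mono_ae (hk.int u ξ).norm ((ee_int u).abs.mul_const _)
        filter_upwards [ae_restrict_mem measurableSet_Ioo] with x hx
        rw [norm_mul, Complex.norm_real, Real.norm_eq_abs]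
        gcongr
        exact hk.bd x hx ξ
    _ ≤ ‖u‖ * g ξ := by
        rw [integral_mul_const]
        exact mul_le_mul_of_nonneg_right (ee_l1 u) (hk.g_nonneg ξ)
lemma Ker.sm (hk : Ker a g) (u : EE) : StronglyMeasurable (KT a u) := by
  have h : StronglyMeasurable (fun p : ℝ × ℝ => (u p.2 : ℂ) * a p.2 p.1) := by
    apply Measurable.stronglyMeasurable
    apply Measurable.mul
    · exact Complex.measurable_ofReal.comp ((Lp.stronglyMeasurable u).measurable.comp measurable_snd)
    · exact hk.meas.comp (measurable_snd.prodMk measurable_fst)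
  exact h.integral_prod_right
lemma Ker.memLp (hk : Ker a g) (u : EE) : MemLp (KT a u) 2 volume := by
  apply MemLp.of_le (hk.g2.const_mul ‖u‖) (hk.sm u).aestronglyMeasurable
  refine Eventually.of_forall fun ξ => ?_
  rw [Real.norm_of_nonneg (mul_nonneg (norm_nonneg _) (hk.g_nonneg ξ))]
  exact hk.norm_le u ξ
lemma Ker.KT_add (hk : Ker a g) (u v : EE) (ξ : ℝ) : KT a (u + v) ξ = KT a u ξ + KT a v ξ := by
  unfold KT
  rw [← integral_add (hk.int u ξ) (hk.int v ξ)]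
  apply integral_congr_ae
  filter_upwards [Lp.coeFn_add u v] with x hx
  rw [hx, Pi.add_apply]; push_cast; ring
lemma KT_smul (c : ℝ) (u : EE) (ξ : ℝ) : KT a (c • u) ξ = c * KT a u ξ := by
  unfold KT
  rw [← integral_const_mul]
  apply integral_congr_ae
  filter_upwards [Lp.coeFn_smul c u] with x hx
  rw [hx, Pi.smul_apply, smul_eq_mul]; push_cast; ring
def Ker.op (hk : Ker a g) : EE →L[ℝ] HH :=
  LinearMap.mkContinuous
    { toFun := fun u => (hk.memLp u).toLp (KT a u)
      map_add' := fun u v => by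
        rw [← MemLp.toLp_add]
        congr 1
        ext ξ
        exact hk.KT_add u v ξ
      map_smul' := fun c u => by
        rw [RingHom.id_apply, ← MemLp.toLp_const_smul]
        congr 1
        ext ξ
        rw [KT_smul, Pi.smul_apply, Complex.real_smul] } (√(∫ ξ, g ξ ^ 2)) (fun u => by
    change ‖(hk.memLp u).toLp (KT a u)‖ ≤ _
    apply abs_le_of_sq_le_sq' _ (by positivity) |>.2
    rw [hh_norm_sq, mul_pow, Real.sq_sqrt (integral_nonneg fun ξ => sq_nonneg _), mul_comm,
      ← integral_const_mul]
    apply integral_mono_of_nonneg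
    · exact Eventually.of_forall fun ξ => sq_nonneg _
    · exact (hk.g2.integrable_sq).const_mul _
    · refine Eventually.of_forall fun ξ => ?_
      simp only
      rw [← mul_pow]
      have := hk.norm_le u ξ
      gcongr)
lemma Ker.op_norm_sq (hk : Ker a g) (u : EE) : ‖hk.op u‖ ^ 2 = ∫ ξ, ‖KT a u ξ‖ ^ 2 :=
  hh_norm_sq (hk.memLp u)
lemma Ker.op_sq_int (hk : Ker a g) (u : EE) : Integrable (fun ξ => ‖KT a u ξ‖ ^ 2) :=
  (hk.memLp u).integrable_norm_pow (by norm_num)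
end
end
section
lemma int_re {α : Type*} [MeasurableSpace α] {m : Measure α} {f : α → ℂ} (hf : Integrable f m) :
    (∫ x, f x ∂m).re = ∫ x, (f x).re ∂m := (Complex.reCLM.integral_comp_comm hf).symm
lemma int_im {α : Type*} [MeasurableSpace α] {m : Measure α} {f : α → ℂ} (hf : Integrable f m) :
    (∫ x, f x ∂m).im = ∫ x, (f x).im ∂m := (Complex.imCLM.integral_comp_comm hf).symm
section
variable {a : ℝ → ℝ → ℂ} {g : ℝ → ℝ}
lemma Ker.norm_sq_eq (hk : Ker a g) (u : EE) (ξ : ℝ) :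
    ‖KT a u ξ‖ ^ 2 = ∫ z, (u z.1 * u z.2) * (a z.1 ξ * starRingEnd ℂ (a z.2 ξ)).re ∂(nu.prod nu) := by
  have h1 : ((‖KT a u ξ‖ ^ 2 : ℝ) : ℂ) =
      ∫ z, ((u z.1 : ℂ) * a z.1 ξ) * starRingEnd ℂ ((u z.2 : ℂ) * a z.2 ξ) ∂(nu.prod nu) := by
    rw [integral_prod_mul (fun x => (u x : ℂ) * a x ξ) (fun x => starRingEnd ℂ ((u x : ℂ) * a x ξ)),
      integral_conj]
    change _ = KT a u ξ * starRingEnd ℂ (KT a u ξ)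
    rw [Complex.mul_conj, Complex.normSq_eq_norm_sq]
  have h2 : Integrable (fun z : ℝ × ℝ => ((u z.1 : ℂ) * a z.1 ξ) *
      starRingEnd ℂ ((u z.2 : ℂ) * a z.2 ξ)) (nu.prod nu) := by
    apply (hk.int u ξ).mul_prod (g := fun x => starRingEnd ℂ ((u x : ℂ) * a x ξ))
    exact (Complex.conjCLE.toContinuousLinearMap.integrable_comp (hk.int u ξ))
  rw [← Complex.ofReal_re (‖KT a u ξ‖ ^ 2), h1]
  rw [int_re h2]
  congr 1; ext z
  rw [map_mul, Complex.conj_ofReal]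
  rw [show (u z.1 : ℂ) * a z.1 ξ * ((u z.2 : ℂ) * starRingEnd ℂ (a z.2 ξ)) =
    ((u z.1 * u z.2 : ℝ) : ℂ) * (a z.1 ξ * starRingEnd ℂ (a z.2 ξ)) by push_cast; ring,
    Complex.re_ofReal_mul]
lemma Ker.fubini (hk : Ker a g) (u : EE) :
    ‖hk.op u‖ ^ 2 = ∫ x, ∫ y, (∫ ξ, (a x ξ * starRingEnd ℂ (a y ξ)).re) * u x * u y ∂nu ∂nu := by
  rw [hk.op_norm_sq]
  simp_rw [hk.norm_sq_eq u]
  have hu : Measurable (u : ℝ → ℝ) := (Lp.stronglyMeasurable u).measurable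
  have hI : Integrable (Function.uncurry fun (ξ : ℝ) (z : ℝ × ℝ) =>
      (u z.1 * u z.2) * (a z.1 ξ * starRingEnd ℂ (a z.2 ξ)).re) (volume.prod (nu.prod nu)) := by
    have hb : Integrable (fun p : ℝ × (ℝ × ℝ) => g p.1 ^ 2 * (|u p.2.1| * |u p.2.2|))
        (volume.prod (nu.prod nu)) :=
      hk.g2.integrable_sq.mul_prod ((ee_int u).abs.mul_prod (ee_int u).abs)
    apply hb.mono'
    · apply Measurable.aestronglyMeasurable
      unfold Function.uncurry
      have m1 : Measurable (fun p : ℝ × (ℝ × ℝ) => a p.2.1 p.1) :=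
        hk.meas.comp ((measurable_fst.comp measurable_snd).prodMk measurable_fst)
      have m2 : Measurable (fun p : ℝ × (ℝ × ℝ) => a p.2.2 p.1) :=
        hk.meas.comp ((measurable_snd.comp measurable_snd).prodMk measurable_fst)
      have m3 : Measurable (fun p : ℝ × (ℝ × ℝ) => u p.2.1) := hu.comp (measurable_fst.comp measurable_snd)
      have m4 : Measurable (fun p : ℝ × (ℝ × ℝ) => u p.2.2) := hu.comp (measurable_snd.comp measurable_snd)
      exact (m3.mul m4).mul (Complex.measurable_re.comp
        (m1.mul (Complex.continuous_conj.measurable.comp m2)))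
    · have h1 : ∀ᵐ p : ℝ × (ℝ × ℝ) ∂(volume.prod (nu.prod nu)), p.2.1 ∈ Ioo (0:ℝ) 1 :=
        Measure.quasiMeasurePreserving_snd.ae (Measure.quasiMeasurePreserving_fst.ae
          (ae_restrict_mem measurableSet_Ioo))
      have h2 : ∀ᵐ p : ℝ × (ℝ × ℝ) ∂(volume.prod (nu.prod nu)), p.2.2 ∈ Ioo (0:ℝ) 1 :=
        Measure.quasiMeasurePreserving_snd.ae (Measure.quasiMeasurePreserving_snd.ae
          (ae_restrict_mem measurableSet_Ioo))
      filter_upwards [h1, h2] with p h1 h2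
      unfold Function.uncurry
      simp only
      rw [norm_mul, norm_mul, Real.norm_eq_abs, Real.norm_eq_abs, Real.norm_eq_abs, mul_comm]
      gcongr
      refine (Complex.abs_re_le_norm _).trans ?_
      rw [norm_mul, RCLike.norm_conj, sq]
      exact mul_le_mul (hk.bd _ h1 _) (hk.bd _ h2 _) (norm_nonneg _) (hk.g_nonneg _)
  have hJ := hI.integral_prod_right
  simp only [Function.uncurry] at hJ
  rw [integral_integral_swap hI, integral_prod _ hJ]
  congr 1; ext x; congr 1; ext y
  simp only [Function.uncurry]
  rw [integral_const_mul]; ring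
end
lemma bessel_complex {N : ℕ} (q : Fin N → EE) (hq : Orthonormal ℝ q) (w : ℝ → ℂ) (hw : Measurable w) :
    ∑ i, ‖∫ x, (q i x : ℂ) * w x ∂nu‖ₑ ^ 2 ≤ ∫⁻ x, ‖w x‖ₑ ^ 2 ∂nu := by
  by_cases hfin : ∫⁻ x, ‖w x‖ₑ ^ 2 ∂nu = ⊤
  · rw [hfin]; exact le_top
  have hL : MemLp w 2 nu := by
    refine ⟨hw.aestronglyMeasurable, ?_⟩
    rw [eLpNorm_lt_top_iff_lintegral_rpow_enorm_lt_top (by norm_num) (by norm_num)]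
    simpa using lt_top_iff_ne_top.2 hfin
  have hre : MemLp (fun x => (w x).re) 2 nu := hL.re
  have him : MemLp (fun x => (w x).im) 2 nu := hL.im
  have hi : ∀ i, Integrable (fun x => (q i x : ℂ) * w x) nu := fun i =>
    (MemLp.ofReal (Lp.memLp (q i)) : MemLp (fun x => (q i x : ℂ)) 2 nu).integrable_mul hL
  have e1 : ∀ i, (∫ x, (q i x : ℂ) * w x ∂nu).re = inner ℝ (q i) (hre.toLp _) := fun i => by
    rw [ee_inner]
    rw [int_re (hi i)]
    apply integral_congr_ae
    filter_upwards [hre.coeFn_toLp] with x hx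
    rw [hx]; simp
  have e2 : ∀ i, (∫ x, (q i x : ℂ) * w x ∂nu).im = inner ℝ (q i) (him.toLp _) := fun i => by
    rw [ee_inner]
    rw [int_im (hi i)]
    apply integral_congr_ae
    filter_upwards [him.coeFn_toLp] with x hx
    rw [hx]; simp
  have b1 := hq.sum_inner_products_le (hre.toLp _) (s := Finset.univ)
  have b2 := hq.sum_inner_products_le (him.toLp _) (s := Finset.univ)
  have n1 : ‖hre.toLp _‖ ^ 2 = ∫ x, (w x).re ^ 2 ∂nu := by
    rw [ee_norm_sq]; apply integral_congr_ae
    filter_upwards [hre.coeFn_toLp] with x hx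
    rw [hx]
  have n2 : ‖him.toLp _‖ ^ 2 = ∫ x, (w x).im ^ 2 ∂nu := by
    rw [ee_norm_sq]; apply integral_congr_ae
    filter_upwards [him.coeFn_toLp] with x hx
    rw [hx]
  have key : ∑ i, ‖∫ x, (q i x : ℂ) * w x ∂nu‖ ^ 2 ≤ ∫ x, ‖w x‖ ^ 2 ∂nu := by
    calc ∑ i, ‖∫ x, (q i x : ℂ) * w x ∂nu‖ ^ 2
        = ∑ i, (inner ℝ (q i) (hre.toLp _)) ^ 2 + ∑ i, (inner ℝ (q i) (him.toLp _)) ^ 2 := by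
          rw [← Finset.sum_add_distrib]
          refine Finset.sum_congr rfl fun i _ => ?_
          rw [← e1, ← e2, ← Complex.normSq_eq_norm_sq, Complex.normSq_apply]; ring
      _ ≤ ∫ x, (w x).re ^ 2 ∂nu + ∫ x, (w x).im ^ 2 ∂nu := by
          rw [← n1, ← n2]
          simp only [Real.norm_eq_abs, sq_abs] at b1 b2
          exact add_le_add b1 b2
      _ = ∫ x, ‖w x‖ ^ 2 ∂nu := by
          rw [← integral_add hre.integrable_sq him.integrable_sq]
          congr 1; ext x
          rw [← Complex.normSq_eq_norm_sq, Complex.normSq_apply]; ring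
  have hin : Integrable (fun x => ‖w x‖ ^ 2) nu := hL.integrable_norm_pow (by norm_num)
  have e3 : ∫⁻ x, ‖w x‖ₑ ^ 2 ∂nu = ENNReal.ofReal (∫ x, ‖w x‖ ^ 2 ∂nu) := by
    rw [ofReal_integral_eq_lintegral_ofReal hin (Eventually.of_forall fun x => sq_nonneg _)]
    congr 1; ext x
    rw [ENNReal.ofReal_pow (norm_nonneg _), ofReal_norm]
  rw [e3]
  refine le_trans (le_of_eq ?_) (ENNReal.ofReal_le_ofReal key)
  rw [ENNReal.ofReal_sum_of_nonneg (fun i _ => sq_nonneg _)]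
  refine Finset.sum_congr rfl fun i _ => ?_
  rw [ENNReal.ofReal_pow (norm_nonneg _), ofReal_norm]
lemma hs_lemma {N : ℕ} (q : Fin N → EE) (hq : Orthonormal ℝ q) (w : ℝ → ℝ → ℂ)
    (hw : Measurable (Function.uncurry w)) (S : Set ℝ) (hS : MeasurableSet S) (c : ℝ) (hc0 : 0 ≤ c)
    (hc : ∀ x ∈ Ioo (0:ℝ) 1, ∫⁻ ξ, ‖w x ξ‖ₑ ^ 2 ≤ S.indicator (fun _ => ENNReal.ofReal c) x)
    (F : Fin N → ℝ → ℂ) (hF : ∀ i, Integrable (fun ξ => ‖F i ξ‖ ^ 2))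
    (hFw : ∀ i, ∀ᵐ ξ, F i ξ = ∫ x, (q i x : ℂ) * w x ξ ∂nu) :
    ∑ i, ∫ ξ, ‖F i ξ‖ ^ 2 ≤ c * nu.real S := by
  have h1 : ∫⁻ ξ, ENNReal.ofReal (∑ i, ‖F i ξ‖ ^ 2) ≤ ENNReal.ofReal (c * nu.real S) := by
    calc ∫⁻ ξ, ENNReal.ofReal (∑ i, ‖F i ξ‖ ^ 2) ≤ ∫⁻ ξ, ∫⁻ x, ‖w x ξ‖ₑ ^ 2 ∂nu := by
          apply lintegral_mono_ae
          filter_upwards [ae_all_iff.2 hFw] with ξ hξ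
          have hm : Measurable (fun x => w x ξ) := hw.comp (measurable_id.prodMk measurable_const)
          refine le_trans (le_of_eq ?_) (bessel_complex q hq _ hm)
          rw [ENNReal.ofReal_sum_of_nonneg (fun i _ => sq_nonneg _)]
          refine Finset.sum_congr rfl fun i _ => ?_
          rw [ENNReal.ofReal_pow (norm_nonneg _), ofReal_norm, hξ i]
      _ = ∫⁻ x, (∫⁻ ξ, ‖w x ξ‖ₑ ^ 2) ∂nu := by
          apply lintegral_lintegral_swap
          apply Measurable.aemeasurable
          exact ((hw.comp measurable_swap).enorm).pow_const 2
      _ ≤ ∫⁻ x, S.indicator (fun _ => ENNReal.ofReal c) x ∂nu := by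
          apply lintegral_mono_ae
          filter_upwards [ae_restrict_mem measurableSet_Ioo] with x hx
          exact hc x hx
      _ = ENNReal.ofReal (c * nu.real S) := by
          rw [lintegral_indicator hS, setLIntegral_const, ENNReal.ofReal_mul hc0, ofReal_measureReal]
  rw [← integral_finsetSum _ (fun i _ => hF i)]
  rw [← ofReal_integral_eq_lintegral_ofReal (integrable_finsetSum _ fun i _ => hF i)
    (Eventually.of_forall fun ξ => Finset.sum_nonneg fun i _ => sq_nonneg _)] at h1
  exact (ENNReal.ofReal_le_ofReal_iff (by positivity)).1 h1
end
section
lemma mu_char [MeasurableSpace EE] [BorelSpace EE] (μ : Measure EE) [IsProbabilityMeasure μ]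
    (hGauss : ∀ L : EE →L[ℝ] ℝ, ∃ v : ℝ≥0, μ.map L = ProbabilityTheory.gaussianReal 0 v)
    {V : Type*} [NormedAddCommGroup V] [NormedSpace ℝ V] (T : EE →L[ℝ] V)
    (hT : ∀ v : EE, ∫ f, (inner ℝ v f) * (inner ℝ v f) ∂μ = ‖T v‖ ^ 2) (v : EE) :
    ∫ f, Complex.exp (Complex.I * ((inner ℝ v f : ℝ) : ℂ)) ∂μ = (exp (-(‖T v‖ ^ 2) / 2) : ℂ) := by
  obtain ⟨s, hs⟩ := hGauss (innerSL ℝ v)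
  have hm : Measurable (innerSL ℝ v) := (innerSL ℝ v).continuous.measurable
  have hvar : (s : ℝ) = ‖T v‖ ^ 2 := by
    rw [← hT v]
    have h1 : ∫ x, x ^ 2 ∂(μ.map (innerSL ℝ v)) = ∫ f, (inner ℝ v f) * (inner ℝ v f) ∂μ := by
      rw [integral_map hm.aemeasurable (by fun_prop)]
      congr 1; ext f; rw [innerSL_apply_apply, sq]
    rw [← h1, hs]
    have := ProbabilityTheory.variance_fun_id_gaussianReal (μ := 0) (v := s)
    rw [ProbabilityTheory.variance_eq_integral (by fun_prop)] at this
    simpa using this.symm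
  have h2 : ∫ f, Complex.exp (Complex.I * ((inner ℝ v f : ℝ) : ℂ)) ∂μ =
      charFun (μ.map (innerSL ℝ v)) 1 := by
    rw [charFun_apply_real, integral_map hm.aemeasurable (by fun_prop)]
    congr 1; ext f; rw [innerSL_apply_apply]; push_cast; ring_nf
  rw [h2, hs, ProbabilityTheory.charFun_gaussianReal]
  have hs' : ((s : ℝ) : ℂ) = ((‖T v‖ ^ 2 : ℝ) : ℂ) := by rw [hvar]
  push_cast at hs' ⊢
  rw [hs']; congr 1; ring
def mm (α ξ : ℝ) : ℝ := min 4 (ξ ^ 2) * |ξ| ^ (-α)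
lemma mm_nonneg (α ξ : ℝ) : 0 ≤ mm α ξ := by unfold mm; positivity
lemma mm_meas (α : ℝ) : Measurable (mm α) := by unfold mm; fun_prop
lemma rpow_neg_le {x α : ℝ} (hx : 0 < x) (α₁ α₂ : ℝ) (h1 : α₁ ≤ α) (h2 : α ≤ α₂) :
    x ^ (-α) ≤ x ^ (-α₁) + x ^ (-α₂) := by
  have p1 := rpow_nonneg hx.le (-α₁)
  have p2 := rpow_nonneg hx.le (-α₂)
  rcases le_total x 1 with h | h
  · have := rpow_le_rpow_of_exponent_ge hx h (neg_le_neg h2)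
    linarith
  · have := rpow_le_rpow_of_exponent_le h (neg_le_neg h1)
    linarith
lemma mm_le {α : ℝ} (α₁ α₂ ξ : ℝ) (h1 : α₁ ≤ α) (h2 : α ≤ α₂) : mm α ξ ≤ mm α₁ ξ + mm α₂ ξ := by
  unfold mm
  rcases eq_or_ne ξ 0 with h | h
  · simp [h]
  rw [← mul_add]
  exact mul_le_mul_of_nonneg_left (rpow_neg_le (abs_pos.2 h) _ _ h1 h2) (by positivity)
lemma mm_int {α : ℝ} (h1 : 1 < α) (h3 : α < 3) : Integrable (mm α) := by
  have h : IntegrableOn (fun x : ℝ => min 4 (x ^ 2) * x ^ (-α)) (Ioi 0) := by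
    rw [← Ioc_union_Ioi_eq_Ioi zero_le_one]
    apply IntegrableOn.union
    · have : IntegrableOn (fun x : ℝ => x ^ (2 - α)) (Ioc 0 1) :=
        (intervalIntegrable_iff_integrableOn_Ioc_of_le zero_le_one).1
          (intervalIntegral.intervalIntegrable_rpow' (by linarith))
      apply this.mono' (by fun_prop)
      filter_upwards [ae_restrict_mem measurableSet_Ioc] with x hx
      have hx0 := hx.1
      rw [Real.norm_of_nonneg (by positivity), rpow_sub hx0, rpow_neg hx0.le, div_eq_mul_inv,
        rpow_two]
      gcongr
      exact min_le_right _ _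
    · have : IntegrableOn (fun x : ℝ => 4 * x ^ (-α)) (Ioi 1) :=
        (integrableOn_Ioi_rpow_of_lt (by linarith) one_pos).const_mul 4
      apply this.mono' (by fun_prop)
      filter_upwards [ae_restrict_mem measurableSet_Ioi] with x hx
      have hx0 : 0 < x := one_pos.trans hx
      rw [Real.norm_of_nonneg (by positivity)]
      gcongr
      exact min_le_left _ _
  have := integrable_abs_of h
  unfold mm
  simpa using this
lemma norm_exp_sub_one_sq (y : ℝ) : ‖Complex.exp (Complex.I * y) - 1‖ ^ 2 ≤ min 4 (y ^ 2) := by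
  apply le_min
  · have h : ‖Complex.exp (Complex.I * y) - 1‖ ≤ 2 := by
      refine (norm_sub_le _ _).trans ?_
      rw [mul_comm, Complex.norm_exp_ofReal_mul_I, norm_one]; norm_num
    nlinarith [norm_nonneg (Complex.exp (Complex.I * y) - 1)]
  · have h := Real.norm_exp_I_mul_ofReal_sub_one_le (x := y)
    rw [← sq_abs y]
    rw [Real.norm_eq_abs] at h
    gcongr
lemma Cstar_nonneg (h : ℝ) : 0 ≤ Cstar h := sqrt_nonneg _
lemma Cstar_cont : ContinuousOn Cstar (Icc 0 1) := by
  unfold Cstar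
  apply ContinuousOn.sqrt
  apply ContinuousOn.div_const
  apply ContinuousOn.mul _ (by fun_prop)
  intro x hx
  have hd : ContinuousAt Real.Gamma (2 * x + 1) := by
    apply (Real.differentiableAt_Gamma _).continuousAt
    intro m
    have h0 := hx.1
    have : (0:ℝ) ≤ m := Nat.cast_nonneg m
    intro h; linarith
  exact (hd.comp (f := fun x : ℝ => 2 * x + 1) (by fun_prop)).continuousWithinAt
lemma Cstar_bdd : ∃ C : ℝ, 0 < C ∧ ∀ h ∈ Icc (0:ℝ) 1, Cstar h ≤ C := by
  obtain ⟨C, hC⟩ := (isCompact_Icc.image_of_continuousOn Cstar_cont).bddAbove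
  exact ⟨max C 1, by positivity, fun h hh => (hC ⟨h, hh, rfl⟩).trans (le_max_left _ _)⟩
lemma Cstar_sq {h : ℝ} (h0 : 0 < h) (h1 : h < 1) :
    2 * π * Cstar h ^ 2 = Real.Gamma (2 * h + 1) * sin (π * h) := by
  unfold Cstar
  have hg : 0 < Real.Gamma (2 * h + 1) := Real.Gamma_pos_of_pos (by linarith)
  have hs : 0 < sin (π * h) := sin_pos_of_pos_of_lt_pi (by positivity) (by nlinarith [pi_pos])
  rw [Real.sq_sqrt (by positivity)]
  field_simp
lemma gs_pos {h : ℝ} (h0 : 0 < h) (h1 : h < 1) : 0 < Real.Gamma (2 * h + 1) * sin (π * h) := by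
  have hg : 0 < Real.Gamma (2 * h + 1) := Real.Gamma_pos_of_pos (by linarith)
  have hs : 0 < sin (π * h) := sin_pos_of_pos_of_lt_pi (by positivity) (by nlinarith [pi_pos])
  positivity
def aK (H : ℝ → ℝ) (x ξ : ℝ) : ℂ :=
  ((Cstar (H x) * |ξ| ^ (-(H x + 1 / 2)) : ℝ) : ℂ) * (Complex.exp (Complex.I * ((x * ξ : ℝ) : ℂ)) - 1)
structure Hreg (H : ℝ → ℝ) (lo hi : ℝ) : Prop where
  cont : Continuous H
  lo_pos : 0 < lo
  hi_lt : hi < 1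
  mem : ∀ x, H x ∈ Icc lo hi
lemma Hreg.mem01 {H : ℝ → ℝ} {lo hi : ℝ} (h : Hreg H lo hi) (x : ℝ) : H x ∈ Icc (0:ℝ) 1 :=
  ⟨h.lo_pos.le.trans (h.mem x).1, (h.mem x).2.trans h.hi_lt.le⟩
lemma Hreg.lohi {H : ℝ → ℝ} {lo hi : ℝ} (h : Hreg H lo hi) : lo ≤ hi :=
  (h.mem 0).1.trans (h.mem 0).2
lemma Hreg.cC {H : ℝ → ℝ} {lo hi : ℝ} (h : Hreg H lo hi) : Continuous (fun x => Cstar (H x)) :=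
  Cstar_cont.comp_continuous h.cont h.mem01
lemma exp_sub_one_mm {x : ℝ} (hx : x ∈ Ioo (0:ℝ) 1) (ξ : ℝ) :
    ‖Complex.exp (Complex.I * ((x * ξ : ℝ) : ℂ)) - 1‖ ^ 2 ≤ min 4 (ξ ^ 2) := by
  refine (norm_exp_sub_one_sq (x * ξ)).trans ?_
  apply min_le_min_left
  rw [mul_pow]
  have : x ^ 2 ≤ 1 := pow_le_one₀ hx.1.le hx.2.le
  nlinarith [sq_nonneg ξ]
lemma abs_rpow_half_sq (ξ b : ℝ) : (|ξ| ^ (-(b + 1 / 2))) ^ 2 = |ξ| ^ (-(2 * b + 1)) := by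
  rw [← rpow_natCast, ← rpow_mul (abs_nonneg _)]
  congr 1; push_cast; ring
lemma aK_norm_sq (H : ℝ → ℝ) {x : ℝ} (hx : x ∈ Ioo (0:ℝ) 1) (ξ : ℝ) :
    ‖aK H x ξ‖ ^ 2 ≤ Cstar (H x) ^ 2 * mm (2 * H x + 1) ξ := by
  unfold aK mm
  rw [norm_mul, mul_pow, Complex.norm_real, Real.norm_eq_abs, sq_abs, mul_pow, abs_rpow_half_sq]
  rw [mul_assoc, mul_comm (min _ _)]
  gcongr
  exact exp_sub_one_mm hx ξ
lemma aK_ker {H : ℝ → ℝ} {lo hi : ℝ} (h : Hreg H lo hi) :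
    ∃ g, Ker (aK H) g := by
  obtain ⟨C, hC, hCb⟩ := Cstar_bdd
  have hlh := h.lohi
  have h0 := h.lo_pos
  have h1 := h.hi_lt
  refine ⟨fun ξ => C * √(mm (2 * lo + 1) ξ + mm (2 * hi + 1) ξ), ?_, ?_, ?_⟩
  · unfold aK Function.uncurry
    have m1 := h.cC.measurable
    have m2 := h.cont.measurable
    apply Measurable.mul
    · apply Complex.measurable_ofReal.comp
      apply (m1.comp measurable_fst).mul
      apply Measurable.pow (by fun_prop)
      exact ((m2.comp measurable_fst).add_const _).neg
    · fun_prop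
  · intro x hx ξ
    apply abs_le_of_sq_le_sq' _ (by positivity) |>.2
    rw [mul_pow, Real.sq_sqrt (add_nonneg (mm_nonneg _ _) (mm_nonneg _ _))]
    refine (aK_norm_sq H hx ξ).trans ?_
    have := Cstar_nonneg (H x)
    have := mm_nonneg (2 * H x + 1) ξ
    have := hCb _ (h.mem01 x)
    have := (h.mem x)
    apply mul_le_mul (by gcongr) (mm_le _ _ _ (by linarith [this.1]) (by linarith [this.2])) (by assumption)
      (by positivity)
  · apply MemLp.const_mul
    have hms : Measurable (fun ξ => √(mm (2 * lo + 1) ξ + mm (2 * hi + 1) ξ)) :=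
      ((mm_meas _).add (mm_meas _)).sqrt
    rw [memLp_two_iff_integrable_sq hms.aestronglyMeasurable]
    have : (fun ξ => √(mm (2 * lo + 1) ξ + mm (2 * hi + 1) ξ) ^ 2) =
        fun ξ => mm (2 * lo + 1) ξ + mm (2 * hi + 1) ξ := by
      ext ξ; exact Real.sq_sqrt (add_nonneg (mm_nonneg _ _) (mm_nonneg _ _))
    rw [this]
    exact (mm_int (by linarith) (by linarith)).add (mm_int (by linarith) (by linarith))
lemma aK_G (H : ℝ → ℝ) (x y : ℝ) :
    ∫ ξ, (aK H x ξ * starRingEnd ℂ (aK H y ξ)).re = GmBM H x y := by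
  unfold GmBM
  rw [← integral_const_mul]
  congr 1; ext ξ
  unfold aK
  rcases eq_or_ne ξ 0 with h | h
  · simp [h]
  rw [map_mul, Complex.conj_ofReal, map_sub, map_one, ← Complex.exp_conj, map_mul, Complex.conj_I,
    Complex.conj_ofReal]
  have e : |ξ| ^ (-(H x + H y + 1)) = |ξ| ^ (-(H x + 1 / 2)) * |ξ| ^ (-(H y + 1 / 2)) := by
    rw [← rpow_add (abs_pos.2 h)]; congr 1; ring
  rw [e]
  set A := |ξ| ^ (-(H x + 1 / 2))
  set B := |ξ| ^ (-(H y + 1 / 2))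
  rw [show ((Cstar (H x) * A : ℝ) : ℂ) * (Complex.exp (Complex.I * ((x * ξ : ℝ) : ℂ)) - 1) *
    (((Cstar (H y) * B : ℝ) : ℂ) * (Complex.exp (-Complex.I * ((y * ξ : ℝ) : ℂ)) - 1)) =
    ((Cstar (H x) * A * (Cstar (H y) * B) : ℝ) : ℂ) *
      ((Complex.exp (Complex.I * x * ξ) - 1) * (Complex.exp (-Complex.I * y * ξ) - 1)) by
      push_cast; ring_nf, Complex.re_ofReal_mul]
  ring
lemma GmBM_congr {H H' : ℝ → ℝ} {x y : ℝ} (hx : H x = H' x) (hy : H y = H' y) :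
    GmBM H x y = GmBM H' x y := by unfold GmBM; rw [hx, hy]
lemma cov_eq {H H' : ℝ → ℝ} (hHH : ∀ x ∈ Ioo (0:ℝ) 1, H x = H' x) {g : ℝ → ℝ} (hk : Ker (aK H') g)
    (u : EE) : ∫ x in Ioo (0:ℝ) 1, ∫ y in Ioo (0:ℝ) 1, GmBM H x y * u x * u y = ‖hk.op u‖ ^ 2 := by
  rw [hk.fubini]
  apply setIntegral_congr_fun measurableSet_Ioo
  intro x hx
  apply setIntegral_congr_fun measurableSet_Ioo
  intro y hy
  simp only
  rw [aK_G, GmBM_congr (hHH x hx) (hHH y hy)]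
end
section
def eK (x ξ : ℝ) : ℂ := Complex.exp (Complex.I * ((x * ξ : ℝ) : ℂ))
lemma eK_norm (x ξ : ℝ) : ‖eK x ξ‖ = 1 := by
  unfold eK; rw [mul_comm, Complex.norm_exp_ofReal_mul_I]
lemma eK_meas : Measurable (Function.uncurry eK) := by
  unfold eK Function.uncurry; fun_prop
lemma eK_reg (ε : ℝ) (hε : 0 < ε) :
    Ker (fun x ξ => ((exp (-(ε / 2) * ξ ^ 2) : ℝ) : ℂ) * eK x ξ) (fun ξ => exp (-(ε / 2) * ξ ^ 2)) := by
  refine ⟨?_, ?_, ?_⟩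
  · have h1 := eK_meas
    unfold Function.uncurry at h1 ⊢
    apply Measurable.mul _ h1
    fun_prop
  · intro x _ ξ
    rw [norm_mul, eK_norm, mul_one, Complex.norm_real, Real.norm_of_nonneg (exp_pos _).le]
  · rw [memLp_two_iff_integrable_sq (by fun_prop)]
    have : (fun ξ : ℝ => exp (-(ε / 2) * ξ ^ 2) ^ 2) = fun ξ => exp (-ε * ξ ^ 2) := by
      ext ξ; rw [← exp_nat_mul]; congr 1; push_cast; ring
    rw [this]
    exact integrable_exp_neg_mul_sq hε
lemma gauss_kernel (ε : ℝ) (hε : 0 < ε) (x y : ℝ) :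
    ∫ ξ, ((((exp (-(ε / 2) * ξ ^ 2) : ℝ) : ℂ) * eK x ξ) *
      starRingEnd ℂ (((exp (-(ε / 2) * ξ ^ 2) : ℝ) : ℂ) * eK y ξ)).re =
    √(π / ε) * exp (-(1 / (4 * ε)) * (x - y) ^ 2) := by
  have key := fourierIntegral_gaussian (b := (ε : ℂ)) (by simpa using hε) ((x - y : ℝ) : ℂ)
  have e1 : ∀ ξ : ℝ, (((exp (-(ε / 2) * ξ ^ 2) : ℝ) : ℂ) * eK x ξ) *
      starRingEnd ℂ (((exp (-(ε / 2) * ξ ^ 2) : ℝ) : ℂ) * eK y ξ) =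
      Complex.exp (Complex.I * ((x - y : ℝ) : ℂ) * ξ) * Complex.exp (-ε * ξ ^ 2) := by
    intro ξ
    unfold eK
    rw [map_mul, Complex.conj_ofReal, ← Complex.exp_conj, map_mul, Complex.conj_I, Complex.conj_ofReal]
    push_cast
    rw [← Complex.exp_add, ← Complex.exp_add, ← Complex.exp_add, ← Complex.exp_add]
    congr 1; ring
  have hint : Integrable (fun ξ : ℝ => Complex.exp (Complex.I * ((x - y : ℝ) : ℂ) * ξ) *
      Complex.exp (-ε * ξ ^ 2)) := by
    have h2 := integrable_exp_neg_mul_sq hε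
    apply h2.mono' (by fun_prop)
    refine Eventually.of_forall fun ξ => ?_
    rw [norm_mul, Complex.norm_exp, Complex.norm_exp]
    have r1 : (Complex.I * ((x - y : ℝ) : ℂ) * ξ).re = 0 := by simp
    have r2 : (-(ε : ℂ) * (ξ : ℂ) ^ 2).re = -ε * ξ ^ 2 := by
      rw [show -(ε : ℂ) * (ξ : ℂ) ^ 2 = ((-ε * ξ ^ 2 : ℝ) : ℂ) by push_cast; ring, Complex.ofReal_re]
    rw [r1, r2]; simp
  simp_rw [e1]
  rw [← int_re hint, key]
  have e2 : ((π : ℂ) / (ε : ℂ)) ^ ((1:ℂ) / 2) = ((√(π / ε) : ℝ) : ℂ) := by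
    rw [sqrt_eq_rpow, Complex.ofReal_cpow (by positivity)]; push_cast; rfl
  have e3 : Complex.exp (-((x - y : ℝ) : ℂ) ^ 2 / (4 * ε)) =
      ((exp (-(1 / (4 * ε)) * (x - y) ^ 2) : ℝ) : ℂ) := by
    push_cast; congr 1; ring
  rw [e2, e3, ← Complex.ofReal_mul, Complex.ofReal_re]
lemma gauss_mass (ε : ℝ) (hε : 0 < ε) (x : ℝ) :
    ∫ y, √(π / ε) * exp (-(1 / (4 * ε)) * (x - y) ^ 2) ∂nu ≤ 2 * π := by
  have hi : Integrable (fun y : ℝ => √(π / ε) * exp (-(1 / (4 * ε)) * (x - y) ^ 2)) := by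
    apply Integrable.const_mul
    exact (integrable_exp_neg_mul_sq (b := 1 / (4 * ε)) (by positivity)).comp_sub_left x
  refine (setIntegral_le_integral hi (Eventually.of_forall fun y => by positivity)).trans (le_of_eq ?_)
  rw [integral_const_mul, integral_sub_left_eq_self (fun y => exp (-(1 / (4 * ε)) * y ^ 2)),
    integral_gaussian, ← sqrt_mul (by positivity)]
  rw [show π / ε * (π / (1 / (4 * ε))) = (2 * π) ^ 2 by field_simp; ring, sqrt_sq (by positivity)]
lemma reg_bound (ε : ℝ) (hε : 0 < ε) (u : EE) :
    ∫ ξ, exp (-ε * ξ ^ 2) * ‖KT eK u ξ‖ ^ 2 ≤ 2 * π * ‖u‖ ^ 2 := by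
  have hk := eK_reg ε hε
  have h1 := hk.fubini u
  have h2 := hk.op_norm_sq u
  have e1 : ∀ ξ, ‖KT (fun x ξ => ((exp (-(ε / 2) * ξ ^ 2) : ℝ) : ℂ) * eK x ξ) u ξ‖ ^ 2 =
      exp (-ε * ξ ^ 2) * ‖KT eK u ξ‖ ^ 2 := by
    intro ξ
    have : KT (fun x ξ => ((exp (-(ε / 2) * ξ ^ 2) : ℝ) : ℂ) * eK x ξ) u ξ =
        ((exp (-(ε / 2) * ξ ^ 2) : ℝ) : ℂ) * KT eK u ξ := by
      unfold KT
      rw [← integral_const_mul]; congr 1; ext x; ring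
    rw [this, norm_mul, mul_pow, Complex.norm_real, Real.norm_of_nonneg (exp_pos _).le,
      ← exp_nat_mul]
    congr 2; push_cast; ring
  simp_rw [e1] at h2
  rw [← h2, h1]
  simp_rw [gauss_kernel ε hε]
  set K : ℝ → ℝ → ℝ := fun x y => √(π / ε) * exp (-(1 / (4 * ε)) * (x - y) ^ 2) with hK
  have hKm : Measurable (fun z : ℝ × ℝ => K z.1 z.2) := by rw [hK]; fun_prop
  have hK0 : ∀ x y, 0 ≤ K x y := fun x y => by rw [hK]; positivity
  have hKb : ∀ x y, K x y ≤ √(π / ε) := fun x y => by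
    rw [hK]
    simp only
    have : exp (-(1 / (4 * ε)) * (x - y) ^ 2) ≤ 1 := by
      rw [exp_le_one_iff]
      have : 0 ≤ (1 / (4 * ε)) * (x - y) ^ 2 := by positivity
      linarith
    have := mul_le_mul_of_nonneg_left this (sqrt_nonneg (π / ε))
    linarith
  have hu : Measurable (u : ℝ → ℝ) := (Lp.stronglyMeasurable u).measurable
  have i1 : Integrable (fun z : ℝ × ℝ => K z.1 z.2 * u z.1 ^ 2) (nu.prod nu) := by
    have b := (ee_sq_int u).mul_prod (integrable_const (√(π / ε)) : Integrable (fun _ => √(π / ε)) nu)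
    apply b.mono' (hKm.mul ((hu.comp measurable_fst).pow_const 2)).aestronglyMeasurable
    refine Eventually.of_forall fun z => ?_
    have := hK0 z.1 z.2
    have := hKb z.1 z.2
    change ‖K z.1 z.2 * u z.1 ^ 2‖ ≤ u z.1 ^ 2 * √(π / ε)
    rw [Real.norm_of_nonneg (by positivity), mul_comm]
    gcongr
  have i2 : Integrable (fun z : ℝ × ℝ => K z.1 z.2 * u z.2 ^ 2) (nu.prod nu) := by
    have b := (integrable_const (√(π / ε)) : Integrable (fun _ => √(π / ε)) nu).mul_prod (ee_sq_int u)
    apply b.mono' (hKm.mul ((hu.comp measurable_snd).pow_const 2)).aestronglyMeasurable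
    refine Eventually.of_forall fun z => ?_
    have := hK0 z.1 z.2
    have := hKb z.1 z.2
    change ‖K z.1 z.2 * u z.2 ^ 2‖ ≤ √(π / ε) * u z.2 ^ 2
    rw [Real.norm_of_nonneg (by positivity)]
    gcongr
  have i3 : Integrable (fun z : ℝ × ℝ => K z.1 z.2 * u z.1 * u z.2) (nu.prod nu) := by
    apply (i1.add i2).mono' ((hKm.mul (hu.comp measurable_fst)).mul (hu.comp measurable_snd)).aestronglyMeasurable
    refine Eventually.of_forall fun z => ?_
    have := hK0 z.1 z.2
    change ‖K z.1 z.2 * u z.1 * u z.2‖ ≤ K z.1 z.2 * u z.1 ^ 2 + K z.1 z.2 * u z.2 ^ 2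
    rw [mul_assoc, norm_mul, Real.norm_of_nonneg this, Real.norm_eq_abs, ← mul_add]
    gcongr
    rw [abs_mul]
    nlinarith [sq_nonneg (|u z.1| - |u z.2|), sq_abs (u z.1), sq_abs (u z.2), abs_nonneg (u z.1), abs_nonneg (u z.2)]
  have j1 : ∫ z, K z.1 z.2 * u z.1 ^ 2 ∂(nu.prod nu) ≤ 2 * π * ‖u‖ ^ 2 := by
    rw [integral_prod _ i1, ee_norm_sq, ← integral_const_mul]
    apply integral_mono i1.integral_prod_left ((ee_sq_int u).const_mul _)
    intro x
    simp only
    rw [integral_mul_const]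
    exact mul_le_mul_of_nonneg_right (gauss_mass ε hε x) (sq_nonneg _)
  have j2 : ∫ z, K z.1 z.2 * u z.2 ^ 2 ∂(nu.prod nu) ≤ 2 * π * ‖u‖ ^ 2 := by
    rw [integral_prod_symm _ i2, ee_norm_sq, ← integral_const_mul]
    apply integral_mono i2.integral_prod_right ((ee_sq_int u).const_mul _)
    intro x
    simp only
    rw [integral_mul_const]
    refine mul_le_mul_of_nonneg_right (le_trans (le_of_eq ?_) (gauss_mass ε hε x)) (sq_nonneg _)
    congr 1; ext y; simp only [hK]; congr 3; ring
  change ∫ x, ∫ y, K x y * u x * u y ∂nu ∂nu ≤ _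
  rw [← integral_prod (fun z : ℝ × ℝ => K z.1 z.2 * u z.1 * u z.2) i3]
  calc ∫ z, K z.1 z.2 * u z.1 * u z.2 ∂(nu.prod nu)
      ≤ ∫ z, ((1 / 2) * (K z.1 z.2 * u z.1 ^ 2) + (1 / 2) * (K z.1 z.2 * u z.2 ^ 2)) ∂(nu.prod nu) := by
        apply integral_mono i3 ((i1.const_mul _).add (i2.const_mul _))
        intro z
        have := hK0 z.1 z.2
        simp only [Pi.add_apply]
        nlinarith [mul_nonneg this (sq_nonneg (u z.1 - u z.2))]
    _ ≤ 2 * π * ‖u‖ ^ 2 := by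
        rw [integral_add (i1.const_mul _) (i2.const_mul _), integral_const_mul, integral_const_mul]
        linarith
lemma eK_int (u : EE) (ξ : ℝ) : Integrable (fun x => (u x : ℂ) * eK x ξ) nu := by
  have h1 : Integrable (fun x => (u x : ℂ)) nu := (ee_int u).ofReal
  apply h1.mono
  · apply h1.1.mul
    exact (eK_meas.comp (measurable_id.prodMk measurable_const)).aestronglyMeasurable
  · refine Eventually.of_forall fun x => ?_
    rw [norm_mul, eK_norm, mul_one]
lemma KT_eK_sm (u : EE) : StronglyMeasurable (KT eK u) := by
  have h : StronglyMeasurable (fun p : ℝ × ℝ => (u p.2 : ℂ) * eK p.2 p.1) := by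
    apply Measurable.stronglyMeasurable
    apply Measurable.mul
    · exact Complex.measurable_ofReal.comp ((Lp.stronglyMeasurable u).measurable.comp measurable_snd)
    · exact eK_meas.comp (measurable_snd.prodMk measurable_fst)
  exact h.integral_prod_right
lemma eK_bd (u : EE) (ξ : ℝ) : ‖KT eK u ξ‖ ≤ ‖u‖ := by
  unfold KT
  refine (norm_integral_le_integral_norm _).trans (le_trans (le_of_eq ?_) (ee_l1 u))
  congr 1; ext x
  rw [norm_mul, eK_norm, mul_one, Complex.norm_real, Real.norm_eq_abs]
theorem plancherel (u : EE) : Integrable (fun ξ => ‖KT eK u ξ‖ ^ 2) ∧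
    ∫ ξ, ‖KT eK u ξ‖ ^ 2 ≤ 2 * π * ‖u‖ ^ 2 := by
  have hm : Measurable (fun ξ => ‖KT eK u ξ‖ ^ 2) := ((KT_eK_sm u).measurable.norm).pow_const 2
  have key : ∫⁻ ξ, ENNReal.ofReal (‖KT eK u ξ‖ ^ 2) ≤ ENNReal.ofReal (2 * π * ‖u‖ ^ 2) := by
    let f : ℕ → ℝ → ℝ≥0∞ := fun n ξ =>
      ENNReal.ofReal (exp (-(1 / ((n:ℝ) + 1)) * ξ ^ 2) * ‖KT eK u ξ‖ ^ 2)
    have hf : ∀ n, Measurable (f n) := fun n => by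
      apply Measurable.ennreal_ofReal
      exact Measurable.mul (by fun_prop) hm
    have hlim : ∀ ξ, liminf (fun n => f n ξ) atTop = ENNReal.ofReal (‖KT eK u ξ‖ ^ 2) := fun ξ => by
      apply Tendsto.liminf_eq
      apply ENNReal.tendsto_ofReal
      have h0 : Tendsto (fun n : ℕ => -(1 / ((n:ℝ) + 1)) * ξ ^ 2) atTop (nhds (-0 * ξ ^ 2)) :=
        (tendsto_one_div_add_atTop_nhds_zero_nat.neg).mul_const _
      have h1 := (Real.continuous_exp.tendsto _).comp h0
      have h2 := h1.mul_const (‖KT eK u ξ‖ ^ 2)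
      simpa using h2
    have hb : ∀ n, ∫⁻ ξ, f n ξ ≤ ENNReal.ofReal (2 * π * ‖u‖ ^ 2) := fun n => by
      have hp : (0:ℝ) < 1 / ((n:ℝ) + 1) := by positivity
      have hi : Integrable (fun ξ => exp (-(1 / ((n:ℝ) + 1)) * ξ ^ 2) * ‖KT eK u ξ‖ ^ 2) := by
        apply ((integrable_exp_neg_mul_sq hp).mul_const (‖u‖ ^ 2)).mono'
          (Measurable.mul (by fun_prop) hm).aestronglyMeasurable
        refine Eventually.of_forall fun ξ => ?_
        change ‖exp (-(1 / ((n:ℝ) + 1)) * ξ ^ 2) * ‖KT eK u ξ‖ ^ 2‖ ≤ _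
        rw [Real.norm_of_nonneg (by positivity)]
        have := eK_bd u ξ
        gcongr
      rw [← ofReal_integral_eq_lintegral_ofReal hi (Eventually.of_forall fun ξ => by positivity)]
      exact ENNReal.ofReal_le_ofReal (reg_bound _ hp u)
    calc ∫⁻ ξ, ENNReal.ofReal (‖KT eK u ξ‖ ^ 2) = ∫⁻ ξ, liminf (fun n => f n ξ) atTop := by
          simp_rw [hlim]
      _ ≤ liminf (fun n => ∫⁻ ξ, f n ξ) atTop := lintegral_liminf_le hf
      _ ≤ liminf (fun _ : ℕ => ENNReal.ofReal (2 * π * ‖u‖ ^ 2)) atTop :=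
          liminf_le_liminf (Eventually.of_forall hb)
      _ = _ := liminf_const _
  have hi : Integrable (fun ξ => ‖KT eK u ξ‖ ^ 2) := by
    refine ⟨hm.aestronglyMeasurable, ?_⟩
    rw [hasFiniteIntegral_iff_ofReal (Eventually.of_forall fun ξ => sq_nonneg _)]
    exact key.trans_lt ENNReal.ofReal_lt_top
  refine ⟨hi, ?_⟩
  rw [← ofReal_integral_eq_lintegral_ofReal hi (Eventually.of_forall fun ξ => sq_nonneg _)] at key
  exact (ENNReal.ofReal_le_ofReal_iff (by positivity)).1 key
end
section
lemma KT_const_mean_zero (h0 : ℝ) (u : EE) (hu : ∫ x, u x ∂nu = 0) (ξ : ℝ) :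
    KT (aK (fun _ => h0)) u ξ = ((Cstar h0 * |ξ| ^ (-(h0 + 1 / 2)) : ℝ) : ℂ) * KT eK u ξ := by
  unfold KT
  have h1 : ∀ x, (u x : ℂ) * aK (fun _ => h0) x ξ =
      ((Cstar h0 * |ξ| ^ (-(h0 + 1 / 2)) : ℝ) : ℂ) * ((u x : ℂ) * eK x ξ - (u x : ℂ)) := by
    intro x; unfold aK eK; ring
  simp_rw [h1]
  have hof : Integrable (fun x => (u x : ℂ)) nu := (ee_int u).ofReal
  rw [integral_const_mul, integral_sub (eK_int u ξ) hof]
  have : ∫ x, (u x : ℂ) ∂nu = 0 := by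
    rw [integral_complex_ofReal, hu, Complex.ofReal_zero]
  rw [this, sub_zero]
lemma KT_const_mean_zero_sq (h0 : ℝ) (u : EE) (hu : ∫ x, u x ∂nu = 0) (ξ : ℝ) :
    ‖KT (aK (fun _ => h0)) u ξ‖ ^ 2 = Cstar h0 ^ 2 * |ξ| ^ (-(2 * h0 + 1)) * ‖KT eK u ξ‖ ^ 2 := by
  rw [KT_const_mean_zero h0 u hu, norm_mul, mul_pow, Complex.norm_real, Real.norm_eq_abs, sq_abs,
    mul_pow, abs_rpow_half_sq]
lemma log_tangent {c y : ℝ} (hc : 0 ≤ c) (hy : 0 ≤ y) :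
    log (1 + y) ≤ log (1 + c) + (y - c) / (1 + c) := by
  have h := log_le_sub_one_of_pos (x := (1 + y) / (1 + c)) (by positivity)
  rw [log_div (by positivity) (by positivity)] at h
  have : (1 + y) / (1 + c) - 1 = (y - c) / (1 + c) := by field_simp; ring
  linarith
lemma log_lower {c : ℝ} (hc : 0 ≤ c) : c / (1 + c) ≤ log (1 + c) := by
  have h := log_tangent hc (le_refl 0)
  rw [add_zero, log_one] at h
  have : (0 - c) / (1 + c) = - (c / (1 + c)) := by ring
  linarith
lemma jensen_log (y m : ℝ → ℝ) (hy : ∀ ξ, 0 ≤ y ξ) (hm : ∀ ξ, 0 ≤ m ξ) (hym : Measurable y)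
    (him : Integrable m) (hM : ∫ ξ, m ξ ≤ 1) (hi : Integrable (fun ξ => y ξ * m ξ)) :
    Integrable (fun ξ => log (1 + y ξ) * m ξ) ∧
    ∫ ξ, log (1 + y ξ) * m ξ ≤ log (1 + ∫ ξ, y ξ * m ξ) := by
  have hi2 : Integrable (fun ξ => log (1 + y ξ) * m ξ) := by
    apply hi.mono' ((Real.measurable_log.comp (measurable_const.add hym)).aestronglyMeasurable.mul him.1)
    refine Eventually.of_forall fun ξ => ?_
    have h0 : 0 ≤ log (1 + y ξ) := log_nonneg (by linarith [hy ξ])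
    change ‖log (1 + y ξ) * m ξ‖ ≤ _
    rw [Real.norm_of_nonneg (mul_nonneg h0 (hm ξ))]
    apply mul_le_mul_of_nonneg_right _ (hm ξ)
    have := log_le_sub_one_of_pos (x := 1 + y ξ) (by linarith [hy ξ])
    linarith
  refine ⟨hi2, ?_⟩
  set c := ∫ ξ, y ξ * m ξ with hc
  have hc0 : 0 ≤ c := integral_nonneg fun ξ => mul_nonneg (hy ξ) (hm ξ)
  set M := ∫ ξ, m ξ with hMd
  calc ∫ ξ, log (1 + y ξ) * m ξ
      ≤ ∫ ξ, ((log (1 + c) - c / (1 + c)) * m ξ + (1 / (1 + c)) * (y ξ * m ξ)) := by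
        apply integral_mono hi2 ((him.const_mul _).add (hi.const_mul _))
        intro ξ
        have := mul_le_mul_of_nonneg_right (log_tangent hc0 (hy ξ)) (hm ξ)
        simp only [Pi.add_apply]
        refine this.trans (le_of_eq ?_)
        ring
    _ = (log (1 + c) - c / (1 + c)) * M + (1 / (1 + c)) * c := by
        rw [integral_add (him.const_mul _) (hi.const_mul _), integral_const_mul, integral_const_mul]
    _ ≤ log (1 + c) := by
        have h1 := log_lower hc0
        have : (log (1 + c) - c / (1 + c)) * M ≤ (log (1 + c) - c / (1 + c)) * 1 :=
          mul_le_mul_of_nonneg_left hM (by linarith)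
        have e : (1 / (1 + c)) * c = c / (1 + c) := by ring
        linarith
lemma jensen_op (h0 : ℝ) {g : ℝ → ℝ} (hk : Ker (aK (fun _ => h0)) g)
    (u : EE) (hu : ∫ x, u x ∂nu = 0) (hn : ‖u‖ ≤ 1) (s : ℝ) (hs : 0 ≤ s) (a : ℝ)
    (ha : a = 2 * π * Cstar h0 ^ 2) :
    Integrable (fun ξ => log (1 + s * a * |ξ| ^ (-(2 * h0 + 1))) * ‖KT eK u ξ‖ ^ 2) ∧
    (1 / (2 * π)) * ∫ ξ, log (1 + s * a * |ξ| ^ (-(2 * h0 + 1))) * ‖KT eK u ξ‖ ^ 2 ≤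
      log (1 + s * ‖hk.op u‖ ^ 2) := by
  have ha0 : 0 ≤ a := by rw [ha]; positivity
  obtain ⟨pi, pb⟩ := plancherel u
  have hop := hk.op_norm_sq u
  have hopi := hk.op_sq_int u
  simp_rw [KT_const_mean_zero_sq h0 u hu] at hop hopi
  have e : ∀ ξ, s * a * |ξ| ^ (-(2 * h0 + 1)) * ((1 / (2 * π)) * ‖KT eK u ξ‖ ^ 2) =
      s * (Cstar h0 ^ 2 * |ξ| ^ (-(2 * h0 + 1)) * ‖KT eK u ξ‖ ^ 2) := by
    intro ξ; rw [ha]; field_simp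
  have key := jensen_log (fun ξ => s * a * |ξ| ^ (-(2 * h0 + 1))) (fun ξ => (1 / (2 * π)) * ‖KT eK u ξ‖ ^ 2)
    (fun ξ => by positivity) (fun ξ => by positivity) (by fun_prop) (pi.const_mul _) (by
      rw [integral_const_mul]
      have : 2 * π * ‖u‖ ^ 2 ≤ 2 * π := by
        have := pow_le_one₀ (n := 2) (norm_nonneg u) hn
        nlinarith [pi_pos]
      rw [one_div, inv_mul_le_iff₀ (by positivity), mul_one]
      exact pb.trans this) (by simp_rw [e]; exact hopi.const_mul s)
  simp_rw [e] at key
  rw [integral_const_mul s, ← hop] at key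
  have e2 : ∀ ξ, log (1 + s * a * |ξ| ^ (-(2 * h0 + 1))) * ((1 / (2 * π)) * ‖KT eK u ξ‖ ^ 2) =
     (1 / (2 * π)) * (log (1 + s * a * |ξ| ^ (-(2 * h0 + 1))) * ‖KT eK u ξ‖ ^ 2) := fun ξ => by ring
  simp_rw [e2] at key
  rw [integral_const_mul (1 / (2 * π))] at key
  refine ⟨?_, key.2⟩
  have := key.1.const_mul (2 * π)
  refine this.congr (Eventually.of_forall fun ξ => ?_)
  simp only
  field_simp
def cosE (ξ : ℝ) : EE := (MemLp.of_bound (μ := nu) (p := 2) (f := fun x => cos (x * ξ))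
  (by fun_prop) 1 (Eventually.of_forall fun x => Real.abs_cos_le_one _)).toLp _
def sinE (ξ : ℝ) : EE := (MemLp.of_bound (μ := nu) (p := 2) (f := fun x => sin (x * ξ))
  (by fun_prop) 1 (Eventually.of_forall fun x => Real.abs_sin_le_one _)).toLp _
def oneE : EE := (memLp_const (μ := nu) (p := 2) (1:ℝ)).toLp _
lemma cosE_coe (ξ : ℝ) : ∀ᵐ x ∂nu, cosE ξ x = cos (x * ξ) := by unfold cosE; exact MemLp.coeFn_toLp _
lemma sinE_coe (ξ : ℝ) : ∀ᵐ x ∂nu, sinE ξ x = sin (x * ξ) := by unfold sinE; exact MemLp.coeFn_toLp _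
lemma oneE_coe : ∀ᵐ x ∂nu, oneE x = 1 := by unfold oneE; exact MemLp.coeFn_toLp _
lemma KT_eK_sq (u : EE) (ξ : ℝ) : ‖KT eK u ξ‖ ^ 2 = inner ℝ u (cosE ξ) ^ 2 + inner ℝ u (sinE ξ) ^ 2 := by
  have e1 : (KT eK u ξ).re = inner ℝ u (cosE ξ) := by
    unfold KT
    rw [int_re (eK_int u ξ), ee_inner]
    apply integral_congr_ae
    filter_upwards [cosE_coe ξ] with x hx
    rw [hx, Complex.re_ofReal_mul]; unfold eK
    rw [mul_comm Complex.I, Complex.exp_ofReal_mul_I_re]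
  have e2 : (KT eK u ξ).im = inner ℝ u (sinE ξ) := by
    unfold KT
    rw [int_im (eK_int u ξ), ee_inner]
    apply integral_congr_ae
    filter_upwards [sinE_coe ξ] with x hx
    rw [hx, Complex.im_ofReal_mul]; unfold eK
    rw [mul_comm Complex.I, Complex.exp_ofReal_mul_I_im]
  rw [← e1, ← e2, ← Complex.normSq_eq_norm_sq, Complex.normSq_apply]; ring
section
variable (D : Set ℝ) (hD : MeasurableSet D)
lemma o_norm : ‖ind D hD oneE‖ ^ 2 = nu.real D := by
  rw [ind_norm_sq]
  have : ∫ x in D, oneE x ^ 2 ∂nu = ∫ x in D, (1:ℝ) ∂nu := by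
    apply integral_congr_ae
    filter_upwards [ae_restrict_of_ae oneE_coe] with x hx
    rw [hx, one_pow]
  rw [this]; simp [Measure.real]
lemma cs_norm (ξ : ℝ) : ‖ind D hD (cosE ξ)‖ ^ 2 + ‖ind D hD (sinE ξ)‖ ^ 2 = nu.real D := by
  rw [ind_norm_sq, ind_norm_sq, ← integral_add (ee_sq_int _).integrableOn (ee_sq_int _).integrableOn]
  have : ∫ x in D, (cosE ξ x ^ 2 + sinE ξ x ^ 2) ∂nu = ∫ x in D, (1:ℝ) ∂nu := by
    apply integral_congr_ae
    filter_upwards [ae_restrict_of_ae (cosE_coe ξ), ae_restrict_of_ae (sinE_coe ξ)] with x h1 h2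
    rw [h1, h2]; exact cos_sq_add_sin_sq _
  rw [this]; simp [Measure.real]
def PD (u : EE) : EE := ind D hD (u - (inner ℝ (ind D hD oneE) u / nu.real D) • ind D hD oneE)
lemma PD_eq (u : EE) : PD D hD u = ind D hD u - (inner ℝ (ind D hD oneE) u / nu.real D) • ind D hD oneE := by
  unfold PD; rw [map_sub, map_smul, ind_idem]
lemma PD_symm (u v : EE) : inner ℝ (PD D hD u) v = inner ℝ u (PD D hD v) := by
  rw [PD_eq, PD_eq, inner_sub_left, inner_sub_right, inner_smul_left, inner_smul_right, ind_symm]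
  simp only [RCLike.conj_to_real]
  rw [real_inner_comm (ind D hD oneE) u]; ring
lemma o_ind (u : EE) : inner ℝ (ind D hD oneE) (ind D hD u) = inner ℝ (ind D hD oneE) u := by
  rw [← ind_symm, ind_idem]
lemma PD_norm (hM : nu.real D ≠ 0) (u : EE) :
    ‖PD D hD u‖ ^ 2 = ‖ind D hD u‖ ^ 2 - inner ℝ (ind D hD oneE) u ^ 2 / nu.real D := by
  rw [PD_eq, norm_sub_sq_real, inner_smul_right, norm_smul, mul_pow, o_norm, real_inner_comm (ind D hD oneE), o_ind,
    Real.norm_eq_abs, sq_abs]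
  field_simp; ring
lemma ind_norm_le (u : EE) : ‖ind D hD u‖ ≤ ‖u‖ := indF_norm D hD u
lemma PD_norm_le (hM : nu.real D ≠ 0) (u : EE) : ‖PD D hD u‖ ≤ ‖u‖ := by
  apply abs_le_of_sq_le_sq' _ (norm_nonneg _) |>.2
  rw [PD_norm D hD hM]
  have h1 := ind_norm_le D hD u
  have h2 : ‖ind D hD u‖ ^ 2 ≤ ‖u‖ ^ 2 := by gcongr
  have : 0 ≤ inner ℝ (ind D hD oneE) u ^ 2 / nu.real D := by positivity
  linarith
lemma int_eq_inner (u : EE) : ∫ x, u x ∂nu = inner ℝ oneE u := by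
  rw [ee_inner]
  apply integral_congr_ae
  filter_upwards [oneE_coe] with x hx
  rw [hx, one_mul]
lemma PD_mean (hM : nu.real D ≠ 0) (u : EE) : ∫ x, PD D hD u x ∂nu = 0 := by
  rw [int_eq_inner, ← PD_symm, PD_eq, real_inner_comm, ← o_ind, real_inner_self_eq_norm_sq, o_norm,
    div_self hM, one_smul, sub_self, inner_zero_right]
def PDL : EE →L[ℝ] EE :=
  ind D hD - (innerSL ℝ ((1 / nu.real D) • ind D hD oneE)).smulRight (ind D hD oneE)
lemma PDL_apply (u : EE) : PDL D hD u = PD D hD u := by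
  rw [PD_eq]; unfold PDL
  simp only [sub_apply, ContinuousLinearMap.smulRight_apply, innerSL_apply_apply,
    inner_smul_left, RCLike.conj_to_real]
  congr 2; ring
lemma cs_PD (hM : nu.real D ≠ 0) (ξ : ℝ) : ‖PD D hD (cosE ξ)‖ ^ 2 + ‖PD D hD (sinE ξ)‖ ^ 2 =
    nu.real D - ‖KT eK (ind D hD oneE) ξ‖ ^ 2 / nu.real D := by
  rw [PD_norm D hD hM, PD_norm D hD hM, KT_eK_sq, ← cs_norm D hD ξ]; ring
end
end
section
section
variable [MeasurableSpace EE] [BorelSpace EE] (μ : Measure EE) [IsProbabilityMeasure μ]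
  (T : EE →L[ℝ] HH)
lemma mu_dual (hchar : ∀ v : EE, ∫ f, Complex.exp (Complex.I * ((inner ℝ v f : ℝ) : ℂ)) ∂μ =
      (exp (-(‖T v‖ ^ 2) / 2) : ℂ)) {ι : Type*} [Fintype ι] (v : ι → EE) (s : ℝ) (hs : 0 ≤ s) :
    ∫ f, exp (-(s / 2) * ∑ i, inner ℝ (v i) f ^ 2) ∂μ
      = ∫ Z, exp (-(s / 2) * ‖∑ i, Z i • T (v i)‖ ^ 2) ∂(gaussPi ι) := by
  apply gauss_dual μ (fun i f => inner ℝ (v i) f) (fun i => ?_) (fun i => T (v i)) (fun z => ?_) s hs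
  · exact (innerSL ℝ (v i)).continuous.measurable
  · have := hchar (∑ i, z i • v i)
    rw [map_sum] at this
    simp only [map_smul] at this
    rw [← this]
    congr 1; ext f
    rw [sum_inner]
    simp only [inner_smul_left, RCLike.conj_to_real]
lemma exp_bdd_int (F : EE → ℝ) (hF : Measurable F) (hF0 : ∀ f, 0 ≤ F f) (s : ℝ) (hs : 0 ≤ s) :
    Integrable (fun f => exp (-(s / 2) * F f)) μ := by
  apply (integrable_const (1:ℝ)).mono' (by fun_prop)
  refine Eventually.of_forall fun f => ?_
  rw [Real.norm_of_nonneg (exp_pos _).le, exp_le_one_iff]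
  nlinarith [hF0 f, mul_nonneg hs (hF0 f)]
lemma phi_pos (F : EE → ℝ) (hF : Measurable F) (hF0 : ∀ f, 0 ≤ F f) (s : ℝ) (hs : 0 ≤ s) :
    0 < ∫ f, exp (-(s / 2) * F f) ∂μ := integral_exp_pos (exp_bdd_int μ F hF hF0 s hs)
lemma log_prod_sqrt {n : ℕ} (x : Fin n → ℝ) (hx : ∀ i, 0 ≤ x i) :
    log (∏ i, (√(1 + x i))⁻¹) = -(1 / 2) * ∑ i, log (1 + x i) := by
  have hp : ∀ i, 0 < 1 + x i := fun i => by linarith [hx i]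
  rw [log_prod (fun i _ => (inv_pos.2 (Real.sqrt_pos.2 (hp i))).ne'), Finset.mul_sum]
  refine Finset.sum_congr rfl fun i _ => ?_
  rw [log_inv, log_sqrt (hp i).le]; ring
lemma upper_fin (hchar : ∀ v : EE, ∫ f, Complex.exp (Complex.I * ((inner ℝ v f : ℝ) : ℂ)) ∂μ =
      (exp (-(‖T v‖ ^ 2) / 2) : ℂ)) (h0 : ℝ) {g : ℝ → ℝ} (hk : Ker (aK (fun _ => h0)) g)
    (D : Set ℝ) (hD : MeasurableSet D) (hTD : ∀ u, T (ind D hD u) = hk.op (ind D hD u))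
    (hM : nu.real D ≠ 0) (s : ℝ) (hs : 0 ≤ s) (a : ℝ) (ha : a = 2 * π * Cstar h0 ^ 2)
    {ι : Type} (h : ι → EE) (hh : Orthonormal ℝ h) (K : Finset ι) :
    ∑ i ∈ K, ∫ ξ, log (1 + s * a * |ξ| ^ (-(2 * h0 + 1))) * ‖KT eK (PD D hD (h i)) ξ‖ ^ 2 ≤
      2 * π * (-2 * log (∫ f, exp (-(s / 2) * ‖f‖ ^ 2) ∂μ)) := by
  classical
  let hK : Fin K.card → EE := fun j => h (K.equivFin.symm j)
  have hhK : Orthonormal ℝ hK :=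
    hh.comp (fun j => (K.equivFin.symm j : ι)) (Subtype.val_injective.comp K.equivFin.symm.injective)
  have hsum : ∀ F : ι → ℝ, ∑ j, F (K.equivFin.symm j) = ∑ i ∈ K, F i := by
    intro F
    rw [K.equivFin.symm.sum_comp (fun i : K => F i), Finset.sum_coe_sort]
  obtain ⟨e, heo, hes, horth, -⟩ := diag_lemma hK hhK (T.comp (PDL D hD))
  simp only [ContinuousLinearMap.comp_apply, PDL_apply] at horth
  have hop : ∀ j, T (PD D hD (e j)) = hk.op (PD D hD (e j)) := fun j => hTD _
  have hn : ∀ j, ‖PD D hD (e j)‖ ≤ 1 := fun j => (PD_norm_le D hD hM _).trans (heo.1 j).le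
  have hup : ∫ f, exp (-(s / 2) * ‖f‖ ^ 2) ∂μ ≤ ∏ j, (√(1 + s * ‖T (PD D hD (e j))‖ ^ 2))⁻¹ := by
    rw [← gauss_orth _ horth s hs, ← mu_dual μ T hchar (fun j => PD D hD (e j)) s hs]
    apply integral_mono
    · exact exp_bdd_int μ (fun f => ‖f‖ ^ 2) (by fun_prop) (fun f => sq_nonneg _) s hs
    · exact exp_bdd_int μ (fun f => ∑ j, inner ℝ (PD D hD (e j)) f ^ 2)
        (Finset.measurable_sum _ fun j _ => ((innerSL ℝ (PD D hD (e j))).continuous.measurable).pow_const 2)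
        (fun f => Finset.sum_nonneg fun j _ => sq_nonneg _) s hs
    · intro f
      simp only
      apply exp_le_exp.2
      have b := heo.sum_inner_products_le (PD D hD f) (s := Finset.univ)
      have b2 := PD_norm_le D hD hM f
      have b3 : ‖PD D hD f‖ ^ 2 ≤ ‖f‖ ^ 2 := by gcongr
      simp only [Real.norm_eq_abs, sq_abs] at b
      have b4 : ∑ j, inner ℝ (PD D hD (e j)) f ^ 2 ≤ ‖f‖ ^ 2 := by
        simp_rw [PD_symm]; exact b.trans b3
      nlinarith
  have hpos := phi_pos μ (fun f => ‖f‖ ^ 2) (by fun_prop) (fun f => sq_nonneg _) s hs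
  have hlog := log_le_log hpos hup
  rw [log_prod_sqrt _ (fun j => by positivity)] at hlog
  have hJ := fun j => jensen_op h0 hk (PD D hD (e j)) (PD_mean D hD hM _) (hn j) s hs a ha
  have hJ' := fun j => jensen_op h0 hk (PD D hD (hK j)) (PD_mean D hD hM _)
    ((PD_norm_le D hD hM _).trans (hhK.1 j).le) s hs a ha
  have hS : ∑ j, ∫ ξ, log (1 + s * a * |ξ| ^ (-(2 * h0 + 1))) * ‖KT eK (PD D hD (e j)) ξ‖ ^ 2 =
      ∑ i ∈ K, ∫ ξ, log (1 + s * a * |ξ| ^ (-(2 * h0 + 1))) * ‖KT eK (PD D hD (h i)) ξ‖ ^ 2 := by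
    rw [← hsum (fun i => ∫ ξ, log (1 + s * a * |ξ| ^ (-(2 * h0 + 1))) * ‖KT eK (PD D hD (h i)) ξ‖ ^ 2)]
    change _ = ∑ j, ∫ ξ, log (1 + s * a * |ξ| ^ (-(2 * h0 + 1))) * ‖KT eK (PD D hD (hK j)) ξ‖ ^ 2
    rw [← integral_finsetSum _ (fun j _ => (hJ j).1), ← integral_finsetSum _ (fun j _ => (hJ' j).1)]
    congr 1; ext ξ
    rw [← Finset.mul_sum, ← Finset.mul_sum]
    congr 1
    simp_rw [KT_eK_sq, PD_symm]
    rw [Finset.sum_add_distrib, Finset.sum_add_distrib, hes, hes]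
  rw [← hS]
  have hle : ∑ j, (1 / (2 * π)) * ∫ ξ, log (1 + s * a * |ξ| ^ (-(2 * h0 + 1))) *
      ‖KT eK (PD D hD (e j)) ξ‖ ^ 2 ≤ ∑ j, log (1 + s * ‖T (PD D hD (e j))‖ ^ 2) :=
    Finset.sum_le_sum fun j _ => by rw [hop]; exact (hJ j).2
  rw [← Finset.mul_sum, one_div, inv_mul_le_iff₀ (by positivity)] at hle
  refine hle.trans (mul_le_mul_of_nonneg_left ?_ (by positivity))
  linarith
theorem upper_phi (hchar : ∀ v : EE, ∫ f, Complex.exp (Complex.I * ((inner ℝ v f : ℝ) : ℂ)) ∂μ =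
      (exp (-(‖T v‖ ^ 2) / 2) : ℂ)) (h0 : ℝ) (hh0 : 0 < h0) {g : ℝ → ℝ}
    (hk : Ker (aK (fun _ => h0)) g)
    (D : Set ℝ) (hD : MeasurableSet D) (hTD : ∀ u, T (ind D hD u) = hk.op (ind D hD u))
    (hM : 0 < nu.real D) (s : ℝ) (hs : 0 < s) (a : ℝ) (ha : a = 2 * π * Cstar h0 ^ 2) (ha0 : 0 < a) :
    nu.real D * (s * a) ^ (1 / (2 * h0 + 1)) / sin (π / (2 * h0 + 1)) - log (1 + s * a)
      - 1 / sin (π / (2 * h0 + 1)) ≤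
      -2 * log (∫ f, exp (-(s / 2) * ‖f‖ ^ 2) ∂μ) := by
  set M := nu.real D with hMdef
  set R := -2 * log (∫ f, exp (-(s / 2) * ‖f‖ ^ 2) ∂μ) with hR
  set p := 2 * h0 + 1 with hp
  have hp1 : 1 < p := by rw [hp]; linarith
  have hsin := sin_pi_div_pos p hp1
  obtain ⟨Li, LE⟩ := J_line p (s * a) hp1 (by positivity)
  obtain ⟨L1i, L1E⟩ := J_line p 1 hp1 one_pos
  set L : ℝ → ℝ := fun ξ => log (1 + s * a * |ξ| ^ (-p)) with hL
  have hLm : Measurable L := by rw [hL]; fun_prop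
  have hL0 : ∀ ξ, 0 ≤ L ξ := fun ξ => log_nonneg (by
    have : 0 ≤ s * a * |ξ| ^ (-p) := by positivity
    linarith)
  obtain ⟨ι, hcount, h, hh, hsum⟩ := exists_onb EE
  have hfin := upper_fin μ T hchar h0 hk D hD hTD hM.ne' s hs.le a ha h hh
  rw [← hR, ← hp] at hfin
  have hR0 : 0 ≤ R := by
    have := hfin ∅
    rw [Finset.sum_empty] at this
    have := pi_pos
    by_contra hneg
    push Not at hneg
    nlinarith
  set o := ind D hD oneE with ho
  set W : ℝ → ℝ := fun ξ => M - ‖KT eK o ξ‖ ^ 2 / M with hW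
  have hWsum : ∀ ξ, HasSum (fun i => ‖KT eK (PD D hD (h i)) ξ‖ ^ 2) (W ξ) := by
    intro ξ
    have h1 := (hsum (PD D hD (cosE ξ))).add (hsum (PD D hD (sinE ξ)))
    rw [cs_PD D hD hM.ne' ξ] at h1
    refine h1.congr_fun ?_
    intro i
    rw [KT_eK_sq, PD_symm, PD_symm]
  have hmi : ∀ i, Measurable (fun ξ => L ξ * ‖KT eK (PD D hD (h i)) ξ‖ ^ 2) := fun i =>
    hLm.mul (((KT_eK_sm _).measurable.norm).pow_const 2)
  have hint : ∀ i, Integrable (fun ξ => L ξ * ‖KT eK (PD D hD (h i)) ξ‖ ^ 2) := fun i =>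
    (jensen_op h0 hk (PD D hD (h i)) (PD_mean D hD hM.ne' _)
    ((PD_norm_le D hD hM.ne' _).trans (hh.1 i).le) s hs.le a ha).1
  have hlin : ∫⁻ ξ, ENNReal.ofReal (L ξ * W ξ) ≤ ENNReal.ofReal (2 * π * R) := by
    have e1 : ∀ ξ, ENNReal.ofReal (L ξ * W ξ) =
        ∑' i, ENNReal.ofReal (L ξ * ‖KT eK (PD D hD (h i)) ξ‖ ^ 2) := by
      intro ξ
      have h2 := (hWsum ξ).mul_left (L ξ)
      rw [← h2.tsum_eq]
      exact ENNReal.ofReal_tsum_of_nonneg (fun i => mul_nonneg (hL0 ξ) (sq_nonneg _)) h2.summable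
    simp_rw [e1]
    rw [lintegral_tsum (fun i => (hmi i).ennreal_ofReal.aemeasurable)]
    rw [ENNReal.tsum_eq_iSup_sum]
    apply iSup_le
    intro K
    have e2 : ∀ i, ∫⁻ ξ, ENNReal.ofReal (L ξ * ‖KT eK (PD D hD (h i)) ξ‖ ^ 2) =
        ENNReal.ofReal (∫ ξ, L ξ * ‖KT eK (PD D hD (h i)) ξ‖ ^ 2) := fun i =>
      (ofReal_integral_eq_lintegral_ofReal (hint i)
        (Eventually.of_forall fun ξ => mul_nonneg (hL0 ξ) (sq_nonneg _))).symm
    simp_rw [e2]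
    rw [← ENNReal.ofReal_sum_of_nonneg (fun i _ => integral_nonneg fun ξ => mul_nonneg (hL0 ξ) (sq_nonneg _))]
    exact ENNReal.ofReal_le_ofReal (hfin K)
  have hon : ‖o‖ ^ 2 = M := o_norm D hD
  have hob : ∀ ξ, ‖KT eK o ξ‖ ^ 2 ≤ M := fun ξ => by
    rw [← hon]
    have := eK_bd o ξ
    gcongr
  obtain ⟨oi, ob⟩ := plancherel o
  rw [hon] at ob
  have hLo : Integrable (fun ξ => L ξ * ‖KT eK o ξ‖ ^ 2) := by
    apply (Li.const_mul M).mono' (hLm.mul (((KT_eK_sm _).measurable.norm).pow_const 2)).aestronglyMeasurable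
    refine Eventually.of_forall fun ξ => ?_
    change ‖L ξ * ‖KT eK o ξ‖ ^ 2‖ ≤ M * L ξ
    rw [Real.norm_of_nonneg (mul_nonneg (hL0 ξ) (sq_nonneg _)), mul_comm]
    exact mul_le_mul_of_nonneg_right (hob ξ) (hL0 ξ)
  have hLW : ∀ ξ, L ξ * W ξ = M * L ξ - (1 / M) * (L ξ * ‖KT eK o ξ‖ ^ 2) := fun ξ => by
    rw [hW]; ring
  have hLWi : Integrable (fun ξ => L ξ * W ξ) := by
    simp_rw [hLW]; exact (Li.const_mul M).sub (hLo.const_mul _)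
  rw [← ofReal_integral_eq_lintegral_ofReal hLWi (Eventually.of_forall fun ξ =>
    mul_nonneg (hL0 ξ) ((hWsum ξ).nonneg fun i => sq_nonneg _)),
    ENNReal.ofReal_le_ofReal_iff (by positivity)] at hlin
  simp_rw [hLW] at hlin
  rw [integral_sub (Li.const_mul M) (hLo.const_mul _), integral_const_mul, integral_const_mul] at hlin
  have hcorr : ∫ ξ, L ξ * ‖KT eK o ξ‖ ^ 2 ≤
      log (1 + s * a) * (2 * π * M) + M * (2 * (π / sin (π / p))) := by
    have hL1 : ∀ ξ, L ξ ≤ log (1 + s * a) + log (1 + 1 * |ξ| ^ (-p)) := fun ξ => by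
      have hx : 0 ≤ |ξ| ^ (-p) := by positivity
      have hsa : 0 < s * a := by positivity
      rw [← log_mul (by positivity) (by positivity)]
      apply log_le_log (by positivity)
      nlinarith
    calc ∫ ξ, L ξ * ‖KT eK o ξ‖ ^ 2
        ≤ ∫ ξ, (log (1 + s * a) * ‖KT eK o ξ‖ ^ 2 + M * log (1 + 1 * |ξ| ^ (-p))) := by
          apply integral_mono hLo ((oi.const_mul _).add (L1i.const_mul _))
          intro ξ
          have h1 := mul_le_mul_of_nonneg_right (hL1 ξ) (sq_nonneg ‖KT eK o ξ‖)
          have h2 : 0 ≤ log (1 + 1 * |ξ| ^ (-p)) := log_nonneg (by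
            have : 0 ≤ |ξ| ^ (-p) := by positivity
            linarith)
          have h3 := mul_le_mul_of_nonneg_left (hob ξ) h2
          simp only [Pi.add_apply]
          linarith
      _ ≤ _ := by
          rw [integral_add (oi.const_mul _) (L1i.const_mul _), integral_const_mul, integral_const_mul, L1E,
            Real.one_rpow, one_mul]
          have : 0 ≤ log (1 + s * a) := log_nonneg (by
            have : 0 < s * a := by positivity
            linarith)
          have := mul_le_mul_of_nonneg_left ob this
          linarith
  rw [show ∫ ξ, L ξ = 2 * ((s * a) ^ (1 / p) * (π / sin (π / p))) from LE] at hlin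
  have h5 := mul_le_mul_of_nonneg_left hcorr (show 0 ≤ 1 / M by positivity)
  have h6 : 1 / M * (log (1 + s * a) * (2 * π * M) + M * (2 * (π / sin (π / p)))) =
      2 * π * (log (1 + s * a) + 1 / sin (π / p)) := by field_simp
  rw [h6] at h5
  have h7 : M * (2 * ((s * a) ^ (1 / p) * (π / sin (π / p)))) =
      2 * π * (M * (s * a) ^ (1 / p) / sin (π / p)) := by ring
  rw [h7] at hlin
  have h8 : 2 * π * (M * (s * a) ^ (1 / p) / sin (π / p) - log (1 + s * a) - 1 / sin (π / p)) ≤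
      2 * π * R := by linarith
  exact le_of_mul_le_mul_left h8 (by positivity)
end
end
section
def cK (H : ℝ → ℝ) (y : ℝ) (k : ℕ) (ξ : ℝ) : ℂ :=
  ((|ξ| ^ (-(H y + 1 / 2)) * ((-log |ξ|) ^ k / (k.factorial : ℝ)) : ℝ) : ℂ) *
    (Complex.exp (Complex.I * ((y * ξ : ℝ) : ℂ)) - 1)
lemma real_taylor (z : ℝ) (K : ℕ) :
    |exp z - ∑ m ∈ Finset.range K, z ^ m / (m.factorial : ℝ)| ≤ |z| ^ K * exp |z| := by
  have h := Complex.norm_exp_sub_sum_le_norm_mul_exp (z : ℂ) K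
  rw [Complex.norm_real, Real.norm_eq_abs] at h
  have e : Complex.exp (z : ℂ) - ∑ m ∈ Finset.range K, (z : ℂ) ^ m / (m.factorial : ℂ) =
      ((exp z - ∑ m ∈ Finset.range K, z ^ m / (m.factorial : ℝ) : ℝ) : ℂ) := by
    push_cast; rfl
  rw [e, Complex.norm_real, Real.norm_eq_abs] at h
  exact h
lemma rho_bound {η Δ L : ℝ} (hη : 0 < η) (hΔ : |Δ| ≤ η) (K : ℕ) :
    (|Δ * L| ^ K * exp |Δ * L|) ^ 2 ≤
      |Δ| ^ (2 * K) * ((K.factorial : ℝ) / η ^ K) ^ 2 * exp (4 * η * |L|) := by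
  have h1 : (η * |L|) ^ K / (K.factorial : ℝ) ≤ exp (η * |L|) :=
    Real.pow_div_factorial_le_exp _ (by positivity) K
  have hf : (0:ℝ) < K.factorial := by exact_mod_cast K.factorial_pos
  have h2 : |L| ^ K ≤ (K.factorial : ℝ) / η ^ K * exp (η * |L|) := by
    rw [mul_pow, div_le_iff₀ hf] at h1
    rw [div_mul_eq_mul_div, le_div_iff₀ (by positivity)]
    linarith
  have h3 : exp |Δ * L| ≤ exp (η * |L|) := by
    apply exp_le_exp.2
    rw [abs_mul]; gcongr
  calc (|Δ * L| ^ K * exp |Δ * L|) ^ 2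
      ≤ (|Δ| ^ K * ((K.factorial : ℝ) / η ^ K * exp (η * |L|)) * exp (η * |L|)) ^ 2 := by
        apply pow_le_pow_left₀ (by positivity)
        rw [abs_mul, mul_pow]
        rw [abs_mul] at h3
        gcongr
    _ = _ := by
        have : exp (4 * η * |L|) = exp (η * |L|) ^ 4 := by
          rw [← exp_nat_mul]; congr 1; push_cast; ring
        rw [this, pow_mul']; ring
lemma exp_abs_log_le {x c : ℝ} (hx : 0 < x) :
    exp (c * |log x|) ≤ x ^ c + x ^ (-c) := by
  rw [rpow_def_of_pos hx, rpow_def_of_pos hx]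
  rcases abs_choice (log x) with h | h <;> rw [h]
  · rw [mul_comm]; linarith [exp_pos (log x * -c)]
  · rw [show c * -log x = log x * -c by ring]; linarith [exp_pos (log x * c)]
def BB (α₁ α₂ ξ : ℝ) : ℝ := mm α₁ ξ + mm α₂ ξ
lemma term2_bound {b η α₁ α₂ : ℝ} (h1 : α₁ ≤ 2 * b + 1 - 4 * η) (h2 : 2 * b + 1 + 4 * η ≤ α₂)
    (hη : 0 < η) {ξ : ℝ} (hξ : ξ ≠ 0) :
    min 4 (ξ ^ 2) * |ξ| ^ (-(2 * b + 1)) * exp (4 * η * |(log (|ξ|))|) ≤ 2 * BB α₁ α₂ ξ := by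
  have hx := abs_pos.2 hξ
  have e := exp_abs_log_le (c := 4 * η) hx
  have a1 : |ξ| ^ (-(2 * b + 1)) * |ξ| ^ (4 * η) = |ξ| ^ (-(2 * b + 1 - 4 * η)) := by
    rw [← rpow_add hx]; congr 1; ring
  have a2 : |ξ| ^ (-(2 * b + 1)) * |ξ| ^ (-(4 * η)) = |ξ| ^ (-(2 * b + 1 + 4 * η)) := by
    rw [← rpow_add hx]; congr 1; ring
  calc _ ≤ min 4 (ξ ^ 2) * |ξ| ^ (-(2 * b + 1)) * (|ξ| ^ (4 * η) + |ξ| ^ (-(4 * η))) := by gcongr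
    _ = mm (2 * b + 1 - 4 * η) ξ + mm (2 * b + 1 + 4 * η) ξ := by
        unfold mm; rw [← a1, ← a2]; ring
    _ ≤ _ := by
        have := mm_le α₁ α₂ ξ h1 (by linarith : 2 * b + 1 - 4 * η ≤ α₂)
        have := mm_le α₁ α₂ ξ (by linarith : α₁ ≤ 2 * b + 1 + 4 * η) h2
        unfold BB; linarith
lemma term1_bound {b a0 α₁ α₂ x y : ℝ} {n : ℕ} (hn : 1 ≤ n) (h1 : α₁ ≤ 2 * b + 1) (h2 : 2 * b + 1 ≤ α₂)
    (ha : a0 ≤ b) (hxy : |x - y| ≤ 1 / n) (ξ : ℝ) :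
    ‖Complex.exp (Complex.I * ((x * ξ : ℝ) : ℂ)) - Complex.exp (Complex.I * ((y * ξ : ℝ) : ℂ))‖ ^ 2 *
      |ξ| ^ (-(2 * b + 1)) ≤ (n:ℝ) ^ (-(2 * a0 + 1)) * BB α₁ α₂ (ξ / n) := by
  have hn0 : (0:ℝ) < n := by exact_mod_cast hn
  have hn1 : (1:ℝ) ≤ n := by exact_mod_cast hn
  have e1 : ‖Complex.exp (Complex.I * ((x * ξ : ℝ) : ℂ)) - Complex.exp (Complex.I * ((y * ξ : ℝ) : ℂ))‖
      = ‖Complex.exp (Complex.I * (((x - y) * ξ : ℝ) : ℂ)) - 1‖ := by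
    have : Complex.exp (Complex.I * ((x * ξ : ℝ) : ℂ)) - Complex.exp (Complex.I * ((y * ξ : ℝ) : ℂ)) =
      Complex.exp (Complex.I * ((y * ξ : ℝ) : ℂ)) * (Complex.exp (Complex.I * (((x - y) * ξ : ℝ) : ℂ)) - 1) := by
      rw [mul_sub, ← Complex.exp_add, mul_one]; congr 2; push_cast; ring
    rw [this, norm_mul, mul_comm Complex.I, Complex.norm_exp_ofReal_mul_I, one_mul]
  rw [e1]
  have e2 := norm_exp_sub_one_sq ((x - y) * ξ)
  have e3 : ((x - y) * ξ) ^ 2 ≤ (ξ / n) ^ 2 := by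
    rw [sq_le_sq, abs_mul, abs_div, abs_of_pos hn0, div_eq_mul_one_div, mul_comm |ξ|]
    gcongr
  calc _ ≤ min 4 ((ξ / n) ^ 2) * |ξ| ^ (-(2 * b + 1)) := by
        gcongr
        exact e2.trans (min_le_min_left _ e3)
    _ = (n:ℝ) ^ (-(2 * b + 1)) * mm (2 * b + 1) (ξ / n) := by
        unfold mm
        have : |ξ| ^ (-(2 * b + 1)) = (n:ℝ) ^ (-(2 * b + 1)) * |ξ / n| ^ (-(2 * b + 1)) := by
          rw [← Real.mul_rpow hn0.le (abs_nonneg _)]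
          congr 1
          rw [abs_div, abs_of_pos hn0]; field_simp
        rw [this]; ring
    _ ≤ _ := by
        apply mul_le_mul _ (mm_le _ _ _ h1 h2) (mm_nonneg _ _) (by positivity)
        exact rpow_le_rpow_of_exponent_le hn1 (by linarith)
lemma BB_int {α₁ α₂ : ℝ} (h1 : 1 < α₁) (h2 : α₁ ≤ α₂) (h3 : α₂ < 3) : Integrable (BB α₁ α₂) :=
  (mm_int h1 (by linarith)).add (mm_int (by linarith) h3)
lemma BB_nonneg (α₁ α₂ ξ : ℝ) : 0 ≤ BB α₁ α₂ ξ := add_nonneg (mm_nonneg _ _) (mm_nonneg _ _)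
lemma w_split (H : ℝ → ℝ) (x y ξ : ℝ) (hξ : ξ ≠ 0) (K : ℕ) :
    aK H x ξ - ∑ k ∈ Finset.range K, ((Cstar (H x) * (H x - H y) ^ k : ℝ) : ℂ) * cK H y k ξ =
    ((Cstar (H x) * |ξ| ^ (-(H x + 1 / 2)) : ℝ) : ℂ) * (Complex.exp (Complex.I * ((x * ξ : ℝ) : ℂ))
      - Complex.exp (Complex.I * ((y * ξ : ℝ) : ℂ))) +
    ((Cstar (H x) * |ξ| ^ (-(H y + 1 / 2)) * (exp ((H x - H y) * (-log |ξ|)) -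
      ∑ k ∈ Finset.range K, ((H x - H y) * (-log |ξ|)) ^ k / (k.factorial : ℝ)) : ℝ) : ℂ) *
      (Complex.exp (Complex.I * ((y * ξ : ℝ) : ℂ)) - 1) := by
  have hx := abs_pos.2 hξ
  have e1 : |ξ| ^ (-(H x + 1 / 2)) = |ξ| ^ (-(H y + 1 / 2)) * exp ((H x - H y) * (-log |ξ|)) := by
    rw [show (H x - H y) * (-log |ξ|) = log |ξ| * (-(H x - H y)) by ring,
      ← rpow_def_of_pos hx, ← rpow_add hx]
    congr 1; ring
  have e2 : ∑ k ∈ Finset.range K, ((Cstar (H x) * (H x - H y) ^ k : ℝ) : ℂ) * cK H y k ξ =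
     ((Cstar (H x) * |ξ| ^ (-(H y + 1 / 2)) * 
      ∑ k ∈ Finset.range K, ((H x - H y) * (-log |ξ|)) ^ k / (k.factorial : ℝ) : ℝ) : ℂ) *
      (Complex.exp (Complex.I * ((y * ξ : ℝ) : ℂ)) - 1) := by
    rw [Finset.mul_sum, Complex.ofReal_sum, Finset.sum_mul]
    apply Finset.sum_congr rfl
    intro k _
    unfold cK
    rw [← mul_assoc, ← Complex.ofReal_mul]
    congr 2
    rw [mul_pow]; ring
  rw [e2]
  unfold aK
  rw [e1]
  set E := exp ((H x - H y) * (-log |ξ|))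
  set Sm := ∑ k ∈ Finset.range K, ((H x - H y) * (-log |ξ|)) ^ k / (k.factorial : ℝ)
  push_cast
  ring
lemma w_norm {H : ℝ → ℝ} {lo hi : ℝ} (h : Hreg H lo hi) {a0 η α₁ α₂ Cb : ℝ} (hη : 0 < η)
    (h1 : α₁ ≤ 2 * lo + 1 - 4 * η) (h2 : 2 * hi + 1 + 4 * η ≤ α₂)
    (hCb : ∀ b ∈ Icc (0:ℝ) 1, Cstar b ≤ Cb) {n : ℕ} (hn : 1 ≤ n) {x y : ℝ} (hy : y ∈ Icc (0:ℝ) 1)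
    (hxy : |x - y| ≤ 1 / n) (ha : a0 ≤ H x) (hΔ : |H x - H y| ≤ η) (K : ℕ) {Cd : ℝ}
    (hd : |H x - H y| ^ (2 * K) * ((K.factorial : ℝ) / η ^ K) ^ 2 ≤ Cd) (ξ : ℝ) (hξ : ξ ≠ 0) :
    ‖aK H x ξ - ∑ k ∈ Finset.range K, ((Cstar (H x) * (H x - H y) ^ k : ℝ) : ℂ) * cK H y k ξ‖ ^ 2 ≤
      2 * Cb ^ 2 * ((n:ℝ) ^ (-(2 * a0 + 1)) * BB α₁ α₂ (ξ / n)) + 4 * Cb ^ 2 * Cd * BB α₁ α₂ ξ := by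
  rw [w_split H x y ξ hξ K]
  have hc := hCb _ (h.mem01 x)
  have hc0 := Cstar_nonneg (H x)
  have hx1 := (h.mem x).1
  have hx2 := (h.mem x).2
  have hy1 := (h.mem y).1
  have hy2 := (h.mem y).2
  have t1 := term1_bound (b := H x) (a0 := a0) (α₁ := α₁) (α₂ := α₂) hn (by linarith) (by linarith) ha hxy ξ
  have t2 := term2_bound (b := H y) (η := η) (α₁ := α₁) (α₂ := α₂) (by linarith) (by linarith) hη hξ
  have rt := real_taylor ((H x - H y) * (-log |ξ|)) K
  have rb := rho_bound (L := -log |ξ|) hη hΔ K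
  set E := exp ((H x - H y) * (-log |ξ|)) -
      ∑ k ∈ Finset.range K, ((H x - H y) * (-log |ξ|)) ^ k / (k.factorial : ℝ) with hE
  set p := Complex.exp (Complex.I * ((x * ξ : ℝ) : ℂ)) - Complex.exp (Complex.I * ((y * ξ : ℝ) : ℂ))
  set q := Complex.exp (Complex.I * ((y * ξ : ℝ) : ℂ)) - 1 with hq
  have hE2 : E ^ 2 ≤ Cd * exp (4 * η * |(log (|ξ|))|) := by
    rw [← sq_abs]
    refine (pow_le_pow_left₀ (abs_nonneg _) rt 2).trans (rb.trans ?_)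
    rw [abs_neg]
    gcongr
  have hqn : ‖q‖ ^ 2 ≤ min 4 (ξ ^ 2) := by
    refine (norm_exp_sub_one_sq (y * ξ)).trans (min_le_min_left _ ?_)
    rw [mul_pow]
    have : y ^ 2 ≤ 1 := by rw [sq_le_one_iff_abs_le_one, abs_of_nonneg hy.1]; exact hy.2
    nlinarith [sq_nonneg ξ]
  have hCb2 : Cstar (H x) ^ 2 ≤ Cb ^ 2 := pow_le_pow_left₀ hc0 hc 2
  have hCd : 0 ≤ Cd := le_trans (by positivity) hd
  have key : ∀ A B : ℂ, ‖A + B‖ ^ 2 ≤ 2 * ‖A‖ ^ 2 + 2 * ‖B‖ ^ 2 := by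
    intro A B
    have := norm_add_le A B
    have h0 := norm_nonneg (A + B)
    nlinarith [sq_nonneg (‖A‖ - ‖B‖)]
  refine (key _ _).trans ?_
  rw [norm_mul, norm_mul, Complex.norm_real, Complex.norm_real, mul_pow, mul_pow, Real.norm_eq_abs,
    Real.norm_eq_abs, sq_abs, sq_abs, mul_pow, mul_pow, mul_pow, abs_rpow_half_sq, abs_rpow_half_sq]
  have A1 : 2 * (Cstar (H x) ^ 2 * |ξ| ^ (-(2 * H x + 1)) * ‖p‖ ^ 2) ≤
      2 * Cb ^ 2 * ((n:ℝ) ^ (-(2 * a0 + 1)) * BB α₁ α₂ (ξ / n)) := by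
    calc _ = 2 * Cstar (H x) ^ 2 * (‖p‖ ^ 2 * |ξ| ^ (-(2 * H x + 1))) := by ring
      _ ≤ _ := by
        apply mul_le_mul (by linarith) t1 (by positivity) (by positivity)
  have A2 : 2 * (Cstar (H x) ^ 2 * |ξ| ^ (-(2 * H y + 1)) * E ^ 2 * ‖q‖ ^ 2) ≤
      4 * Cb ^ 2 * Cd * BB α₁ α₂ ξ := by
    calc _ ≤ 2 * (Cb ^ 2 * |ξ| ^ (-(2 * H y + 1)) * (Cd * exp (4 * η * |(log (|ξ|))|)) *
          min 4 (ξ ^ 2)) := by gcongr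
      _ = 2 * Cb ^ 2 * Cd * (min 4 (ξ ^ 2) * |ξ| ^ (-(2 * H y + 1)) *
          exp (4 * η * |(log (|ξ|))|)) := by ring
      _ ≤ 2 * Cb ^ 2 * Cd * (2 * BB α₁ α₂ ξ) := by gcongr
      _ = _ := by ring
  linarith
lemma w_lint {H : ℝ → ℝ} {lo hi : ℝ} (h : Hreg H lo hi) {r C a0 : ℝ} (hr : 0 < r) (ha1 : a0 ≤ 1)
    (hH : ∀ x ∈ Icc (0:ℝ) 1, ∀ y ∈ Icc (0:ℝ) 1, |H x - H y| ≤ C * |x - y| ^ r) :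
    ∃ (n0 K : ℕ) (C1 : ℝ), 1 ≤ n0 ∧ 0 < C1 ∧ ∀ n : ℕ, n0 ≤ n → ∀ x ∈ Ioo (0:ℝ) 1, ∀ y ∈ Icc (0:ℝ) 1,
      |x - y| ≤ 1 / n → a0 ≤ H x →
      ∫⁻ ξ, ‖aK H x ξ - ∑ k ∈ Finset.range K, ((Cstar (H x) * (H x - H y) ^ k : ℝ) : ℂ) * cK H y k ξ‖ₑ ^ 2
        ≤ ENNReal.ofReal (C1 * (n:ℝ) ^ (-(2 * a0))) := by
  obtain ⟨Cb, hCb0, hCb⟩ := Cstar_bdd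
  have hlo := h.lo_pos
  have hhi := h.hi_lt
  have hlh := h.lohi
  set η := min lo (1 - hi) / 4 with hηd
  have hη : 0 < η := by apply div_pos (lt_min hlo (by linarith)); norm_num
  have hη1 : 4 * η ≤ lo := by rw [hηd]; linarith [min_le_left lo (1 - hi)]
  have hη2 : 4 * η ≤ 1 - hi := by rw [hηd]; linarith [min_le_right lo (1 - hi)]
  set α₁ := 2 * lo + 1 - 4 * η with hα₁
  set α₂ := 2 * hi + 1 + 4 * η with hα₂
  have hBi : Integrable (BB α₁ α₂) := BB_int (by linarith) (by linarith) (by linarith)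
  set Cm := ∫ ξ, BB α₁ α₂ ξ with hCm
  have hCm0 : 0 ≤ Cm := integral_nonneg (BB_nonneg _ _)
  obtain ⟨K, hK⟩ := exists_nat_ge (1 / r)
  have hrK : 1 ≤ r * K := by rw [div_le_iff₀ hr] at hK; linarith
  set C' := max C 0 with hC'
  set Q := C' ^ (2 * K) * ((K.factorial : ℝ) / η ^ K) ^ 2 with hQ
  have hQ0 : 0 ≤ Q := by positivity
  have hlim : Tendsto (fun n : ℕ => C' * (n:ℝ) ^ (-r)) atTop (nhds (C' * 0)) :=
    ((tendsto_rpow_neg_atTop hr).comp tendsto_natCast_atTop_atTop).const_mul C'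
  rw [mul_zero] at hlim
  obtain ⟨n1, hn1⟩ := eventually_atTop.1 (hlim.eventually_le_const hη)
  refine ⟨max 1 n1, K, 2 * Cb ^ 2 * Cm + 4 * Cb ^ 2 * Q * Cm + 1, le_max_left _ _, by positivity, ?_⟩
  intro n hn x hx y hy hxy ha
  have hn1' : 1 ≤ n := (le_max_left _ _).trans hn
  have hnR : (1:ℝ) ≤ n := by exact_mod_cast hn1'
  have hnpos : (0:ℝ) < n := by linarith
  have hΔ' : |H x - H y| ≤ C' * (n:ℝ) ^ (-r) := by
    refine (hH x (Ioo_subset_Icc_self hx) y hy).trans ?_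
    have : |x - y| ^ r ≤ (n:ℝ) ^ (-r) := by
      rw [rpow_neg hnpos.le, ← Real.inv_rpow hnpos.le, ← one_div]
      exact rpow_le_rpow (abs_nonneg _) hxy hr.le
    exact mul_le_mul (le_max_left _ _) this (by positivity) (le_max_right _ _)
  have hΔ : |H x - H y| ≤ η := hΔ'.trans (hn1 n ((le_max_right _ _).trans hn))
  have hd : |H x - H y| ^ (2 * K) * ((K.factorial : ℝ) / η ^ K) ^ 2 ≤ Q * (n:ℝ) ^ (-(2:ℝ)) := by
    have : |H x - H y| ^ (2 * K) ≤ C' ^ (2 * K) * (n:ℝ) ^ (-(2:ℝ)) := by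
      refine (pow_le_pow_left₀ (abs_nonneg _) hΔ' _).trans ?_
      rw [mul_pow]
      gcongr
      rw [← rpow_natCast, ← rpow_mul hnpos.le]
      apply rpow_le_rpow_of_exponent_le hnR
      push_cast; nlinarith
    calc _ ≤ C' ^ (2 * K) * (n:ℝ) ^ (-(2:ℝ)) * ((K.factorial : ℝ) / η ^ K) ^ 2 := by gcongr
      _ = _ := by rw [hQ]; ring
  have hBs : Integrable (fun ξ => BB α₁ α₂ (ξ / n)) := hBi.comp_div hnpos.ne'
  have hmaj : Integrable (fun ξ => 2 * Cb ^ 2 * ((n:ℝ) ^ (-(2 * a0 + 1)) * BB α₁ α₂ (ξ / n)) +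
      4 * Cb ^ 2 * (Q * (n:ℝ) ^ (-(2:ℝ))) * BB α₁ α₂ ξ) :=
    ((hBs.const_mul _).const_mul _).add (hBi.const_mul _)
  calc _ ≤ ∫⁻ ξ, ENNReal.ofReal (2 * Cb ^ 2 * ((n:ℝ) ^ (-(2 * a0 + 1)) * BB α₁ α₂ (ξ / n)) +
      4 * Cb ^ 2 * (Q * (n:ℝ) ^ (-(2:ℝ))) * BB α₁ α₂ ξ) := by
        apply lintegral_mono_ae
        filter_upwards [compl_mem_ae_iff.2 (measure_singleton (0:ℝ))] with ξ hξ
        rw [← ofReal_norm, ← ENNReal.ofReal_pow (norm_nonneg _)]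
        apply ENNReal.ofReal_le_ofReal
        exact w_norm h hη le_rfl le_rfl hCb hn1' hy hxy ha hΔ K hd ξ hξ
    _ = ENNReal.ofReal (∫ ξ, (2 * Cb ^ 2 * ((n:ℝ) ^ (-(2 * a0 + 1)) * BB α₁ α₂ (ξ / n)) +
      4 * Cb ^ 2 * (Q * (n:ℝ) ^ (-(2:ℝ))) * BB α₁ α₂ ξ)) := by
        rw [ofReal_integral_eq_lintegral_ofReal hmaj]
        refine Eventually.of_forall fun ξ => ?_
        have := BB_nonneg α₁ α₂ ξ
        have := BB_nonneg α₁ α₂ (ξ / n)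
        change 0 ≤ _
        positivity
    _ ≤ _ := by
        apply ENNReal.ofReal_le_ofReal
        rw [integral_add ((hBs.const_mul _).const_mul _) (hBi.const_mul _), integral_const_mul,
          integral_const_mul, integral_const_mul, Measure.integral_comp_div, abs_of_pos hnpos,
          smul_eq_mul, ← hCm]
        have e1 : (n:ℝ) ^ (-(2 * a0 + 1)) * (n * Cm) = (n:ℝ) ^ (-(2 * a0)) * Cm := by
          rw [← mul_assoc, ← rpow_add_one hnpos.ne']; congr 2; ring
        have e2 : (n:ℝ) ^ (-(2:ℝ)) ≤ (n:ℝ) ^ (-(2 * a0)) :=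
          rpow_le_rpow_of_exponent_le hnR (by linarith)
        rw [e1]
        have e3 : 4 * Cb ^ 2 * (Q * (n:ℝ) ^ (-(2:ℝ))) * Cm ≤ 4 * Cb ^ 2 * (Q * (n:ℝ) ^ (-(2 * a0))) * Cm := by
          gcongr
        have e4 : 0 < (n:ℝ) ^ (-(2 * a0)) := by positivity
        linarith
end
section
lemma cK_meas {H : ℝ → ℝ} (hc : Continuous H) (k : ℕ) :
    Measurable (fun z : ℝ × ℝ => cK H z.1 k z.2) := by
  have := hc.measurable
  unfold cK
  fun_prop
lemma KT_ind (a : ℝ → ℝ → ℂ) (S : Set ℝ) (hS : MeasurableSet S) (u : EE) (ξ : ℝ) :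
    KT a (ind S hS u) ξ = ∫ x, (u x : ℂ) * S.indicator (fun x => a x ξ) x ∂nu := by
  unfold KT
  apply integral_congr_ae
  filter_upwards [ind_coe S hS u] with x hx
  rw [hx]
  by_cases hxS : x ∈ S <;> simp [hxS]
lemma S_crude {a : ℝ → ℝ → ℂ} {g : ℝ → ℝ} (hk : Ker a g) (S : Set ℝ) (hS : MeasurableSet S)
    (N : ℕ) (q : Fin N → EE) (hq : Orthonormal ℝ q) :
    ∑ i, ‖hk.op (ind S hS (q i))‖ ^ 2 ≤ (∫ ξ, g ξ ^ 2) * nu.real S := by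
  simp_rw [hk.op_norm_sq]
  refine hs_lemma q hq (fun x ξ => S.indicator (fun x => a x ξ) x) ?_ S hS _
    (integral_nonneg fun ξ => sq_nonneg _) ?_ _ (fun i => hk.op_sq_int _) ?_
  · have : (Function.uncurry fun x ξ => S.indicator (fun x => a x ξ) x) =
      (Prod.fst ⁻¹' S).indicator (Function.uncurry a) := by
      ext ⟨x, ξ⟩
      by_cases hx : x ∈ S <;> simp [hx, Function.uncurry]
    rw [this]
    exact hk.meas.indicator (measurable_fst hS)
  · intro x hx
    by_cases hxS : x ∈ S
    · simp only [hxS, indicator_of_mem]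
      rw [ofReal_integral_eq_lintegral_ofReal hk.g2.integrable_sq (Eventually.of_forall fun _ => sq_nonneg _)]
      apply lintegral_mono
      intro ξ
      dsimp only
      rw [← ofReal_norm, ← ENNReal.ofReal_pow (norm_nonneg _)]
      exact ENNReal.ofReal_le_ofReal (pow_le_pow_left₀ (norm_nonneg _) (hk.bd x hx ξ) 2)
    · simp [hxS]
  · intro i
    exact Eventually.of_forall fun ξ => KT_ind a S hS (q i) ξ
def fV (H : ℝ → ℝ) (y : ℝ) (k : ℕ) (x : ℝ) : ℝ := Cstar (H x) * (H x - H y) ^ k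
lemma fV_memLp {H : ℝ → ℝ} {lo hi : ℝ} (h : Hreg H lo hi) (y : ℝ) (k : ℕ) : MemLp (fV H y k) 2 nu := by
  obtain ⟨Cb, hCb0, hCb⟩ := Cstar_bdd
  have hc := h.cC
  have hc' := h.cont
  refine MemLp.of_bound (C := Cb) ?_ (Eventually.of_forall fun x => ?_)
  · have : Continuous (fV H y k) := by unfold fV; fun_prop
    exact this.aestronglyMeasurable
  · unfold fV
    rw [norm_mul, norm_pow, Real.norm_eq_abs, Real.norm_eq_abs, abs_of_nonneg (Cstar_nonneg _)]
    have h1 : |H x - H y| ≤ 1 := by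
      rw [abs_le]; constructor <;> linarith [(h.mem01 x).1, (h.mem01 x).2, (h.mem01 y).1, (h.mem01 y).2]
    calc _ ≤ Cb * 1 := mul_le_mul (hCb _ (h.mem01 x)) (pow_le_one₀ (abs_nonneg _) h1) (by positivity) hCb0.le
      _ = Cb := mul_one _
lemma S_rank {H : ℝ → ℝ} {lo hi : ℝ} (h : Hreg H lo hi) {g : ℝ → ℝ} (hk : Ker (aK H) g)
    {a0 C1 : ℝ} {K : ℕ} (hC1 : 0 < C1) {n : ℕ} (hn : 1 ≤ n)
    (hw : ∀ x ∈ Ioo (0:ℝ) 1, ∀ y ∈ Icc (0:ℝ) 1, |x - y| ≤ 1 / n → a0 ≤ H x →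
      ∫⁻ ξ, ‖aK H x ξ - ∑ k ∈ Finset.range K, ((Cstar (H x) * (H x - H y) ^ k : ℝ) : ℂ) * cK H y k ξ‖ₑ ^ 2
        ≤ ENNReal.ofReal (C1 * (n:ℝ) ^ (-(2 * a0))))
    (S : Set ℝ) (hS : MeasurableSet S) (hSa : ∀ x ∈ S, x ∈ Ioo (0:ℝ) 1 → a0 ≤ H x) :
    ∃ v : Fin n × Fin K → EE, ∀ (N : ℕ) (q : Fin N → EE), Orthonormal ℝ q →
      (∀ i j, inner ℝ (v j) (q i) = 0) →
      ∑ i, ‖hk.op (ind S hS (q i))‖ ^ 2 ≤ (C1 * (n:ℝ) ^ (-(2 * a0))) * nu.real S := by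
  have hnpos : (0:ℝ) < n := by exact_mod_cast hn
  have hfl : Measurable (fun x : ℝ => ⌊(n:ℝ) * x⌋₊) := Nat.measurable_floor.comp (measurable_const_mul _)
  set P : ℕ → Set ℝ := fun j => S ∩ (fun x : ℝ => ⌊(n:ℝ) * x⌋₊) ⁻¹' {j} with hPdef
  have hP : ∀ j, MeasurableSet (P j) := fun j => hS.inter (hfl (measurableSet_singleton j))
  refine ⟨fun jk => ind (P jk.1) (hP jk.1) ((fV_memLp h ((jk.1:ℕ) / n) jk.2).toLp _), ?_⟩
  intro N q hq hort
  set yy : ℝ → ℝ := fun x => (⌊(n:ℝ) * x⌋₊ : ℝ) / n with hyy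
  have hyym : Measurable yy := by
    have : Measurable (fun m : ℕ => (m:ℝ) / n) := by fun_prop
    exact this.comp hfl
  set w : ℝ → ℝ → ℂ := fun x ξ => S.indicator (fun x => aK H x ξ -
    ∑ k ∈ Finset.range K, ((Cstar (H x) * (H x - H (yy x)) ^ k : ℝ) : ℂ) * cK H (yy x) k ξ) x with hwdef
  simp_rw [hk.op_norm_sq]
  refine hs_lemma q hq w ?_ S hS _ (by positivity) ?_ _ (fun i => hk.op_sq_int _) ?_
  · have : (Function.uncurry w) =
      (Prod.fst ⁻¹' S).indicator (fun z => aK H z.1 z.2 -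
    ∑ k ∈ Finset.range K, ((Cstar (H z.1) * (H z.1 - H (yy z.1)) ^ k : ℝ) : ℂ) * cK H (yy z.1) k z.2) := by
      ext ⟨x, ξ⟩
      by_cases hx : x ∈ S <;> simp [hwdef, hx, Function.uncurry]
    rw [this]
    refine Measurable.indicator ?_ (measurable_fst hS)
    have hm1 : Measurable (fun z : ℝ × ℝ => aK H z.1 z.2) := hk.meas
    have hm2 : ∀ k, Measurable (fun z : ℝ × ℝ => cK H (yy z.1) k z.2) := fun k =>
      (cK_meas h.cont k).comp ((hyym.comp measurable_fst).prodMk measurable_snd)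
    have hm3 := h.cC.measurable
    have hm4 := h.cont.measurable
    refine hm1.sub (Finset.measurable_sum _ fun k _ => Measurable.mul ?_ (hm2 k))
    apply Complex.measurable_ofReal.comp
    exact (hm3.comp measurable_fst).mul (((hm4.comp measurable_fst).sub
      (hm4.comp (hyym.comp measurable_fst))).pow_const k)
  · intro x hx
    by_cases hxS : x ∈ S
    · simp only [hwdef, hxS, indicator_of_mem]
      have hfle : (⌊(n:ℝ) * x⌋₊ : ℝ) ≤ n * x := Nat.floor_le (by have := hx.1; positivity)
      have hflt : (n:ℝ) * x < ⌊(n:ℝ) * x⌋₊ + 1 := Nat.lt_floor_add_one _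
      have y1 : yy x ≤ x := by rw [hyy]; dsimp only; rw [div_le_iff₀ hnpos]; linarith
      have y2 : x < yy x + 1 / n := by
        rw [hyy]; dsimp only; rw [← add_div, lt_div_iff₀ hnpos]; linarith
      apply hw x hx (yy x) ⟨by rw [hyy]; positivity, by linarith [hx.2]⟩ _ (hSa x hxS hx)
      rw [abs_of_nonneg (by linarith)]; linarith
    · simp [hwdef, hxS]
  · intro i
    refine Eventually.of_forall fun ξ => ?_
    rw [KT_ind]
    set V : Fin n → Fin K → ℝ → ℝ := fun j k => (P j).indicator (fV H ((j:ℕ) / n) k) with hV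
    have hVi : ∀ j k, Integrable (fun x => (q i x : ℂ) * ((V j k x : ℝ) : ℂ)) nu ∧
        ∫ x, (q i x : ℂ) * ((V j k x : ℝ) : ℂ) ∂nu = 0 := by
      intro j k
      have e0 := hort i (j, k)
      set vv : EE := ind (P j) (hP j) ((fV_memLp h ((j:ℕ) / n) k).toLp _) with hvv
      have hco : vv =ᵐ[nu] V j k := by
        filter_upwards [ind_coe (P j) (hP j) ((fV_memLp h ((j:ℕ) / n) k).toLp _),
          (fV_memLp h ((j:ℕ) / n) k).coeFn_toLp] with x h1 h2
        rw [hvv, h1]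
        by_cases hx : x ∈ P j <;> simp [hV, hx, h2]
      have hee : (fun x => (q i x : ℂ) * ((V j k x : ℝ) : ℂ)) =ᵐ[nu] fun x => ((vv x * q i x : ℝ) : ℂ) := by
        filter_upwards [hco] with x hx
        rw [hx]; push_cast; ring
      constructor
      · exact ((ee_mul_int vv (q i)).ofReal).congr hee.symm
      · rw [integral_congr_ae hee]
        refine (integral_ofReal (𝕜 := ℂ) (f := fun x => vv x * q i x)).trans ?_
        rw [← ee_inner vv (q i)]
        exact Complex.ofReal_eq_zero.2 e0
    have hR : Integrable (fun x => ∑ j : Fin n, ∑ k : Fin K, cK H ((j:ℕ) / n) k ξ * ((q i x : ℂ) * ((V j k x : ℝ) : ℂ))) nu :=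
      integrable_finsetSum _ fun j _ => integrable_finsetSum _ fun k _ => (hVi j k).1.const_mul _
    have hR0 : ∫ x, ∑ j : Fin n, ∑ k : Fin K, cK H ((j:ℕ) / n) k ξ * ((q i x : ℂ) * ((V j k x : ℝ) : ℂ)) ∂nu = 0 := by
      rw [integral_finsetSum _ fun j _ => integrable_finsetSum _ fun k _ => (hVi j k).1.const_mul _]
      apply Finset.sum_eq_zero
      intro j _
      rw [integral_finsetSum _ fun k _ => (hVi j k).1.const_mul _]
      apply Finset.sum_eq_zero
      intro k _
      rw [integral_const_mul, (hVi j k).2, mul_zero]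
    have hA : Integrable (fun x => (q i x : ℂ) * S.indicator (fun x => aK H x ξ) x) nu := by
      refine (hk.int (ind S hS (q i)) ξ).congr ?_
      filter_upwards [ind_coe S hS (q i)] with x hx
      rw [hx]
      by_cases hxS : x ∈ S <;> simp [hxS]
    have : ∫ x, (q i x : ℂ) * w x ξ ∂nu = ∫ x, ((q i x : ℂ) * S.indicator (fun x => aK H x ξ) x -
        ∑ j : Fin n, ∑ k : Fin K, cK H ((j:ℕ) / n) k ξ * ((q i x : ℂ) * ((V j k x : ℝ) : ℂ))) ∂nu := by
      apply integral_congr_ae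
      filter_upwards [ae_restrict_mem measurableSet_Ioo] with x hx
      by_cases hxS : x ∈ S
      · have hj : ⌊(n:ℝ) * x⌋₊ < n := by
          rw [Nat.floor_lt (by have := hx.1; positivity)]
          nlinarith [hx.2]
        rw [Finset.sum_eq_single (⟨_, hj⟩ : Fin n)]
        · simp only [hwdef, hxS, indicator_of_mem]
          rw [mul_sub, Finset.mul_sum, Finset.sum_range]
          congr 1
          apply Finset.sum_congr rfl
          intro k _
          have hm : x ∈ P ⌊(n:ℝ) * x⌋₊ := ⟨hxS, rfl⟩
          simp only [hV, hm, indicator_of_mem, fV, hyy]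
          ring
        · intro j _ hne
          apply Finset.sum_eq_zero
          intro k _
          have hm : x ∉ P j := by
            rintro ⟨_, h2⟩
            apply hne
            ext
            exact h2.symm
          simp [hV, hm]
        · intro h0; exact absurd (Finset.mem_univ _) h0
      · have hm : ∀ j, x ∉ P j := fun j h0 => hxS h0.1
        simp [hwdef, hxS, hV, hm]
    rw [this, integral_sub hA hR, hR0, sub_zero]
lemma S_decay {H : ℝ → ℝ} {lo hi : ℝ} (h : Hreg H lo hi) {g : ℝ → ℝ} (hk : Ker (aK H) g)
    {r C a0 : ℝ} (hr : 0 < r) (ha0 : 0 ≤ a0) (ha1 : a0 ≤ 1)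
    (hH : ∀ x ∈ Icc (0:ℝ) 1, ∀ y ∈ Icc (0:ℝ) 1, |H x - H y| ≤ C * |x - y| ^ r) :
    ∃ Cst : ℝ, 0 < Cst ∧ ∀ (S : Set ℝ) (hS : MeasurableSet S), (∀ x ∈ S, x ∈ Ioo (0:ℝ) 1 → a0 ≤ H x) →
      ∀ (N : ℕ) (e : Fin N → EE), Orthonormal ℝ e →
      (∀ i j, i ≠ j → inner ℝ (hk.op (ind S hS (e i))) (hk.op (ind S hS (e j))) = 0) →
      Antitone (fun i => ‖hk.op (ind S hS (e i))‖ ^ 2) →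
      ∀ k, ‖hk.op (ind S hS (e k))‖ ^ 2 ≤ Cst * nu.real S * (((k:ℕ):ℝ) + 1) ^ (-(2 * a0 + 1)) := by
  obtain ⟨n0, K, C1, hn0, hC1, hw⟩ := w_lint h hr ha1 hH
  set C2 := ∫ ξ, g ξ ^ 2 with hC2
  have hC20 : 0 ≤ C2 := integral_nonneg fun ξ => sq_nonneg _
  set M0 : ℕ := 2 * (K + 1) * n0 with hM0
  refine ⟨2 * C1 * (4 * ((K:ℝ) + 1)) ^ 2 + C2 * (M0:ℝ) ^ 3, by positivity, ?_⟩
  intro S hS hSa N e he horth hanti k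
  set m : ℕ := (k:ℕ) + 1 with hm
  have hmR : ((k:ℕ):ℝ) + 1 = (m:ℝ) := by rw [hm]; push_cast; rfl
  rw [hmR]
  have hm1 : (1:ℝ) ≤ m := by exact_mod_cast (by omega : 1 ≤ m)
  have hmp : (0:ℝ) < m := by linarith
  have hnS : 0 ≤ nu.real S := measureReal_nonneg
  set X := ‖hk.op (ind S hS (e k))‖ ^ 2 with hX
  have hX0 : 0 ≤ X := sq_nonneg _
  have hpos : 0 < (m:ℝ) ^ (-(2 * a0 + 1)) := by positivity
  by_cases hcase : M0 ≤ m
  · set n : ℕ := m / (2 * (K + 1)) with hn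
    have hnn0 : n0 ≤ n := by
      rw [hn, Nat.le_div_iff_mul_le (by omega)]
      rw [hM0] at hcase
      linarith
    have hn1 : 1 ≤ n := hn0.trans hnn0
    obtain ⟨v, hv⟩ := S_rank h hk hC1 hn1 (hw n hnn0) S hS hSa
    have hrank := rank_lemma (hk.op.comp (ind S hS)) e he horth hanti v _ hv k
    simp only [ContinuousLinearMap.comp_apply] at hrank
    rw [hmR, ← hX] at hrank
    have hcard : (Fintype.card (Fin n × Fin K) : ℝ) ≤ m / 2 := by
      have : 2 * (n * K) ≤ m := by
        have := Nat.div_mul_le_self m (2 * (K + 1))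
        rw [← hn] at this
        nlinarith
      have h2 : (2:ℝ) * ((n * K : ℕ) : ℝ) ≤ m := by exact_mod_cast this
      simp only [Fintype.card_prod, Fintype.card_fin]
      linarith
    have hnlow : (m:ℝ) / (4 * (K + 1)) ≤ n := by
      rw [div_le_iff₀ (by positivity)]
      have : m < 2 * (K + 1) * (n + 1) := by
        have := Nat.lt_mul_div_succ m (by omega : 0 < 2 * (K + 1))
        rw [← hn] at this
        exact this
      have h3 : m ≤ n * (4 * (K + 1)) := by nlinarith
      exact_mod_cast h3
    have hnrp : (n:ℝ) ^ (-(2 * a0)) ≤ (m:ℝ) ^ (-(2 * a0)) * (4 * ((K:ℝ) + 1)) ^ 2 := by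
      calc (n:ℝ) ^ (-(2 * a0)) ≤ ((m:ℝ) / (4 * (K + 1))) ^ (-(2 * a0)) :=
            rpow_le_rpow_of_nonpos (by positivity) hnlow (by linarith)
        _ = (m:ℝ) ^ (-(2 * a0)) * (4 * ((K:ℝ) + 1)) ^ (2 * a0) := by
            rw [Real.div_rpow hmp.le (by positivity), rpow_neg (x := 4 * ((K:ℝ) + 1)) (by positivity),
              div_inv_eq_mul]
        _ ≤ _ := by
            gcongr
            rw [← rpow_two]
            apply rpow_le_rpow_of_exponent_le _ (by linarith)
            have : (0:ℝ) ≤ K := by positivity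
            linarith
    have h5 : (m:ℝ) / 2 * X ≤ C1 * ((m:ℝ) ^ (-(2 * a0)) * (4 * ((K:ℝ) + 1)) ^ 2) * nu.real S := by
      calc (m:ℝ) / 2 * X ≤ ((m:ℝ) - Fintype.card (Fin n × Fin K)) * X := by
            gcongr; linarith
        _ ≤ C1 * (n:ℝ) ^ (-(2 * a0)) * nu.real S := hrank
        _ ≤ _ := by gcongr
    have h6 : (m:ℝ) ^ (-(2 * a0)) = m * (m:ℝ) ^ (-(2 * a0 + 1)) := by
      rw [mul_comm (m:ℝ), ← rpow_add_one hmp.ne']; congr 1; ring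
    rw [h6] at h5
    have h7 : X ≤ 2 * C1 * (4 * ((K:ℝ) + 1)) ^ 2 * nu.real S * (m:ℝ) ^ (-(2 * a0 + 1)) := by
      have : (m:ℝ) * X ≤ m * (2 * C1 * (4 * ((K:ℝ) + 1)) ^ 2 * nu.real S * (m:ℝ) ^ (-(2 * a0 + 1))) := by
        linarith
      exact le_of_mul_le_mul_left this hmp
    have h8 : 0 ≤ C2 * (M0:ℝ) ^ 3 * nu.real S * (m:ℝ) ^ (-(2 * a0 + 1)) := by positivity
    linarith
  · push Not at hcase
    have hrank := rank_lemma (J := Fin 0) (hk.op.comp (ind S hS)) e he horth hanti (fun _ => 0) _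
      (fun N q hq _ => S_crude hk S hS N q hq) k
    simp only [ContinuousLinearMap.comp_apply, Fintype.card_fin, Nat.cast_zero, sub_zero] at hrank
    rw [hmR, ← hX] at hrank
    have hmM : (m:ℝ) ≤ M0 := by exact_mod_cast hcase.le
    have h1 : X ≤ C2 * nu.real S := by
      refine le_trans ?_ hrank
      nlinarith
    have h2 : 1 ≤ (M0:ℝ) ^ 3 * (m:ℝ) ^ (-(2 * a0 + 1)) := by
      rw [rpow_neg hmp.le, ← div_eq_mul_inv, le_div_iff₀ (by positivity), one_mul]
      calc (m:ℝ) ^ (2 * a0 + 1) ≤ (m:ℝ) ^ (3:ℝ) := rpow_le_rpow_of_exponent_le hm1 (by linarith)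
        _ = (m:ℝ) ^ 3 := by norm_cast
        _ ≤ _ := by gcongr
    have h3 : C2 * nu.real S ≤ C2 * nu.real S * ((M0:ℝ) ^ 3 * (m:ℝ) ^ (-(2 * a0 + 1))) :=
      le_mul_of_one_le_right (by positivity) h2
    have h8 : 0 ≤ 2 * C1 * (4 * ((K:ℝ) + 1)) ^ 2 * nu.real S * (m:ℝ) ^ (-(2 * a0 + 1)) := by positivity
    linarith
end
section
lemma sym_int {E : Type*} [NormedAddCommGroup E] [NormedSpace ℝ E] {φ : ℝ → E} {l : ℝ}
    (h1 : IntervalIntegrable φ volume 0 l) (h2 : IntervalIntegrable (fun y => φ (-y)) volume 0 l) :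
    IntervalIntegrable φ volume (-l) l ∧ ∫ y in (-l)..l, φ y = ∫ y in (0:ℝ)..l, (φ y + φ (-y)) := by
  have h3 : IntervalIntegrable φ volume (-l) 0 := by
    have := (IntervalIntegrable.iff_comp_neg (f := fun y => φ (-y)) (a := 0) (b := l)).1 h2
    simp only [neg_neg, neg_zero] at this
    exact this.symm
  refine ⟨h3.trans h1, ?_⟩
  rw [← intervalIntegral.integral_add_adjacent_intervals h3 h1, intervalIntegral.integral_add h1 h2,
    intervalIntegral.integral_comp_neg, neg_zero, add_comm]
lemma cos_series {G : ℝ → ℝ} (hG : StronglyMeasurable G) {l : ℝ} (hl : 0 < l)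
    (h2 : IntervalIntegrable (fun y => G y ^ 2) volume 0 l) (h1 : IntervalIntegrable G volume 0 l) :
    HasSum (fun k : ℕ => 2 / l * (∫ y in (0:ℝ)..l, cos (π * k * y / l) * G y) ^ 2)
      ((∫ y in (0:ℝ)..l, G y ^ 2) + l⁻¹ * (∫ y in (0:ℝ)..l, G y) ^ 2) := by
  set f : ℝ → ℂ := fun y => ((G |y| : ℝ) : ℂ) with hf
  have habs : ∀ y ∈ uIoc 0 l, |y| = y := by
    intro y hy
    rw [uIoc_of_le hl.le] at hy
    exact abs_of_pos hy.1
  have hfm : StronglyMeasurable f :=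
    Complex.continuous_ofReal.comp_stronglyMeasurable (hG.comp_measurable continuous_abs.measurable)
  have hs1 : IntervalIntegrable (fun y => ‖f y‖ ^ 2) volume 0 l := by
    refine (intervalIntegrable_congr ?_).1 h2
    intro y hy
    simp only [hf]
    rw [Complex.norm_real, Real.norm_eq_abs, sq_abs, habs y hy]
  have hs2 : IntervalIntegrable (fun y => ‖f (-y)‖ ^ 2) volume 0 l := by
    simpa only [hf, abs_neg] using hs1
  obtain ⟨hs3, hs4⟩ := sym_int hs1 hs2
  have hab : -l < l := by linarith
  have hL2 : MemLp f 2 (volume.restrict (Ioc (-l) l)) := by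
    rw [memLp_two_iff_integrable_sq_norm hfm.aestronglyMeasurable]
    exact (intervalIntegrable_iff_integrableOn_Ioc_of_le hab.le).1 hs3
  have key := (hasSum_sq_fourierCoeffOn hab hL2).nat_add_neg
  have hcoef : ∀ n : ℤ, ‖fourierCoeffOn hab f n‖ ^ 2 =
      l⁻¹ ^ 2 * (∫ y in (0:ℝ)..l, cos (π * n * y / l) * G y) ^ 2 := by
    intro n
    rw [fourierCoeffOn_eq_integral]
    have hfi : IntervalIntegrable f volume 0 l := by
      refine (intervalIntegrable_congr (f := fun y => ((G y : ℝ) : ℂ)) ?_).1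
        ⟨h1.1.ofReal, h1.2.ofReal⟩
      intro y hy
      simp only [hf]
      rw [habs y hy]
    have e1 : IntervalIntegrable (fun y : ℝ => (fourier (-n)) (y : AddCircle (l - -l)) • f y) volume 0 l := by
      simp_rw [fourier_coe_apply, smul_eq_mul]
      exact hfi.continuousOn_mul (by fun_prop)
    have e2 : IntervalIntegrable (fun y : ℝ => (fourier (-n)) ((-y : ℝ) : AddCircle (l - -l)) • f (-y)) volume 0 l := by
      simp_rw [fourier_coe_apply, smul_eq_mul]
      have : ∀ y, f (-y) = f y := fun y => by simp [hf]
      simp_rw [this]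
      exact hfi.continuousOn_mul (by fun_prop)
    rw [(sym_int e1 e2).2]
    have e3 : ∫ y in (0:ℝ)..l, ((fourier (-n)) (y : AddCircle (l - -l)) • f y +
        (fourier (-n)) ((-y : ℝ) : AddCircle (l - -l)) • f (-y)) =
        ((2 * ∫ y in (0:ℝ)..l, cos (π * n * y / l) * G y : ℝ) : ℂ) := by
      rw [← intervalIntegral.integral_const_mul, ← intervalIntegral.integral_ofReal]
      apply intervalIntegral.integral_congr_ae
      refine Eventually.of_forall fun y hy => ?_
      simp only [fourier_coe_apply, smul_eq_mul, hf, abs_neg, habs y hy]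
      have hl' : (l:ℂ) ≠ 0 := by exact_mod_cast hl.ne'
      rw [← add_mul]
      push_cast
      rw [← mul_assoc]
      congr 1
      rw [Complex.two_cos, add_comm]
      congr 1 <;> · congr 1; field_simp; ring
    rw [e3, ← Complex.coe_smul, smul_eq_mul, ← Complex.ofReal_mul, Complex.norm_real, Real.norm_eq_abs, sq_abs,
      show (1 / (l - -l)) = l⁻¹ * (1 / 2) by field_simp; ring]
    ring
  simp_rw [hcoef] at key
  have key2 := key.mul_left l
  have hm : l * ((l - -l)⁻¹ • ∫ y in (-l)..l, ‖f y‖ ^ 2) = ∫ y in (0:ℝ)..l, G y ^ 2 := by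
    rw [hs4]
    have : ∫ y in (0:ℝ)..l, (‖f y‖ ^ 2 + ‖f (-y)‖ ^ 2) = 2 * ∫ y in (0:ℝ)..l, G y ^ 2 := by
      rw [← intervalIntegral.integral_const_mul]
      apply intervalIntegral.integral_congr_ae
      refine Eventually.of_forall fun y hy => ?_
      simp only [hf, abs_neg, habs y hy, Complex.norm_real, Real.norm_eq_abs, sq_abs]
      ring
    rw [this, smul_eq_mul]
    field_simp
    ring
  have hv : (∫ y in (0:ℝ)..l, G y ^ 2) + l⁻¹ * (∫ y in (0:ℝ)..l, G y) ^ 2 =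
      l * (((l - -l)⁻¹ • ∫ (x : ℝ) in -l..l, ‖f x‖ ^ 2) +
        l⁻¹ ^ 2 * (∫ (y : ℝ) in (0:ℝ)..l, cos (π * ((0:ℤ):ℝ) * y / l) * G y) ^ 2) := by
    rw [mul_add, hm]
    congr 1
    simp only [Int.cast_zero, mul_zero, zero_mul, zero_div, cos_zero, one_mul]
    field_simp
  rw [hv]
  refine key2.congr_fun ?_
  intro k
  push_cast
  have : ∀ y, cos (π * -(k:ℝ) * y / l) = cos (π * k * y / l) := by
    intro y; rw [← cos_neg]; congr 1; ring
  simp_rw [this]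
  field_simp
  ring
def cell (N j : ℕ) : Set ℝ := Ioc ((j:ℝ) / N) (((j:ℝ) + 1) / N)
lemma cell_meas (N j : ℕ) : MeasurableSet (cell N j) := measurableSet_Ioc
lemma cell_sub {N j : ℕ} (hj : j < N) : cell N j ⊆ Ioc (0:ℝ) 1 := by
  have hN : (0:ℝ) < N := by exact_mod_cast (by omega : 0 < N)
  intro x hx
  refine ⟨lt_of_le_of_lt (by positivity) hx.1, hx.2.trans ?_⟩
  rw [div_le_one hN]
  exact_mod_cast hj
lemma nu_cell {N j : ℕ} (hj : j < N) : nu.restrict (cell N j) = volume.restrict (cell N j) := by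
  have : nu = volume.restrict (Ioc (0:ℝ) 1) := Measure.restrict_congr_set Ioo_ae_eq_Ioc
  rw [this, Measure.restrict_restrict (cell_meas N j), inter_eq_left.2 (cell_sub hj)]
def ccF (N j k : ℕ) (x : ℝ) : ℝ := √(2 * N) * cos (π * k * (N * x - j))
lemma ccF_cont (N j k : ℕ) : Continuous (ccF N j k) := by unfold ccF; fun_prop
lemma ccF_abs (N j k : ℕ) (x : ℝ) : |ccF N j k x| ≤ √(2 * N) := by
  unfold ccF
  rw [abs_mul, abs_of_nonneg (sqrt_nonneg _)]
  exact mul_le_of_le_one_right (sqrt_nonneg _) (Real.abs_cos_le_one _)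
lemma ccF_memLp (N j k : ℕ) : MemLp (ccF N j k) 2 nu :=
  MemLp.of_bound (ccF_cont N j k).aestronglyMeasurable (√(2 * N)) (Eventually.of_forall (ccF_abs N j k))
def cc (N j k : ℕ) : EE := ind (cell N j) (cell_meas N j) ((ccF_memLp N j k).toLp _)
lemma cc_coe (N j k : ℕ) : cc N j k =ᵐ[nu] (cell N j).indicator (ccF N j k) := by
  filter_upwards [ind_coe (cell N j) (cell_meas N j) ((ccF_memLp N j k).toLp _),
    (ccF_memLp N j k).coeFn_toLp] with x h1 h2
  rw [cc, h1]
  by_cases hx : x ∈ cell N j <;> simp [hx, h2]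
lemma cell_int {E : Type*} [NormedAddCommGroup E] [NormedSpace ℝ E] {N j : ℕ} (hj : j < N) (F : ℝ → E) :
    ∫ x in cell N j, F x ∂nu = ∫ y in (0:ℝ)..(1 / N), F ((j:ℝ) / N + y) := by
  have hN : (0:ℝ) < N := by exact_mod_cast (by omega : 0 < N)
  rw [nu_cell hj, intervalIntegral.integral_comp_add_left, add_zero, ← add_div,
    intervalIntegral.integral_of_le (by gcongr; linarith)]
  rfl
lemma cc_inner {N j : ℕ} (hj : j < N) (k : ℕ) (g : EE) :
    inner ℝ (cc N j k) g = √(2 * N) * ∫ y in (0:ℝ)..(1 / N), cos (π * k * y / (1 / N)) * g ((j:ℝ) / N + y) := by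
  have hN : (0:ℝ) < N := by exact_mod_cast (by omega : 0 < N)
  rw [ee_inner]
  have : ∫ x, cc N j k x * g x ∂nu = ∫ x in cell N j, ccF N j k x * g x ∂nu := by
    rw [← integral_indicator (cell_meas N j)]
    apply integral_congr_ae
    filter_upwards [cc_coe N j k] with x hx
    rw [hx]
    by_cases hx : x ∈ cell N j <;> simp [hx]
  rw [this, cell_int hj, ← intervalIntegral.integral_const_mul]
  congr 1
  ext y
  unfold ccF
  rw [mul_assoc]
  congr 3
  field_simp
  ring
lemma cell_ii {N j : ℕ} (hj : j < N) {F : ℝ → ℝ} (hF : Integrable F nu) :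
    IntervalIntegrable (fun y => F ((j:ℝ) / N + y)) volume 0 (1 / N) := by
  have hN : (0:ℝ) < N := by exact_mod_cast (by omega : 0 < N)
  have h1 : IntervalIntegrable F volume ((j:ℝ) / N) (((j:ℝ) + 1) / N) := by
    rw [intervalIntegrable_iff_integrableOn_Ioc_of_le (by gcongr; linarith)]
    have := hF.restrict (s := cell N j)
    rwa [nu_cell hj] at this
  have := h1.comp_add_left ((j:ℝ) / N)
  rw [sub_self, ← sub_div, add_sub_cancel_left] at this
  exact this
lemma cos_complete {N j : ℕ} (hj : j < N) (g : EE) :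
    Summable (fun k => inner ℝ (cc N j k) g ^ 2) ∧
    ∫ x in cell N j, g x ^ 2 ∂nu ≤ ∑' k, inner ℝ (cc N j k) g ^ 2 ∧
    ∀ k, 1 ≤ k → inner ℝ (cc N j k) g ^ 2 ≤ ‖g‖ ^ 2 := by
  have hN : (0:ℝ) < N := by exact_mod_cast (by omega : 0 < N)
  have hsm : StronglyMeasurable (fun y => g ((j:ℝ) / N + y)) :=
    (Lp.stronglyMeasurable g).comp_measurable (measurable_const_add _)
  have key := cos_series hsm (l := 1 / N) (by positivity) (cell_ii hj (ee_sq_int g)) (cell_ii hj (ee_int g))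
  have e : ∀ k, inner ℝ (cc N j k) g ^ 2 = 2 / (1 / N) * (∫ y in (0:ℝ)..(1 / N), cos (π * k * y / (1 / N)) * g ((j:ℝ) / N + y)) ^ 2 := by
    intro k
    rw [cc_inner hj, mul_pow, Real.sq_sqrt (by positivity)]
    field_simp
  simp_rw [← e] at key
  rw [← cell_int hj (fun x => g x ^ 2)] at key
  have hle : ∫ x in cell N j, g x ^ 2 ∂nu ≤ ‖g‖ ^ 2 := by
    rw [ee_norm_sq]
    exact setIntegral_le_integral (ee_sq_int g) (Eventually.of_forall fun _ => sq_nonneg _)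
  refine ⟨key.summable, ?_, ?_⟩
  · rw [key.tsum_eq]
    have : 0 ≤ (1 / (N:ℝ))⁻¹ * (∫ y in (0:ℝ)..(1 / N), g ((j:ℝ) / N + y)) ^ 2 := by positivity
    linarith
  · intro k hk
    have h2 := sum_le_hasSum {0, k} (fun i _ => sq_nonneg _) key
    rw [Finset.sum_pair (by omega), e 0] at h2
    simp only [Nat.cast_zero, mul_zero, zero_mul, zero_div, cos_zero, one_mul] at h2
    have h3 : 2 / (1 / (N:ℝ)) * (∫ y in (0:ℝ)..(1 / N), g ((j:ℝ) / N + y)) ^ 2 =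
      2 * ((1 / (N:ℝ))⁻¹ * (∫ y in (0:ℝ)..(1 / N), g ((j:ℝ) / N + y)) ^ 2) := by field_simp
    have : 0 ≤ (1 / (N:ℝ))⁻¹ * (∫ y in (0:ℝ)..(1 / N), g ((j:ℝ) / N + y)) ^ 2 := by positivity
    linarith
lemma cc_norm {N j : ℕ} (hj : j < N) {k : ℕ} (hk : 1 ≤ k) : ‖cc N j k‖ ^ 2 ≤ 1 := by
  have h := (cos_complete hj (cc N j k)).2.2 k hk
  rw [real_inner_self_eq_norm_sq] at h
  by_contra hc
  push Not at hc
  nlinarith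
end
section
lemma cos_exp_int {κ ξ l : ℝ} (hne : κ ^ 2 - ξ ^ 2 ≠ 0) (hs : sin (κ * l) = 0) :
    ‖∫ y in (0:ℝ)..l, ((cos (κ * y) : ℝ) : ℂ) * Complex.exp (Complex.I * ((y * ξ : ℝ) : ℂ))‖ ≤
      2 * |ξ| / |κ ^ 2 - ξ ^ 2| := by
  set F : ℝ → ℂ := fun y => Complex.exp (Complex.I * ((y * ξ : ℝ) : ℂ)) *
    (Complex.I * ξ * ((cos (κ * y) : ℝ) : ℂ) + κ * ((sin (κ * y) : ℝ) : ℂ)) / ((κ ^ 2 - ξ ^ 2 : ℝ) : ℂ) with hF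
  have hne' : ((κ ^ 2 - ξ ^ 2 : ℝ) : ℂ) ≠ 0 := by exact_mod_cast hne
  have hd : ∀ y, HasDerivAt F (((cos (κ * y) : ℝ) : ℂ) * Complex.exp (Complex.I * ((y * ξ : ℝ) : ℂ))) y := by
    intro y
    have d1 : HasDerivAt (fun y : ℝ => ((y * ξ : ℝ) : ℂ)) (ξ : ℂ) y := by
      have := ((hasDerivAt_id y).mul_const ξ).ofReal_comp
      simpa using this
    have d2 := (d1.const_mul Complex.I).cexp
    have d0 : HasDerivAt (fun y : ℝ => κ * y) κ y := by simpa using (hasDerivAt_id y).const_mul κ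
    have d3 := (d0.cos).ofReal_comp
    have d4 := (d0.sin).ofReal_comp
    have d5 := (d2.mul ((d3.const_mul (Complex.I * ξ)).add (d4.const_mul (κ : ℂ)))).div_const ((κ ^ 2 - ξ ^ 2 : ℝ) : ℂ)
    refine HasDerivAt.congr_deriv d5 ?_
    rw [div_eq_iff hne']
    push_cast
    simp only [Pi.add_apply]
    push_cast
    linear_combination (Complex.exp (Complex.I * (y * ξ)) * Complex.cos (κ * y) * ξ ^ 2) * Complex.I_sq
  rw [intervalIntegral.integral_eq_sub_of_hasDerivAt (fun y _ => hd y)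
    (Continuous.intervalIntegrable (by fun_prop) _ _)]
  have hb : ∀ y, sin (κ * y) = 0 → ‖F y‖ ≤ |ξ| / |κ ^ 2 - ξ ^ 2| := by
    intro y hy
    rw [hF]
    dsimp only
    rw [hy, norm_div, norm_mul, mul_comm Complex.I, Complex.norm_exp_ofReal_mul_I, one_mul, Complex.norm_real,
      Real.norm_eq_abs]
    gcongr
    rw [Complex.ofReal_zero, mul_zero, add_zero, norm_mul, norm_mul, Complex.norm_I, one_mul,
      Complex.norm_real, Complex.norm_real, Real.norm_eq_abs, Real.norm_eq_abs]
    exact mul_le_of_le_one_right (abs_nonneg _) (Real.abs_cos_le_one _)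
  calc _ ≤ ‖F l‖ + ‖F 0‖ := norm_sub_le _ _
    _ ≤ |ξ| / |κ ^ 2 - ξ ^ 2| + |ξ| / |κ ^ 2 - ξ ^ 2| := add_le_add (hb _ hs) (hb _ (by simp))
    _ = _ := by ring
lemma cc_KT {N j : ℕ} (hj : j < N) (k : ℕ) (ξ : ℝ) :
    ‖KT eK (cc N j k) ξ‖ = √(2 * N) * ‖∫ y in (0:ℝ)..(1 / N), ((cos ((π * k * N) * y) : ℝ) : ℂ) *
      Complex.exp (Complex.I * ((y * ξ : ℝ) : ℂ))‖ := by
  have hN : (0:ℝ) < N := by exact_mod_cast (by omega : 0 < N)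
  have e1 : KT eK (cc N j k) ξ = ∫ x in cell N j, (ccF N j k x : ℂ) * eK x ξ ∂nu := by
    unfold KT
    rw [← integral_indicator (cell_meas N j)]
    apply integral_congr_ae
    filter_upwards [cc_coe N j k] with x hx
    rw [hx]
    by_cases hx : x ∈ cell N j <;> simp [hx]
  have e2 : ∫ y in (0:ℝ)..(1 / N), (ccF N j k ((j:ℝ) / N + y) : ℂ) * eK ((j:ℝ) / N + y) ξ =
      (√(2 * N) : ℂ) * eK ((j:ℝ) / N) ξ * ∫ y in (0:ℝ)..(1 / N), ((cos ((π * k * N) * y) : ℝ) : ℂ) *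
      Complex.exp (Complex.I * ((y * ξ : ℝ) : ℂ)) := by
    rw [← intervalIntegral.integral_const_mul]
    congr 1
    ext y
    unfold ccF eK
    have a1 : π * k * (N * ((j:ℝ) / N + y) - j) = (π * k * N) * y := by field_simp; ring
    have a2 : Complex.I * ((((j:ℝ) / N + y) * ξ : ℝ) : ℂ) = Complex.I * (((j:ℝ) / N * ξ : ℝ) : ℂ) +
      Complex.I * ((y * ξ : ℝ) : ℂ) := by push_cast; ring
    rw [a1, a2, Complex.exp_add, Complex.ofReal_mul]
    ring
  rw [e1, cell_int hj, e2, norm_mul, norm_mul, eK_norm, mul_one, Complex.norm_real, Real.norm_eq_abs,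
    abs_of_nonneg (sqrt_nonneg _)]
lemma cc_KT_bound {N j : ℕ} (hj : j < N) (k : ℕ) (ξ : ℝ) (hne : (π * k * N) ^ 2 - ξ ^ 2 ≠ 0) :
    ‖KT eK (cc N j k) ξ‖ ^ 2 ≤ 8 * N * ξ ^ 2 / ((π * k * N) ^ 2 - ξ ^ 2) ^ 2 := by
  have hN : (0:ℝ) < N := by exact_mod_cast (by omega : 0 < N)
  have h := cos_exp_int (l := 1 / N) hne (by
    rw [show π * k * N * (1 / (N:ℝ)) = k * π by field_simp]
    exact sin_nat_mul_pi k)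
  rw [cc_KT hj, mul_pow, Real.sq_sqrt (by positivity)]
  calc _ ≤ 2 * N * (2 * |ξ| / |(π * k * N) ^ 2 - ξ ^ 2|) ^ 2 := by gcongr
    _ = _ := by rw [div_pow, mul_pow, sq_abs, sq_abs]; ring
lemma cc_mean {N j : ℕ} (hj : j < N) {k : ℕ} (hk : 1 ≤ k) : ∫ x, cc N j k x ∂nu = 0 := by
  have hN : (0:ℝ) < N := by exact_mod_cast (by omega : 0 < N)
  have hk' : (0:ℝ) < k := by exact_mod_cast hk
  have h := cc_KT_bound hj k 0 (by
    have : 0 < π * k * N := by positivity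
    have : 0 < (π * k * N) ^ 2 := by positivity
    linarith)
  have h0 : KT eK (cc N j k) 0 = ((∫ x, cc N j k x ∂nu : ℝ) : ℂ) := by
    unfold KT eK
    simp only [mul_zero, Complex.ofReal_zero, Complex.exp_zero, mul_one]
    exact integral_ofReal (𝕜 := ℂ)
  rw [h0, Complex.norm_real, Real.norm_eq_abs, sq_abs] at h
  simp at h
  simpa using h
lemma cos_pt {N j : ℕ} (hj : j < N) {k : ℕ} (hk : 1 ≤ k) {δ p : ℝ} (hδ : 0 < δ) (hδ1 : δ < 1) (hp : 0 < p) (ξ : ℝ) :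
    |ξ| ^ (-p) * ‖KT eK (cc N j k) ξ‖ ^ 2 ≤
      ((1 - δ) * (π * k * N)) ^ (-p) * ‖KT eK (cc N j k) ξ‖ ^ 2 +
      8 * N / δ ^ 2 * (π * k * N) ^ (-p - 2) * mm p (ξ / (π * k * N)) := by
  have hN : (0:ℝ) < N := by exact_mod_cast (by omega : 0 < N)
  have hk' : (0:ℝ) < k := by exact_mod_cast hk
  set κ : ℝ := π * k * N with hκ
  have hκ0 : 0 < κ := by positivity
  have hmm := mm_nonneg p (ξ / κ)
  have h1δ : 0 < 1 - δ := by linarith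
  rcases le_or_gt ((1 - δ) * κ) |ξ| with h | h
  · have := rpow_le_rpow_of_nonpos (by positivity) h (by linarith : -p ≤ 0)
    have h2 : |ξ| ^ (-p) * ‖KT eK (cc N j k) ξ‖ ^ 2 ≤ ((1 - δ) * κ) ^ (-p) * ‖KT eK (cc N j k) ξ‖ ^ 2 := by
      gcongr
    have h3 : 0 ≤ 8 * N / δ ^ 2 * κ ^ (-p - 2) * mm p (ξ / κ) := by positivity
    linarith
  · have hx2 : ξ ^ 2 ≤ (1 - δ) * κ ^ 2 := by
      rw [← sq_abs]
      have : |ξ| ^ 2 ≤ ((1 - δ) * κ) ^ 2 := pow_le_pow_left₀ (abs_nonneg _) h.le 2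
      have h5 : (1 - δ) * (1 - δ) ≤ (1 - δ) * 1 := by gcongr; linarith
      have h6 : (1 - δ) * (1 - δ) * κ ^ 2 ≤ (1 - δ) * 1 * κ ^ 2 := by gcongr
      linarith
    have hge : δ * κ ^ 2 ≤ κ ^ 2 - ξ ^ 2 := by linarith
    have hpos : 0 < δ * κ ^ 2 := by positivity
    have hb := cc_KT_bound hj k ξ (by rw [← hκ]; linarith)
    rw [← hκ] at hb
    have hb2 : ‖KT eK (cc N j k) ξ‖ ^ 2 ≤ 8 * N / δ ^ 2 * κ ^ (-(2:ℝ)) * min 4 ((ξ / κ) ^ 2) := by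
      have hz : (ξ / κ) ^ 2 ≤ 4 := by
        rw [div_pow, div_le_iff₀ (by positivity)]
        nlinarith [sq_nonneg κ]
      rw [min_eq_right hz]
      calc _ ≤ 8 * N * ξ ^ 2 / (κ ^ 2 - ξ ^ 2) ^ 2 := hb
        _ ≤ 8 * N * ξ ^ 2 / (δ * κ ^ 2) ^ 2 := by gcongr
        _ = _ := by
          rw [rpow_neg hκ0.le, rpow_two]; field_simp
    have e : |ξ| ^ (-p) = κ ^ (-p) * |ξ / κ| ^ (-p) := by
      rw [← Real.mul_rpow hκ0.le (abs_nonneg _), abs_div, abs_of_pos hκ0]; congr 1; field_simp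
    have h4 : 0 ≤ ((1 - δ) * κ) ^ (-p) * ‖KT eK (cc N j k) ξ‖ ^ 2 := by positivity
    calc _ ≤ |ξ| ^ (-p) * (8 * N / δ ^ 2 * κ ^ (-(2:ℝ)) * min 4 ((ξ / κ) ^ 2)) := by gcongr
      _ = 8 * N / δ ^ 2 * κ ^ (-p - 2) * mm p (ξ / κ) := by
        rw [e, show -p - 2 = -p + -(2:ℝ) by ring, rpow_add hκ0]
        unfold mm
        ring
      _ ≤ _ := by linarith
lemma cos_decay0 {N j : ℕ} (hj : j < N) {k : ℕ} (hk : 1 ≤ k) {h0 : ℝ} (hh0 : h0 ∈ Ioo (0:ℝ) 1) {g : ℝ → ℝ}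
    (hK : Ker (aK (fun _ => h0)) g) {δ : ℝ} (hδ : 0 < δ) (hδ1 : δ < 1) :
    ‖hK.op (cc N j k)‖ ^ 2 ≤ Cstar h0 ^ 2 * (π * k * N) ^ (-(2 * h0 + 1)) *
      (2 * π * (1 - δ) ^ (-(2 * h0 + 1)) + 8 / (δ ^ 2 * π * k) * ∫ ξ, mm (2 * h0 + 1) ξ) := by
  have hN : (0:ℝ) < N := by exact_mod_cast (by omega : 0 < N)
  have hk' : (0:ℝ) < k := by exact_mod_cast hk
  set p := 2 * h0 + 1 with hp
  have hp1 : 1 < p := by linarith [hh0.1]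
  have hp3 : p < 3 := by linarith [hh0.2]
  set κ : ℝ := π * k * N with hκ
  have hκ0 : 0 < κ := by positivity
  have h1δ : 0 < 1 - δ := by linarith
  obtain ⟨hpi, hpl⟩ := plancherel (cc N j k)
  have hpl' : ∫ ξ, ‖KT eK (cc N j k) ξ‖ ^ 2 ≤ 2 * π := by
    refine hpl.trans ?_
    have := cc_norm hj hk
    have hpi := pi_pos
    nlinarith
  have hmi : Integrable (fun ξ => mm p (ξ / κ)) := (mm_int hp1 hp3).comp_div hκ0.ne'
  rw [hK.op_norm_sq]
  simp_rw [KT_const_mean_zero_sq h0 (cc N j k) (cc_mean hj hk)]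
  have hM : Integrable (fun ξ => Cstar h0 ^ 2 * (((1 - δ) * κ) ^ (-p) * ‖KT eK (cc N j k) ξ‖ ^ 2 +
      8 * N / δ ^ 2 * κ ^ (-p - 2) * mm p (ξ / κ))) :=
    ((hpi.const_mul _).add (hmi.const_mul _)).const_mul _
  calc _ ≤ ∫ ξ, Cstar h0 ^ 2 * (((1 - δ) * κ) ^ (-p) * ‖KT eK (cc N j k) ξ‖ ^ 2 +
      8 * N / δ ^ 2 * κ ^ (-p - 2) * mm p (ξ / κ)) := by
        apply integral_mono_of_nonneg (Eventually.of_forall fun ξ => by positivity) hM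
        refine Eventually.of_forall fun ξ => ?_
        have := cos_pt hj hk hδ hδ1 (by linarith : 0 < p) ξ
        dsimp only
        rw [mul_assoc]
        gcongr
    _ = Cstar h0 ^ 2 * (((1 - δ) * κ) ^ (-p) * (∫ ξ, ‖KT eK (cc N j k) ξ‖ ^ 2) +
      8 * N / δ ^ 2 * κ ^ (-p - 2) * (κ * ∫ ξ, mm p ξ)) := by
        rw [integral_const_mul, integral_add (hpi.const_mul _) (hmi.const_mul _), integral_const_mul,
          integral_const_mul, Measure.integral_comp_div, abs_of_pos hκ0, smul_eq_mul]
    _ ≤ Cstar h0 ^ 2 * (((1 - δ) * κ) ^ (-p) * (2 * π) +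
      8 * N / δ ^ 2 * κ ^ (-p - 2) * (κ * ∫ ξ, mm p ξ)) := by gcongr
    _ = _ := by
        rw [Real.mul_rpow h1δ.le hκ0.le, show -p - 2 = -p + -(2:ℝ) by ring, rpow_add hκ0,
          rpow_neg hκ0.le 2, rpow_two]
        have : 8 * N / δ ^ 2 * (κ ^ (-p) * (κ ^ 2)⁻¹) * (κ * ∫ ξ, mm p ξ) =
          κ ^ (-p) * (8 / (δ ^ 2 * π * k) * ∫ ξ, mm p ξ) := by
          set Y := κ ^ (-p)
          set W := ∫ ξ, mm p ξ
          rw [hκ]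
          field_simp
        rw [this]; ring
lemma cos_decay {h0 : ℝ} (hh0 : h0 ∈ Ioo (0:ℝ) 1) {g : ℝ → ℝ}
    (hK : Ker (aK (fun _ => h0)) g) {η : ℝ} (hη : 0 < η) :
    ∃ k0 : ℕ, 1 ≤ k0 ∧ ∀ N j k : ℕ, j < N → k0 ≤ k →
      ‖hK.op (cc N j k)‖ ^ 2 ≤ (1 + η) * (2 * π * Cstar h0 ^ 2) * (π * k * N) ^ (-(2 * h0 + 1)) := by
  set p := 2 * h0 + 1 with hp
  have hc : ContinuousAt (fun δ : ℝ => (1 - δ) ^ (-p)) 0 := by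
    apply ContinuousAt.rpow_const (by fun_prop)
    left; norm_num
  have hc2 : Tendsto (fun δ : ℝ => (1 - δ) ^ (-p)) (nhdsWithin 0 (Ioi 0)) (nhds 1) := by
    have := hc.tendsto.mono_left (nhdsWithin_le_nhds (s := Ioi 0))
    simpa using this
  have h1 := hc2.eventually_le_const (by linarith : 1 < 1 + η / 2)
  have h2 : ∀ᶠ δ : ℝ in nhdsWithin 0 (Ioi 0), δ ∈ Ioo (0:ℝ) 1 := Ioo_mem_nhdsGT one_pos
  obtain ⟨δ, hδ1, hδ⟩ := (h1.and h2).exists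
  set W := ∫ ξ, mm p ξ with hW
  have hW0 : 0 ≤ W := integral_nonneg (mm_nonneg p)
  obtain ⟨k1, hk1⟩ := exists_nat_ge (8 * W / (δ ^ 2 * π * (π * η)))
  refine ⟨max 1 k1, le_max_left _ _, ?_⟩
  intro N j k hj hk
  have hN : (0:ℝ) < N := by exact_mod_cast (by omega : 0 < N)
  have hk1' : 1 ≤ k := (le_max_left _ _).trans hk
  have hkp : (0:ℝ) < k := by exact_mod_cast hk1'
  have hδ0 := hδ.1
  have hkk : 8 * W / (δ ^ 2 * π * (π * η)) ≤ k :=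
    hk1.trans (by exact_mod_cast (le_max_right _ _).trans hk)
  have h3 : 8 / (δ ^ 2 * π * k) * W ≤ π * η := by
    rw [div_le_iff₀ (by positivity)] at hkk
    rw [div_mul_eq_mul_div, div_le_iff₀ (by positivity)]
    linarith
  refine (cos_decay0 hj hk1' hh0 hK hδ.1 hδ.2).trans ?_
  rw [← hp, ← hW]
  have hpi := pi_pos
  have h4 : 2 * π * (1 - δ) ^ (-p) + 8 / (δ ^ 2 * π * k) * W ≤ (1 + η) * (2 * π) := by
    have : 2 * π * (1 - δ) ^ (-p) ≤ 2 * π * (1 + η / 2) := by gcongr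
    linarith
  calc _ ≤ Cstar h0 ^ 2 * (π * k * N) ^ (-p) * ((1 + η) * (2 * π)) := by gcongr
    _ = _ := by ring
lemma cc_norm_crude {N j : ℕ} (hj : j < N) (k : ℕ) : ‖cc N j k‖ ^ 2 ≤ 2 := by
  have hN : (0:ℝ) < N := by exact_mod_cast (by omega : 0 < N)
  have e : ‖cc N j k‖ ^ 2 = ∫ x in cell N j, ccF N j k x ^ 2 ∂nu := by
    rw [ee_norm_sq, ← integral_indicator (cell_meas N j)]
    apply integral_congr_ae
    filter_upwards [cc_coe N j k] with x hx
    rw [hx]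
    by_cases hx : x ∈ cell N j <;> simp [hx]
  rw [e, cell_int hj]
  calc _ ≤ ∫ y in (0:ℝ)..(1 / N), (2 * N : ℝ) := by
        apply intervalIntegral.integral_mono_on (by positivity)
        · have := ccF_cont N j k
          exact Continuous.intervalIntegrable (by fun_prop) _ _
        · exact intervalIntegrable_const
        · intro y _
          rw [← sq_abs, ← Real.sq_sqrt (by positivity : (0:ℝ) ≤ 2 * N)]
          exact pow_le_pow_left₀ (abs_nonneg _) (ccF_abs _ _ _ _) 2
    _ = 2 := by rw [intervalIntegral.integral_const, smul_eq_mul]; field_simp; ring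
end
section
section P16
variable [MeasurableSpace EE] [BorelSpace EE] (μ : Measure EE) [IsProbabilityMeasure μ]
lemma lower_fin {T : EE →L[ℝ] HH}
    (hchar : ∀ v : EE, ∫ f, Complex.exp (Complex.I * ((inner ℝ v f : ℝ) : ℂ)) ∂μ =
      (exp (-(‖T v‖ ^ 2) / 2) : ℂ))
    (D S1 S2 : Set ℝ) (hD : MeasurableSet D) (hS1 : MeasurableSet S1) (hS2 : MeasurableSet S2)
    (s : ℝ) (hs : 0 ≤ s) {R0 R1 R2 : ℝ}
    (hR1 : ∀ (n : ℕ) (e : Fin n → EE), Orthonormal ℝ e →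
      (∀ i j, i ≠ j → inner ℝ (T (ind S1 hS1 (e i))) (T (ind S1 hS1 (e j))) = 0) →
      Antitone (fun i => ‖T (ind S1 hS1 (e i))‖ ^ 2) →
      ∀ K : Finset (Fin n), ∑ i ∈ K, log (1 + s * ‖T (ind S1 hS1 (e i))‖ ^ 2) ≤ R1)
    (hR2 : ∀ (n : ℕ) (e : Fin n → EE), Orthonormal ℝ e →
      (∀ i j, i ≠ j → inner ℝ (T (ind S2 hS2 (e i))) (T (ind S2 hS2 (e j))) = 0) →
      Antitone (fun i => ‖T (ind S2 hS2 (e i))‖ ^ 2) →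
      ∀ K : Finset (Fin n), ∑ i ∈ K, log (1 + s * ‖T (ind S2 hS2 (e i))‖ ^ 2) ≤ R2)
    {κ : Type} [Countable κ] (b : κ → HH)
    (hb : ∀ ζ : HH, Summable (fun k => inner ℝ (b k) ζ ^ 2) ∧
      ∀ (n : ℕ) (e : Fin n → EE), Orthonormal ℝ e →
        ∑ i, inner ℝ (T (ind D hD (e i))) ζ ^ 2 ≤ ∑' k, inner ℝ (b k) ζ ^ 2)
    (hR0 : ∀ K : Finset κ, ∑ k ∈ K, log (1 + s * ‖b k‖ ^ 2) ≤ R0)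
    {n : ℕ} (h : Fin n → EE) (hh : Orthonormal ℝ h) :
    exp (-(R0 + (R1 + R2)) / 2) ≤ ∫ f, exp (-(s / 2) *
      ∑ i, (inner ℝ (h i) (ind D hD f) ^ 2 + inner ℝ (h i) (ind S1 hS1 f) ^ 2
        + inner ℝ (h i) (ind S2 hS2 f) ^ 2)) ∂μ := by
  obtain ⟨e1, he1, hs1, ho1, ha1⟩ := diag_lemma h hh (T.comp (ind S1 hS1))
  obtain ⟨e2, he2, hs2, ho2, ha2⟩ := diag_lemma h hh (T.comp (ind S2 hS2))
  simp only [ContinuousLinearMap.comp_apply] at ho1 ha1 ho2 ha2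
  have q1 := hR1 n e1 he1 ho1 ha1
  have q2 := hR2 n e2 he2 ho2 ha2
  let v : Fin n ⊕ (Fin n ⊕ Fin n) → EE := Sum.elim (fun i => ind D hD (h i))
    (Sum.elim (fun i => ind S1 hS1 (e1 i)) (fun i => ind S2 hS2 (e2 i)))
  have hv : ∀ f, ∑ i, (inner ℝ (h i) (ind D hD f) ^ 2 + inner ℝ (h i) (ind S1 hS1 f) ^ 2
        + inner ℝ (h i) (ind S2 hS2 f) ^ 2) = ∑ i, inner ℝ (v i) f ^ 2 := by
    intro f
    simp only [Finset.sum_add_distrib, Fintype.sum_sum_type, v, Sum.elim_inl, Sum.elim_inr]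
    simp only [ind_symm]
    rw [hs1 (ind S1 hS1 f), hs2 (ind S2 hS2 f), add_assoc]
  simp only [hv]
  rw [mu_dual μ T hchar v s hs]
  let B : κ ⊕ (Fin n ⊕ Fin n) → HH := Sum.elim b
    (Sum.elim (fun i => T (ind S1 hS1 (e1 i))) (fun i => T (ind S2 hS2 (e2 i))))
  apply gauss_compare (fun i => T (v i)) B s hs
  · intro ζ
    obtain ⟨z1, z2⟩ := hb ζ
    have y1 : Summable ((fun k => inner ℝ (B k) ζ ^ 2) ∘ Sum.inl) := z1
    have y2 : Summable ((fun k => inner ℝ (B k) ζ ^ 2) ∘ Sum.inr) := Summable.of_finite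
    refine ⟨y1.sum _ y2, ?_⟩
    rw [y1.tsum_sum y2, Fintype.sum_sum_type]
    refine add_le_add (z2 n h hh) ?_
    rw [tsum_fintype]
    apply le_of_eq
    rw [Fintype.sum_sum_type, Fintype.sum_sum_type]
    rfl
  · intro K
    rw [← Finset.toLeft_disjSum_toRight (u := K), Finset.sum_disjSum]
    refine add_le_add (hR0 _) ?_
    generalize K.toRight = K'
    rw [← Finset.toLeft_disjSum_toRight (u := K'), Finset.sum_disjSum]
    exact add_le_add (q1 _) (q2 _)
theorem lower_phi {T : EE →L[ℝ] HH}
    (hchar : ∀ v : EE, ∫ f, Complex.exp (Complex.I * ((inner ℝ v f : ℝ) : ℂ)) ∂μ =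
      (exp (-(‖T v‖ ^ 2) / 2) : ℂ))
    (D S1 S2 : Set ℝ) (hD : MeasurableSet D) (hS1 : MeasurableSet S1) (hS2 : MeasurableSet S2)
    (hpart : ∀ f : EE, ‖f‖ ^ 2 = ‖ind D hD f‖ ^ 2 + ‖ind S1 hS1 f‖ ^ 2 + ‖ind S2 hS2 f‖ ^ 2)
    (s : ℝ) (hs : 0 ≤ s) {R0 R1 R2 : ℝ}
    (hR1 : ∀ (n : ℕ) (e : Fin n → EE), Orthonormal ℝ e →
      (∀ i j, i ≠ j → inner ℝ (T (ind S1 hS1 (e i))) (T (ind S1 hS1 (e j))) = 0) →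
      Antitone (fun i => ‖T (ind S1 hS1 (e i))‖ ^ 2) →
      ∀ K : Finset (Fin n), ∑ i ∈ K, log (1 + s * ‖T (ind S1 hS1 (e i))‖ ^ 2) ≤ R1)
    (hR2 : ∀ (n : ℕ) (e : Fin n → EE), Orthonormal ℝ e →
      (∀ i j, i ≠ j → inner ℝ (T (ind S2 hS2 (e i))) (T (ind S2 hS2 (e j))) = 0) →
      Antitone (fun i => ‖T (ind S2 hS2 (e i))‖ ^ 2) →
      ∀ K : Finset (Fin n), ∑ i ∈ K, log (1 + s * ‖T (ind S2 hS2 (e i))‖ ^ 2) ≤ R2)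
    {κ : Type} [Countable κ] (b : κ → HH)
    (hb : ∀ ζ : HH, Summable (fun k => inner ℝ (b k) ζ ^ 2) ∧
      ∀ (n : ℕ) (e : Fin n → EE), Orthonormal ℝ e →
        ∑ i, inner ℝ (T (ind D hD (e i))) ζ ^ 2 ≤ ∑' k, inner ℝ (b k) ζ ^ 2)
    (hR0 : ∀ K : Finset κ, ∑ k ∈ K, log (1 + s * ‖b k‖ ^ 2) ≤ R0) :
    -2 * log (∫ f, exp (-(s / 2) * ‖f‖ ^ 2) ∂μ) ≤ R0 + (R1 + R2) := by
  classical
  obtain ⟨ι, hι, h, hho, hsum⟩ := exists_onb EE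
  have key : ∀ K : Finset ι, exp (-(R0 + (R1 + R2)) / 2) ≤ ∫ f, exp (-(s / 2) *
      ∑ i ∈ K, (inner ℝ (h i) (ind D hD f) ^ 2 + inner ℝ (h i) (ind S1 hS1 f) ^ 2
        + inner ℝ (h i) (ind S2 hS2 f) ^ 2)) ∂μ := by
    intro K
    let hK : Fin K.card → EE := fun j => h (K.equivFin.symm j)
    have hhK : Orthonormal ℝ hK :=
      hho.comp (fun j => (K.equivFin.symm j : ι)) (Subtype.val_injective.comp K.equivFin.symm.injective)
    have hsum : ∀ F : ι → ℝ, ∑ i ∈ K, F i = ∑ j, F (K.equivFin.symm j) := by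
      intro F
      rw [K.equivFin.symm.sum_comp (fun i : K => F i), Finset.sum_coe_sort]
    have := lower_fin μ hchar D S1 S2 hD hS1 hS2 s hs hR1 hR2 b hb hR0 hK hhK
    refine this.trans (le_of_eq ?_)
    congr 1
    ext f
    rw [hsum]
  have hlim : Tendsto (fun K : Finset ι => ∫ f, exp (-(s / 2) *
      ∑ i ∈ K, (inner ℝ (h i) (ind D hD f) ^ 2 + inner ℝ (h i) (ind S1 hS1 f) ^ 2
        + inner ℝ (h i) (ind S2 hS2 f) ^ 2)) ∂μ) atTop (nhds (∫ f, exp (-(s / 2) * ‖f‖ ^ 2) ∂μ)) := by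
    apply tendsto_integral_filter_of_dominated_convergence (fun _ => 1)
    · refine Eventually.of_forall fun K => ?_
      apply Continuous.aestronglyMeasurable
      fun_prop
    · refine Eventually.of_forall fun K => Eventually.of_forall fun f => ?_
      rw [Real.norm_of_nonneg (exp_pos _).le, exp_le_one_iff]
      have : 0 ≤ ∑ i ∈ K, (inner ℝ (h i) (ind D hD f) ^ 2 + inner ℝ (h i) (ind S1 hS1 f) ^ 2
        + inner ℝ (h i) (ind S2 hS2 f) ^ 2) := Finset.sum_nonneg fun i _ => by positivity
      have := mul_nonneg hs this
      linarith
    · exact integrable_const _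
    · refine Eventually.of_forall fun f => ?_
      have := ((hsum (ind D hD f)).add (hsum (ind S1 hS1 f))).add (hsum (ind S2 hS2 f))
      rw [← hpart f] at this
      exact (Real.continuous_exp.tendsto _).comp (this.const_mul (-(s / 2)))
  have hfin := ge_of_tendsto' hlim key
  have := log_le_log (exp_pos _) hfin
  rw [log_exp] at this
  linarith
end P16
end
section
open Classical in
def UN (D : Set ℝ) (N : ℕ) : Finset ℕ := (Finset.range N).filter (fun j => (cell N j ∩ D).Nonempty)
lemma UN_mem {D : Set ℝ} {N j : ℕ} : j ∈ UN D N ↔ j < N ∧ (cell N j ∩ D).Nonempty := by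
  simp [UN]
lemma cell_cover {N : ℕ} (hN : 0 < N) {x : ℝ} (hx : x ∈ Ioo (0:ℝ) 1) : ∃ j < N, x ∈ cell N j := by
  have hN' : (0:ℝ) < N := by exact_mod_cast hN
  have hpos : 0 < (N:ℝ) * x := mul_pos hN' hx.1
  have hc : 0 < ⌈(N:ℝ) * x⌉₊ := Nat.ceil_pos.2 hpos
  refine ⟨⌈(N:ℝ) * x⌉₊ - 1, ?_, ?_⟩
  · have : ⌈(N:ℝ) * x⌉₊ ≤ N := by
      apply Nat.ceil_le.2
      nlinarith [hx.2]
    omega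
  · have e : ((⌈(N:ℝ) * x⌉₊ - 1 : ℕ) : ℝ) = (⌈(N:ℝ) * x⌉₊ : ℝ) - 1 := by
      rw [Nat.cast_sub hc]; simp
    have l1 := Nat.le_ceil ((N:ℝ) * x)
    have l2 := Nat.ceil_lt_add_one hpos.le
    constructor
    · rw [div_lt_iff₀ hN', e]; linarith
    · rw [le_div_iff₀ hN', e]; linarith
lemma UN_bound {D : Set ℝ} (hD : MeasurableSet D) {N : ℕ} (hN : 0 < N) (g : EE) :
    ‖ind D hD g‖ ^ 2 ≤ ∑ j ∈ UN D N, ∫ x in cell N j, g x ^ 2 ∂nu := by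
  rw [ind_norm_sq, ← integral_indicator hD]
  simp_rw [← integral_indicator (cell_meas _ _)]
  have hi : ∀ j ∈ UN D N, Integrable ((cell N j).indicator fun x => g x ^ 2) nu :=
    fun j _ => (ee_sq_int g).indicator (cell_meas _ _)
  rw [← integral_finsetSum _ hi]
  apply integral_mono_ae ((ee_sq_int g).indicator hD) (integrable_finsetSum _ hi)
  have hm : ∀ᵐ x ∂nu, x ∈ Ioo (0:ℝ) 1 := ae_restrict_mem measurableSet_Ioo
  filter_upwards [hm] with x hx
  have hnn : ∀ j ∈ UN D N, 0 ≤ (cell N j).indicator (fun x => g x ^ 2) x :=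
    fun j _ => indicator_nonneg (fun _ _ => sq_nonneg _) _
  by_cases hxD : x ∈ D
  · obtain ⟨j, hj, hxj⟩ := cell_cover hN hx
    have hju : j ∈ UN D N := UN_mem.2 ⟨hj, x, hxj, hxD⟩
    refine le_trans (le_of_eq ?_) (Finset.single_le_sum hnn hju)
    simp [indicator_of_mem hxD, indicator_of_mem hxj]
  · rw [indicator_of_notMem hxD]
    exact Finset.sum_nonneg hnn
lemma UN_hb {D : Set ℝ} (hD : MeasurableSet D) {N : ℕ} (hN : 0 < N) (T : EE →L[ℝ] HH) (ζ : HH) :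
    Summable (fun q : (UN D N) × ℕ => inner ℝ (T (cc N q.1 q.2)) ζ ^ 2) ∧
      ∀ (n : ℕ) (e : Fin n → EE), Orthonormal ℝ e →
        ∑ i, inner ℝ (T (ind D hD (e i))) ζ ^ 2 ≤
          ∑' q : (UN D N) × ℕ, inner ℝ (T (cc N q.1 q.2)) ζ ^ 2 := by
  set g : EE := ContinuousLinearMap.adjoint T ζ with hg
  have hadj : ∀ u, inner ℝ (T u) ζ = inner ℝ u g := fun u =>
    (ContinuousLinearMap.adjoint_inner_right T u ζ).symm
  simp only [hadj]
  have hc := fun j : UN D N => cos_complete (UN_mem.1 j.2).1 g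
  have hs : Summable (fun q : (UN D N) × ℕ => inner ℝ (cc N q.1 q.2) g ^ 2) := by
    rw [summable_prod_of_nonneg (fun q => sq_nonneg _)]
    exact ⟨fun j => (hc j).1, Summable.of_finite⟩
  refine ⟨hs, fun n e he => ?_⟩
  rw [hs.tsum_prod, tsum_fintype]
  have h1 : ∑ i, inner ℝ (ind D hD (e i)) g ^ 2 ≤ ‖ind D hD g‖ ^ 2 := by
    have b := he.sum_inner_products_le (ind D hD g) (s := Finset.univ)
    refine le_trans (le_of_eq ?_) b
    refine Finset.sum_congr rfl fun i _ => ?_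
    rw [ind_symm, Real.norm_eq_abs, sq_abs]
  refine h1.trans ((UN_bound hD hN g).trans ?_)
  rw [← Finset.sum_coe_sort (UN D N)]
  exact Finset.sum_le_sum fun j _ => (hc j).2.1
lemma cell_R {h0 : ℝ} (hh0 : h0 ∈ Ioo (0:ℝ) 1) {g : ℝ → ℝ}
    (hK : Ker (aK (fun _ => h0)) g) {η : ℝ} (hη : 0 < η) {k0 N j : ℕ} (hj : j < N) (hk1 : 1 ≤ k0)
    (hk0 : ∀ k, k0 ≤ k →
      ‖hK.op (cc N j k)‖ ^ 2 ≤ (1 + η) * (2 * π * Cstar h0 ^ 2) * (π * k * N) ^ (-(2 * h0 + 1)))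
    (hC : 0 < 2 * π * Cstar h0 ^ 2) {s : ℝ} (hs : 0 < s) (m : ℕ) :
    ∑ k ∈ Finset.range m, log (1 + s * ‖hK.op (cc N j k)‖ ^ 2) ≤
      k0 * log (1 + s * (‖hK.op‖ ^ 2 * 2)) +
        (s * ((1 + η) * (2 * π * Cstar h0 ^ 2))) ^ (1 / (2 * h0 + 1)) / (N * sin (π / (2 * h0 + 1))) := by
  set p := 2 * h0 + 1 with hp
  have hp1 : 1 < p := by rw [hp]; linarith [hh0.1]
  have hN : (0:ℝ) < N := by exact_mod_cast (by omega : 0 < N)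
  have hpi := pi_pos
  set A := s * ((1 + η) * (2 * π * Cstar h0 ^ 2)) with hA
  have hA0 : 0 < A := by positivity
  set c := A * (π * N) ^ (-p) with hc
  have hc0 : 0 < c := by positivity
  set L := log (1 + s * (‖hK.op‖ ^ 2 * 2)) with hL
  have hL0 : 0 ≤ L := log_nonneg (by nlinarith [mul_nonneg hs.le (sq_nonneg ‖hK.op‖)])
  let F : ℕ → ℝ := fun k => if k = 0 then 0 else log (1 + c * (k:ℝ) ^ (-p))
  have hF0 : ∀ k, 0 ≤ F k := by
    intro k
    simp only [F]
    split_ifs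
    · rfl
    · apply log_nonneg
      have : 0 ≤ c * (k:ℝ) ^ (-p) := by positivity
      linarith
  have hterm : ∀ k, log (1 + s * ‖hK.op (cc N j k)‖ ^ 2) ≤ (if k < k0 then L else 0) + F k := by
    intro k
    split_ifs with hk
    · have : log (1 + s * ‖hK.op (cc N j k)‖ ^ 2) ≤ L := by
        apply log_le_log (by positivity)
        have h1 := hK.op.le_opNorm (cc N j k)
        have h2 : ‖hK.op (cc N j k)‖ ^ 2 ≤ ‖hK.op‖ ^ 2 * ‖cc N j k‖ ^ 2 := by
          rw [← mul_pow]; gcongr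
        have h3 := cc_norm_crude hj k
        have h4 : ‖hK.op (cc N j k)‖ ^ 2 ≤ ‖hK.op‖ ^ 2 * 2 := h2.trans (by gcongr)
        gcongr
      linarith [hF0 k]
    · have hk' : k0 ≤ k := not_lt.1 hk
      have hkne : k ≠ 0 := by omega
      have hkpos : (0:ℝ) < k := by exact_mod_cast Nat.pos_of_ne_zero hkne
      simp only [F, hkne, if_false, zero_add]
      apply log_le_log (by positivity)
      have h1 := hk0 k hk'
      have h2 : c * (k:ℝ) ^ (-p) = s * ((1 + η) * (2 * π * Cstar h0 ^ 2) * (π * k * N) ^ (-p)) := by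
        rw [hc, hA, show π * (k:ℝ) * N = (π * N) * k by ring,
          Real.mul_rpow (x := π * (N:ℝ)) (by positivity) hkpos.le]
        ring
      rw [h2]
      gcongr
  refine (Finset.sum_le_sum fun k _ => hterm k).trans ?_
  rw [Finset.sum_add_distrib]
  apply add_le_add
  · rw [← Finset.sum_filter, Finset.sum_const, nsmul_eq_mul]
    apply mul_le_mul_of_nonneg_right _ hL0
    have : (Finset.filter (fun k => k < k0) (Finset.range m)).card ≤ (Finset.range k0).card :=
      Finset.card_le_card (by intro k; simp)
    rw [Finset.card_range] at this
    exact_mod_cast this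
  · have h1 : ∑ k ∈ Finset.range m, F k ≤ ∑ k ∈ Finset.range (m + 1), F k := by
      rw [Finset.sum_range_succ]; linarith [hF0 m]
    refine h1.trans ?_
    rw [Finset.sum_range_succ']
    have h2 := J_sum p c hp1 hc0 (Finset.range m)
    have h3 : c ^ (1 / p) = A ^ (1 / p) / (π * N) := by
      rw [hc, Real.mul_rpow hA0.le (by positivity), ← rpow_mul (by positivity),
        show -p * (1 / p) = -1 by field_simp, rpow_neg_one]
      rfl
    have h4 : c ^ (1 / p) * (π / sin (π / p)) = A ^ (1 / p) / (N * sin (π / p)) := by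
      rw [h3]
      have := (sin_pi_div_pos p hp1).ne'
      field_simp
    rw [← h4]
    refine le_trans (le_of_eq ?_) h2
    simp only [F, Nat.add_eq_zero_iff, one_ne_zero, and_false, if_false, if_true, add_zero, Nat.cast_add, Nat.cast_one]
lemma UN_R {D : Set ℝ} {h0 : ℝ} (hh0 : h0 ∈ Ioo (0:ℝ) 1) {g : ℝ → ℝ}
    (hK : Ker (aK (fun _ => h0)) g) {η : ℝ} (hη : 0 < η) {k0 N : ℕ} (hk1 : 1 ≤ k0)
    (hk0 : ∀ j k, j < N → k0 ≤ k →
      ‖hK.op (cc N j k)‖ ^ 2 ≤ (1 + η) * (2 * π * Cstar h0 ^ 2) * (π * k * N) ^ (-(2 * h0 + 1)))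
    (hC : 0 < 2 * π * Cstar h0 ^ 2) {s : ℝ} (hs : 0 < s) (K : Finset ((UN D N) × ℕ)) :
    ∑ q ∈ K, log (1 + s * ‖hK.op (cc N q.1 q.2)‖ ^ 2) ≤
      (UN D N).card * (k0 * log (1 + s * (‖hK.op‖ ^ 2 * 2)) +
        (s * ((1 + η) * (2 * π * Cstar h0 ^ 2))) ^ (1 / (2 * h0 + 1)) / (N * sin (π / (2 * h0 + 1)))) := by
  classical
  obtain ⟨m, hm⟩ : ∃ m, K ⊆ Finset.univ ×ˢ Finset.range m := by
    refine ⟨(K.sup fun q => q.2) + 1, fun q hq => ?_⟩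
    have : q.2 ≤ K.sup fun q => q.2 := Finset.le_sup (f := fun q : (UN D N) × ℕ => q.2) hq
    simp only [Finset.mem_product, Finset.mem_univ, Finset.mem_range, true_and]
    omega
  refine (Finset.sum_le_sum_of_subset_of_nonneg hm fun q _ _ => ?_).trans ?_
  · apply log_nonneg
    have : 0 ≤ s * ‖hK.op (cc N q.1 q.2)‖ ^ 2 := by positivity
    linarith
  · rw [Finset.sum_product]
    refine (Finset.sum_le_sum fun (j : UN D N) _ => cell_R hh0 hK hη (UN_mem.1 j.2).1 hk1
      (fun k hk => hk0 j k (UN_mem.1 j.2).1 hk) hC hs m).trans ?_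
    rw [Finset.sum_const, nsmul_eq_mul]
    simp
end
section
lemma op_agree {H : ℝ → ℝ} {h0 : ℝ} {g g' : ℝ → ℝ} (hk : Ker (aK H) g) (hB : Ker (aK (fun _ => h0)) g')
    (D : Set ℝ) (hD : MeasurableSet D) (hDH : ∀ x ∈ D, H x = h0) (u : EE) :
    hk.op (ind D hD u) = hB.op (ind D hD u) := by
  change (hk.memLp _).toLp _ = (hB.memLp _).toLp _
  have : KT (aK H) (ind D hD u) = KT (aK (fun _ => h0)) (ind D hD u) := by
    ext ξ
    rw [KT_ind, KT_ind]
    congr 1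
    ext x
    by_cases hx : x ∈ D
    · simp [indicator_of_mem hx, aK, hDH x hx]
    · simp [indicator_of_notMem hx]
  exact MemLp.toLp_congr _ _ (by rw [this])
lemma UN_meas {D : Set ℝ} (hD : IsCompact D) {ε : ℝ} (hε : 0 < ε) :
    ∃ N : ℕ, 0 < N ∧ ((UN D N).card : ℝ) / N ≤ (volume D).toReal + ε := by
  have h := tendsto_measure_cthickening_of_isCompact (μ := volume) hD
  have hfin : volume D ≠ ⊤ := hD.measure_lt_top.ne
  have h1 : Tendsto (fun N : ℕ => volume (cthickening (1 / ((N:ℝ) + 1)) D)) atTop (nhds (volume D)) :=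
    h.comp tendsto_one_div_add_atTop_nhds_zero_nat
  have h2 : volume D < volume D + ENNReal.ofReal ε :=
    ENNReal.lt_add_right hfin (by simpa using hε)
  obtain ⟨n, hn⟩ := (h1.eventually (gt_mem_nhds h2)).exists
  refine ⟨n + 1, by omega, ?_⟩
  have hN : (0:ℝ) < ((n + 1 : ℕ) : ℝ) := by positivity
  have hsub : (⋃ j ∈ UN D (n + 1), cell (n + 1) j) ⊆ cthickening (1 / ((n:ℝ) + 1)) D := by
    intro x hx
    simp only [mem_iUnion] at hx
    obtain ⟨j, hj, hxj⟩ := hx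
    obtain ⟨-, y, hy, hyD⟩ := UN_mem.1 hj
    apply mem_cthickening_of_dist_le x y _ _ hyD
    rw [Real.dist_eq]
    have e : ((j:ℝ) + 1) / ((n + 1 : ℕ):ℝ) = (j:ℝ) / ((n + 1 : ℕ):ℝ) + 1 / ((n:ℝ) + 1) := by
      push_cast; rw [add_div]
    have a1 := hxj.1; have a2 := hxj.2; have a3 := hy.1; have a4 := hy.2
    rw [e] at a2 a4
    rw [abs_le]; constructor <;> linarith
  have hdis : (↑(UN D (n + 1)) : Set ℕ).PairwiseDisjoint (fun j => cell (n + 1) j) := by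
    intro i _ j _ hij
    have key : ∀ i j : ℕ, i < j → Disjoint (cell (n + 1) i) (cell (n + 1) j) := by
      intro i j hij
      rw [Set.disjoint_left]
      intro x hx hy
      have : ((i:ℝ) + 1) / ((n + 1 : ℕ):ℝ) ≤ (j:ℝ) / ((n + 1 : ℕ):ℝ) := by
        gcongr
        exact_mod_cast hij
      linarith [hx.2, hy.1]
    rcases lt_or_gt_of_ne hij with h | h
    · exact key i j h
    · exact (key j i h).symm
  have hvol : volume (⋃ j ∈ UN D (n + 1), cell (n + 1) j) =
      ENNReal.ofReal (((UN D (n + 1)).card : ℝ) / ((n + 1 : ℕ):ℝ)) := by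
    rw [measure_biUnion_finset hdis (fun j _ => cell_meas _ _)]
    have : ∀ j ∈ UN D (n + 1), volume (cell (n + 1) j) = ENNReal.ofReal (1 / ((n + 1 : ℕ):ℝ)) := by
      intro j _
      rw [cell, Real.volume_Ioc]
      congr 1
      rw [add_div]; ring
    rw [Finset.sum_congr rfl this, Finset.sum_const, nsmul_eq_mul, div_eq_mul_one_div (((UN D (n + 1)).card : ℕ) : ℝ),
      ENNReal.ofReal_mul (by positivity), ENNReal.ofReal_natCast]
  have h3 := (measure_mono (μ := volume) hsub).trans hn.le
  rw [hvol] at h3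
  have h4 := ENNReal.toReal_mono (by simp [hfin]) h3
  rw [ENNReal.toReal_ofReal (by positivity), ENNReal.toReal_add hfin (by simp),
    ENNReal.toReal_ofReal hε.le] at h4
  exact h4
lemma S1_meas {H : ℝ → ℝ} (hH : Continuous H) (h0 : ℝ) {ε : ℝ} (hε : 0 < ε) {t : ℝ} (ht : 0 < t) :
    ∃ s' : ℝ, 0 < s' ∧ s' < t ∧ nu.real {x | h0 < H x ∧ H x < h0 + s'} ≤ ε := by
  have hnuf : IsFiniteMeasure nu := by unfold nu; infer_instance
  have hm : ∀ s' : ℝ, MeasurableSet {x | h0 < H x ∧ H x < h0 + s'} := fun s' =>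
    (measurableSet_lt measurable_const hH.measurable).inter (measurableSet_lt hH.measurable measurable_const)
  have h1 : Tendsto (fun n : ℕ => nu {x | h0 < H x ∧ H x < h0 + 1 / ((n:ℝ) + 1)}) atTop
      (nhds (nu (⋂ n : ℕ, {x | h0 < H x ∧ H x < h0 + 1 / ((n:ℝ) + 1)}))) := by
    apply tendsto_measure_iInter_atTop (fun n => (hm _).nullMeasurableSet)
    · intro m n hmn x hx
      refine ⟨hx.1, hx.2.trans_le ?_⟩
      have : 1 / ((n:ℝ) + 1) ≤ 1 / ((m:ℝ) + 1) := by
        gcongr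
      linarith
    · exact ⟨0, measure_ne_top _ _⟩
  have h2 : (⋂ n : ℕ, {x | h0 < H x ∧ H x < h0 + 1 / ((n:ℝ) + 1)}) = ∅ := by
    ext x
    simp only [mem_iInter, mem_ofPred_eq, mem_empty_iff_false, iff_false, not_forall]
    by_contra hc
    push Not at hc
    have hx := (hc 0).1
    obtain ⟨n, hn⟩ := exists_nat_one_div_lt (sub_pos.2 hx)
    linarith [(hc n).2]
  rw [h2, measure_empty] at h1
  have hev := h1.eventually (gt_mem_nhds (show (0:ℝ≥0∞) < ENNReal.ofReal ε by simpa using hε))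
  have hev2 := tendsto_one_div_add_atTop_nhds_zero_nat.eventually (gt_mem_nhds ht)
  obtain ⟨n, hn, hn2⟩ := (hev.and hev2).exists
  refine ⟨1 / ((n:ℝ) + 1), by positivity, hn2, ?_⟩
  exact ENNReal.toReal_le_of_le_ofReal hε.le hn.le
lemma part_norm (D S1 S2 : Set ℝ) (hD : MeasurableSet D) (hS1 : MeasurableSet S1) (hS2 : MeasurableSet S2)
    (h : ∀ x ∈ Ioo (0:ℝ) 1, (x ∈ D ∧ x ∉ S1 ∧ x ∉ S2) ∨ (x ∉ D ∧ x ∈ S1 ∧ x ∉ S2) ∨ (x ∉ D ∧ x ∉ S1 ∧ x ∈ S2))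
    (f : EE) : ‖f‖ ^ 2 = ‖ind D hD f‖ ^ 2 + ‖ind S1 hS1 f‖ ^ 2 + ‖ind S2 hS2 f‖ ^ 2 := by
  have hi := ee_sq_int f
  have i1 : Integrable (D.indicator fun x => f x ^ 2) nu := hi.indicator hD
  have i2 : Integrable (S1.indicator fun x => f x ^ 2) nu := hi.indicator hS1
  have i3 : Integrable (S2.indicator fun x => f x ^ 2) nu := hi.indicator hS2
  have i12 : Integrable (fun x => D.indicator (fun x => f x ^ 2) x + S1.indicator (fun x => f x ^ 2) x) nu := i1.add i2
  rw [ind_norm_sq, ind_norm_sq, ind_norm_sq, ee_norm_sq, ← integral_indicator hD, ← integral_indicator hS1,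
    ← integral_indicator hS2, ← integral_add i1 i2, ← integral_add i12 i3]
  apply integral_congr_ae
  have hm : ∀ᵐ x ∂nu, x ∈ Ioo (0:ℝ) 1 := ae_restrict_mem measurableSet_Ioo
  filter_upwards [hm] with x hx
  rcases h x hx with ⟨a, b, c⟩ | ⟨a, b, c⟩ | ⟨a, b, c⟩ <;> simp [indicator, a, b, c]
lemma nu_real_le (S : Set ℝ) : nu.real S ≤ 1 := by
  have : nu S ≤ 1 := by
    refine (measure_mono (subset_univ S)).trans ?_
    simp [nu]
  exact ENNReal.toReal_le_of_le_ofReal (by norm_num) (by simpa using this)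
lemma decay_R {n : ℕ} (F : Fin n → ℝ) (hF : ∀ k, 0 ≤ F k) {p c s : ℝ} (hp : 1 < p) (hc : 0 < c) (hs : 0 < s)
    (hb : ∀ k, F k ≤ c * (((k:ℕ):ℝ) + 1) ^ (-p)) (K : Finset (Fin n)) :
    ∑ k ∈ K, log (1 + s * F k) ≤ (s * c) ^ (1 / p) * (π / sin (π / p)) := by
  refine le_trans ?_ (J_sum p (s * c) hp (by positivity) (K.map Fin.valEmbedding))
  rw [Finset.sum_map]
  apply Finset.sum_le_sum
  intro k _
  have := hF k
  apply log_le_log (by positivity)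
  rw [mul_assoc]
  have := hb k
  simp only [Fin.valEmbedding_apply]
  gcongr
end
section
lemma log_lim {c q : ℝ} (hc : 0 ≤ c) (hq : 0 < q) :
    Tendsto (fun s : ℝ => log (1 + s * c) / s ^ q) atTop (nhds 0) := by
  have h1 : (fun s : ℝ => log (1 + c) + log s) =o[atTop] (fun s => s ^ q) := by
    refine Asymptotics.IsLittleO.add ?_ (isLittleO_log_rpow_atTop hq)
    refine Asymptotics.isLittleO_const_left.2 (Or.inr ?_)
    exact tendsto_norm_atTop_atTop.comp (tendsto_rpow_atTop hq)
  refine squeeze_zero' ?_ ?_ h1.tendsto_div_nhds_zero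
  · filter_upwards [eventually_ge_atTop 1] with s hs
    have : 0 ≤ s * c := by positivity
    exact div_nonneg (log_nonneg (by linarith)) (by positivity)
  · filter_upwards [eventually_ge_atTop 1] with s hs
    have hs0 : 0 < s := by linarith
    gcongr
    rw [← log_mul (by positivity) (by positivity)]
    apply log_le_log (by positivity)
    nlinarith
section
variable [MeasurableSpace EE] [BorelSpace EE] (μ : Measure EE) [IsProbabilityMeasure μ]
lemma lower_s {H : ℝ → ℝ} {h0 hi r C : ℝ} (hH : Hreg H h0 hi) (hr : 0 < r)
    (hHol : ∀ x ∈ Icc (0:ℝ) 1, ∀ y ∈ Icc (0:ℝ) 1, |H x - H y| ≤ C * |x - y| ^ r)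
    {g g' : ℝ → ℝ} (hk : Ker (aK H) g) (hB : Ker (aK (fun _ => h0)) g')
    (hchar : ∀ v : EE, ∫ f, Complex.exp (Complex.I * ((inner ℝ v f : ℝ) : ℂ)) ∂μ =
      (exp (-(‖hk.op v‖ ^ 2) / 2) : ℂ))
    (D : Set ℝ) (hD : MeasurableSet D) (hDc : IsCompact D) (hDH : ∀ x ∈ D, H x = h0)
    (hDH' : ∀ x ∈ Ioo (0:ℝ) 1, H x = h0 → x ∈ D) :
    ∃ Cst : ℝ, 0 < Cst ∧ ∀ ε : ℝ, 0 < ε → ∃ (c1 c2 c3 q : ℝ), 0 ≤ c1 ∧ 0 < c3 ∧ q < 1 / (2 * h0 + 1) ∧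
      ∀ s : ℝ, 0 < s → -2 * log (∫ f, exp (-(s / 2) * ‖f‖ ^ 2) ∂μ) ≤
        (c2 * log (1 + s * c1) + ((volume D).toReal + ε) *
          ((s * ((1 + ε) * (2 * π * Cstar h0 ^ 2))) ^ (1 / (2 * h0 + 1)) / sin (π / (2 * h0 + 1)))) +
        ((s * (Cst * ε)) ^ (1 / (2 * h0 + 1)) * (π / sin (π / (2 * h0 + 1))) + c3 * s ^ q) := by
  have hh0 : h0 ∈ Ioo (0:ℝ) 1 := ⟨hH.lo_pos, hH.lohi.trans_lt hH.hi_lt⟩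
  obtain ⟨hp0, hp1⟩ := hh0
  have hh0 : h0 ∈ Ioo (0:ℝ) 1 := ⟨hp0, hp1⟩
  have hC : 0 < 2 * π * Cstar h0 ^ 2 := by rw [Cstar_sq hp0 hp1]; exact gs_pos hp0 hp1
  obtain ⟨Cst, hCst, hdec⟩ := S_decay hH hk (a0 := h0) hr hp0.le hp1.le hHol
  refine ⟨Cst, hCst, fun ε hε => ?_⟩
  obtain ⟨N, hN, hUN⟩ := UN_meas hDc hε
  obtain ⟨s', hs', hs1, hS1m⟩ := S1_meas hH.cont h0 hε (sub_pos.2 hp1)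
  obtain ⟨Cst2, hCst2, hdec2⟩ := S_decay hH hk (a0 := h0 + s') hr (by linarith) (by linarith) hHol
  obtain ⟨k0, hk1, hk0⟩ := cos_decay hh0 hB hε
  have hq1 : 1 < 2 * (h0 + s') + 1 := by linarith
  have hsin := sin_pi_div_pos _ hq1
  have hsin0 := sin_pi_div_pos (2 * h0 + 1) (by linarith)
  have hpi := pi_pos
  refine ⟨‖hB.op‖ ^ 2 * 2, (UN D N).card * k0, (Cst2) ^ (1 / (2 * (h0 + s') + 1)) *
    (π / sin (π / (2 * (h0 + s') + 1))), 1 / (2 * (h0 + s') + 1), by positivity, by positivity, ?_, ?_⟩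
  · exact one_div_lt_one_div_of_lt (by linarith) (by linarith)
  intro s hs
  set S1 : Set ℝ := {x | h0 < H x ∧ H x < h0 + s'} with hS1
  set S2 : Set ℝ := {x | h0 + s' ≤ H x} with hS2
  have hm1 : MeasurableSet S1 :=
    (measurableSet_lt measurable_const hH.cont.measurable).inter
      (measurableSet_lt hH.cont.measurable measurable_const)
  have hm2 : MeasurableSet S2 := measurableSet_le measurable_const hH.cont.measurable
  have hpart := part_norm D S1 S2 hD hm1 hm2 (by
    intro x hx
    have hge : h0 ≤ H x := (hH.mem x).1
    rcases hge.eq_or_lt with he | hl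
    · left
      refine ⟨hDH' x hx he.symm, fun h => ?_, fun h => ?_⟩
      · exact absurd h.1 (by linarith)
      · have h' : h0 + s' ≤ H x := h
        linarith
    · right
      have hxD : x ∉ D := fun h => by linarith [hDH x h]
      rcases lt_or_ge (H x) (h0 + s') with h | h
      · exact Or.inl ⟨hxD, ⟨hl, h⟩, fun h' => absurd h (not_lt.2 h')⟩
      · exact Or.inr ⟨hxD, fun h' => absurd h'.2 (not_lt.2 h), h⟩)
  have hb := fun ζ => UN_hb hD hN hB.op ζ
  simp only [← op_agree hk hB D hD hDH] at hb
  refine (lower_phi μ hchar D S1 S2 hD hm1 hm2 hpart s hs.le (R1 := (s * (Cst * ε)) ^ (1 / (2 * h0 + 1)) *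
    (π / sin (π / (2 * h0 + 1)))) (R2 := (s * Cst2) ^ (1 / (2 * (h0 + s') + 1)) *
    (π / sin (π / (2 * (h0 + s') + 1)))) ?_ ?_ (fun q : (UN D N) × ℕ => hB.op (cc N q.1 q.2)) hb
    (UN_R hh0 hB hε hk1 (fun j k hj hk => hk0 N j k hj hk) hC hs)).trans ?_
  · intro n e he ho ha K
    apply decay_R (fun i => ‖hk.op (ind S1 hm1 (e i))‖ ^ 2) (fun i => sq_nonneg _) (by linarith)
      (by positivity) hs _ K
    intro k
    refine (hdec S1 hm1 (fun x hx _ => hx.1.le) n e he ho ha k).trans ?_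
    gcongr
  · intro n e he ho ha K
    apply decay_R (fun i => ‖hk.op (ind S2 hm2 (e i))‖ ^ 2) (fun i => sq_nonneg _) hq1
      hCst2 hs _ K
    intro k
    refine (hdec2 S2 hm2 (fun x hx _ => hx) n e he ho ha k).trans ?_
    have := nu_real_le S2
    have h2 : Cst2 * nu.real S2 ≤ Cst2 := by nlinarith
    gcongr
  · gcongr ?_ + (_ + ?_)
    · rw [mul_add, ← mul_assoc]
      refine add_le_add le_rfl ?_
      have hN' : (0:ℝ) < N := by exact_mod_cast hN
      have e : ∀ x : ℝ, ((UN D N).card : ℝ) * (x / (N * sin (π / (2 * h0 + 1)))) =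
          ((UN D N).card : ℝ) / N * (x / sin (π / (2 * h0 + 1))) := by
        intro x; field_simp
      rw [e]
      gcongr
    · rw [Real.mul_rpow hs.le hCst2.le]
      apply le_of_eq; ring
theorem phi_lim {H : ℝ → ℝ} {h0 hi r C : ℝ} (hH : Hreg H h0 hi) (hr : 0 < r)
    (hHol : ∀ x ∈ Icc (0:ℝ) 1, ∀ y ∈ Icc (0:ℝ) 1, |H x - H y| ≤ C * |x - y| ^ r)
    {g g' : ℝ → ℝ} (hk : Ker (aK H) g) (hB : Ker (aK (fun _ => h0)) g')
    (hchar : ∀ v : EE, ∫ f, Complex.exp (Complex.I * ((inner ℝ v f : ℝ) : ℂ)) ∂μ =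
      (exp (-(‖hk.op v‖ ^ 2) / 2) : ℂ))
    (D : Set ℝ) (hD : MeasurableSet D) (hDc : IsCompact D) (hDH : ∀ x ∈ D, H x = h0)
    (hDH' : ∀ x ∈ Ioo (0:ℝ) 1, H x = h0 → x ∈ D) (hnu : nu.real D = (volume D).toReal)
    (hpos : 0 < (volume D).toReal) :
    Tendsto (fun s : ℝ => -2 * log (∫ f, exp (-(s / 2) * ‖f‖ ^ 2) ∂μ) / s ^ (1 / (2 * h0 + 1))) atTop
      (nhds ((volume D).toReal * (2 * π * Cstar h0 ^ 2) ^ (1 / (2 * h0 + 1)) / sin (π / (2 * h0 + 1)))) := by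
  have hp0 := hH.lo_pos
  have hp1 : h0 < 1 := hH.lohi.trans_lt hH.hi_lt
  have hC : 0 < 2 * π * Cstar h0 ^ 2 := by rw [Cstar_sq hp0 hp1]; exact gs_pos hp0 hp1
  have hsin := sin_pi_div_pos (2 * h0 + 1) (by linarith)
  set a := 2 * π * Cstar h0 ^ 2 with ha
  set p := 2 * h0 + 1 with hp
  have hp' : 0 < 1 / p := by positivity
  set M := (volume D).toReal with hM
  have hpi := pi_pos
  rw [tendsto_order]
  constructor
  · intro y hy
    have hl : Tendsto (fun s : ℝ => M * a ^ (1 / p) / sin (π / p) - log (1 + s * a) / s ^ (1 / p)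
        - (1 / sin (π / p)) / s ^ (1 / p)) atTop (nhds (M * a ^ (1 / p) / sin (π / p) - 0 - 0)) :=
      (tendsto_const_nhds.sub (log_lim hC.le hp')).sub
        (tendsto_const_nhds.div_atTop (tendsto_rpow_atTop hp'))
    rw [sub_zero, sub_zero] at hl
    filter_upwards [hl.eventually (lt_mem_nhds hy), eventually_gt_atTop 0] with s h1 hs
    refine h1.trans_le ?_
    have h2 := upper_phi μ hk.op hchar h0 hp0 hB D hD (op_agree hk hB D hD hDH) (by rw [hnu]; exact hpos) s hs a ha hC
    have hsp : 0 < s ^ (1 / p) := by positivity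
    rw [le_div_iff₀ hsp]
    refine le_trans (le_of_eq ?_) h2
    rw [hnu, ← hp, Real.mul_rpow hs.le hC.le]
    field_simp
  · intro y hy
    obtain ⟨Cst, hCst, hlow⟩ := lower_s μ hH hr hHol hk hB hchar D hD hDc hDH hDH'
    have hcont : Continuous (fun ε : ℝ => (M + ε) * (((1 + ε) * a) ^ (1 / p) / sin (π / p)) +
        (Cst * ε) ^ (1 / p) * (π / sin (π / p))) := by
      have c1 : Continuous (fun ε : ℝ => ((1 + ε) * a) ^ (1 / p)) :=
        Continuous.rpow_const (by fun_prop) (fun _ => Or.inr hp'.le)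
      have c2 : Continuous (fun ε : ℝ => (Cst * ε) ^ (1 / p)) :=
        Continuous.rpow_const (by fun_prop) (fun _ => Or.inr hp'.le)
      fun_prop
    have ht := (hcont.tendsto 0).mono_left (nhdsWithin_le_nhds (s := Ioi 0))
    simp only [add_zero, mul_zero, Real.zero_rpow hp'.ne', one_mul, zero_mul] at ht
    rw [← mul_div_assoc] at ht
    obtain ⟨ε, hεy, hε⟩ := ((ht.eventually (gt_mem_nhds hy)).and self_mem_nhdsWithin).exists
    have hε : 0 < ε := hε
    obtain ⟨c1, c2, c3, q, hc1, hc3, hq, hb⟩ := hlow ε hε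
    have hq' : 0 < 1 / p - q := by linarith
    have hu : Tendsto (fun s : ℝ => c2 * (log (1 + s * c1) / s ^ (1 / p)) +
        ((M + ε) * (((1 + ε) * a) ^ (1 / p) / sin (π / p)) +
        (Cst * ε) ^ (1 / p) * (π / sin (π / p))) + c3 * s ^ (-(1 / p - q))) atTop
        (nhds (c2 * 0 + ((M + ε) * (((1 + ε) * a) ^ (1 / p) / sin (π / p)) +
        (Cst * ε) ^ (1 / p) * (π / sin (π / p))) + c3 * 0)) :=
      (((log_lim hc1 hp').const_mul c2).add tendsto_const_nhds).add
        ((tendsto_rpow_neg_atTop hq').const_mul c3)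
    rw [mul_zero, mul_zero, zero_add, add_zero] at hu
    filter_upwards [hu.eventually (gt_mem_nhds hεy), eventually_gt_atTop 0] with s h1 hs
    refine lt_of_le_of_lt ?_ h1
    have hsp : 0 < s ^ (1 / p) := by positivity
    rw [div_le_iff₀ hsp]
    refine (hb s hs).trans (le_of_eq ?_)
    rw [Real.mul_rpow (y := (1 + ε) * a) hs.le (by positivity), Real.mul_rpow (y := Cst * ε) hs.le (by positivity)]
    have e1 : s ^ (-(1 / p - q)) * s ^ (1 / p) = s ^ q := by
      rw [← rpow_add hs]; congr 1; ring
    rw [← e1, ← hp, ← hM]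
    generalize s ^ (1 / p) = E at hsp
    generalize s ^ (-(1 / p - q)) = X
    field_simp
    ring
end
end
section
lemma const_alg {h M a S : ℝ} (hh : 0 < h) (hM : 0 < M) (ha : 0 < a) (hS : 0 < S) :
    (1 - 1 / (2 * h + 1)) * (M * a ^ (1 / (2 * h + 1)) / S * 2 ^ (1 / (2 * h + 1)) / 2) *
      (1 / (2 * h + 1) * (M * a ^ (1 / (2 * h + 1)) / S * 2 ^ (1 / (2 * h + 1)) / 2)) ^ (1 / (2 * h)) =
    h * M / ((2 * h + 1) * S) * (a * M / ((2 * h + 1) * S)) ^ (1 / (2 * h)) := by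
  set p := 2 * h + 1 with hp
  have hp0 : 0 < p := by positivity
  have e0 : M * a ^ (1 / p) / S * 2 ^ (1 / p) / 2 = M / (2 * S) * (2 * a) ^ (1 / p) := by
    rw [Real.mul_rpow (by norm_num) ha.le]; field_simp
  have e1 : 1 / p * (M / (2 * S) * (2 * a) ^ (1 / p)) = M / (2 * S * p) * (2 * a) ^ (1 / p) := by
    field_simp
  have e2 : a * M / (p * S) = M / (2 * S * p) * (2 * a) := by field_simp
  rw [e0, e1, e2, Real.mul_rpow (x := M / (2 * S * p)) (by positivity) (by positivity),
    Real.mul_rpow (x := M / (2 * S * p)) (y := 2 * a) (by positivity) (by positivity),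
    ← rpow_mul (by positivity)]
  have e3 : (2 * a) ^ (1 / (2 * h)) = (2 * a) ^ (1 / p) * (2 * a) ^ (1 / p * (1 / (2 * h))) := by
    rw [← rpow_add (by positivity)]
    congr 1
    rw [hp]; field_simp
  have e4 : 1 - 1 / p = 2 * h / p := by rw [hp]; field_simp; ring
  rw [e3, e4]
  generalize (2 * a) ^ (1 / p) = X
  generalize (2 * a) ^ (1 / p * (1 / (2 * h))) = Y
  generalize (M / (2 * S * p)) ^ (1 / (2 * h)) = Z
  field_simp
lemma final_core [MeasurableSpace EE] [BorelSpace EE] (μ : Measure EE) [IsProbabilityMeasure μ]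
    {h M a S : ℝ} (hh : 0 < h) (hM : 0 < M) (ha : 0 < a) (hS : 0 < S)
    (hlim : Tendsto (fun s : ℝ => -2 * log (∫ f, exp (-(s / 2) * ‖f‖ ^ 2) ∂μ) / s ^ (1 / (2 * h + 1))) atTop
      (nhds (M * a ^ (1 / (2 * h + 1)) / S))) :
    Tendsto (fun ε : ℝ => ε ^ (1 / h) * log (μ {f | ‖f‖ ≤ ε}).toReal)
      (nhdsWithin 0 (Ioi 0))
      (nhds (-(h * M / ((2 * h + 1) * S) * (a * M / ((2 * h + 1) * S)) ^ (1 / (2 * h))))) := by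
  have hp0 : 0 < 1 / (2 * h + 1) := by positivity
  have hp1 : 1 / (2 * h + 1) < 1 := by rw [div_lt_one (by positivity)]; linarith
  have h1 : Tendsto (fun t : ℝ => log (∫ f, exp (-t * ‖f‖ ^ 2) ∂μ) / t ^ (1 / (2 * h + 1))) atTop
      (nhds (-(M * a ^ (1 / (2 * h + 1)) / S * 2 ^ (1 / (2 * h + 1)) / 2))) := by
    have h2 : Tendsto (fun t : ℝ => 2 * t) atTop atTop := tendsto_id.const_mul_atTop (by norm_num)
    have h3 := ((hlim.comp h2).mul_const ((2:ℝ) ^ (1 / (2 * h + 1)) / 2)).neg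
    rw [← mul_div_assoc] at h3
    refine h3.congr' ?_
    filter_upwards [eventually_gt_atTop 0] with t ht
    simp only [Function.comp]
    rw [show 2 * t / 2 = t by ring, Real.mul_rpow (by norm_num) ht.le]
    have : 0 < (2:ℝ) ^ (1 / (2 * h + 1)) := by positivity
    have : 0 < t ^ (1 / (2 * h + 1)) := by positivity
    field_simp
  have h4 := tauberian μ (fun f => ‖f‖ ^ 2) (by fun_prop) (fun f => sq_nonneg _) hp0 hp1 (by positivity) h1
  have e : 1 / (2 * h + 1) / (1 - 1 / (2 * h + 1)) = 1 / (2 * h) := by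
    have : 1 - 1 / (2 * h + 1) = 2 * h / (2 * h + 1) := by field_simp; ring
    rw [this]; field_simp
  rw [e, const_alg hh hM ha hS] at h4
  have h5 : Tendsto (fun ε : ℝ => ε ^ 2) (nhdsWithin 0 (Ioi 0)) (nhdsWithin 0 (Ioi 0)) := by
    apply tendsto_nhdsWithin_of_tendsto_nhds_of_eventually_within
    · have : Tendsto (fun ε : ℝ => ε ^ 2) (nhds 0) (nhds (0 ^ 2)) := (continuous_pow 2).tendsto 0
      rw [zero_pow two_ne_zero] at this
      exact this.mono_left nhdsWithin_le_nhds
    · filter_upwards [self_mem_nhdsWithin] with ε hε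
      exact pow_pos (show (0:ℝ) < ε from hε) 2
  refine (h4.comp h5).congr' ?_
  filter_upwards [self_mem_nhdsWithin] with ε hε
  have hε : 0 < ε := hε
  simp only [Function.comp]
  have e1 : (ε ^ 2) ^ (1 / (2 * h)) = ε ^ (1 / h) := by
    rw [← rpow_natCast, ← rpow_mul hε.le]
    congr 1
    push_cast; field_simp
  have e2 : {f : EE | ‖f‖ ^ 2 ≤ ε ^ 2} = {f | ‖f‖ ≤ ε} := by
    ext f
    exact pow_le_pow_iff_left₀ (norm_nonneg _) hε.le two_ne_zero
  rw [e1, e2]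
  rfl
lemma main_core (H : ℝ → ℝ) (r : ℝ) (hr : 0 < r) (hHol : HolderOn H r (Icc 0 1))
    (hrange : ∀ x ∈ Icc (0:ℝ) 1, 0 < H x ∧ H x < 1)
    (Hmin : ℝ) (hHmin : IsLeast (H '' Icc 0 1) Hmin)
    (D : Set ℝ) (hD : D = {x | x ∈ Icc (0:ℝ) 1 ∧ H x = Hmin}) (hDpos : 0 < volume D)
    [MeasurableSpace EE] [BorelSpace EE] (μ : Measure EE) [IsProbabilityMeasure μ]
    (hGauss : ∀ L : EE →L[ℝ] ℝ, ∃ v : ℝ≥0, μ.map L = ProbabilityTheory.gaussianReal 0 v)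
    (hCov : ∀ u v : EE, ∫ f, (inner ℝ u f) * (inner ℝ v f) ∂μ =
        ∫ x in Ioo (0:ℝ) 1, ∫ y in Ioo (0:ℝ) 1, GmBM H x y * u x * v y) :
    Tendsto (fun ε : ℝ => ε ^ (1 / Hmin) * log (μ {f | ‖f‖ ≤ ε}).toReal)
      (nhdsWithin 0 (Ioi 0))
      (nhds (-(Hmin * (volume D).toReal /
          ((2 * Hmin + 1) * sin (Real.pi / (2 * Hmin + 1))) *
        (Real.Gamma (2 * Hmin + 1) * sin (Real.pi * Hmin) * (volume D).toReal /
            ((2 * Hmin + 1) * sin (Real.pi / (2 * Hmin + 1)))) ^ (1 / (2 * Hmin))))) := by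
  obtain ⟨C, hC⟩ := hHol
  have hcont : ContinuousOn H (Icc 0 1) := by
    intro x hx
    rw [ContinuousWithinAt, tendsto_iff_dist_tendsto_zero]
    have hc : Tendsto (fun y => C * |y - x| ^ r) (nhdsWithin x (Icc 0 1)) (nhds (C * |x - x| ^ r)) := by
      apply Tendsto.mono_left _ nhdsWithin_le_nhds
      apply Continuous.tendsto
      exact continuous_const.mul (Continuous.rpow_const (by fun_prop) fun _ => Or.inr hr.le)
    rw [sub_self, abs_zero, Real.zero_rpow hr.ne', mul_zero] at hc
    refine squeeze_zero' (Eventually.of_forall fun _ => dist_nonneg) ?_ hc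
    filter_upwards [self_mem_nhdsWithin] with y hy
    exact hC y hy x hx
  obtain ⟨xm, hxm, hxm'⟩ := isCompact_Icc.exists_isMaxOn (nonempty_Icc.2 (zero_le_one (α := ℝ))) hcont
  obtain ⟨x0, hx0, hx0'⟩ := hHmin.1
  let G : ℝ → ℝ := fun x => H (projIcc (0:ℝ) 1 zero_le_one x)
  have hGH : ∀ x ∈ Icc (0:ℝ) 1, G x = H x := fun x hx => by
    simp only [G]; rw [projIcc_of_mem _ hx]
  have hGc : Continuous G := by
    have h2 : Continuous (fun z : Icc (0:ℝ) 1 => H z) := continuousOn_iff_continuous_domRestrict.1 hcont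
    exact h2.comp continuous_projIcc
  have hReg : Hreg G Hmin (H xm) := by
    refine ⟨hGc, ?_, (hrange xm hxm).2, fun x => ⟨?_, ?_⟩⟩
    · rw [← hx0']; exact (hrange x0 hx0).1
    · exact hHmin.2 ⟨_, (projIcc (0:ℝ) 1 zero_le_one x).2, rfl⟩
    · exact hxm' (projIcc (0:ℝ) 1 zero_le_one x).2
  have hp0 := hReg.lo_pos
  have hp1 : Hmin < 1 := hReg.lohi.trans_lt hReg.hi_lt
  have hRegB : Hreg (fun _ => Hmin) Hmin Hmin := ⟨continuous_const, hp0, hp1, fun _ => ⟨le_rfl, le_rfl⟩⟩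
  obtain ⟨g, hk⟩ := aK_ker hReg
  obtain ⟨g', hB⟩ := aK_ker hRegB
  have hchar := mu_char μ hGauss hk.op (fun v => by
    rw [hCov v v]
    exact cov_eq (fun x hx => (hGH x (Ioo_subset_Icc_self hx)).symm) hk v)
  have hDe : D = Icc 0 1 ∩ G ⁻¹' {Hmin} := by
    rw [hD]
    ext x
    constructor
    · rintro ⟨h1, h2⟩
      exact ⟨h1, by rw [mem_preimage, hGH x h1]; exact h2⟩
    · rintro ⟨h1, h2⟩
      rw [mem_preimage, hGH x h1] at h2
      exact ⟨h1, h2⟩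
  have hDc : IsCompact D := by
    rw [hDe]
    exact isCompact_Icc.inter_right (isClosed_singleton.preimage hGc)
  have hDm : MeasurableSet D := hDc.isClosed.measurableSet
  have hnu : nu.real D = (volume D).toReal := by
    unfold Measure.real nu
    rw [Measure.restrict_congr_set Ioo_ae_eq_Icc, Measure.restrict_apply hDm, inter_eq_left.2]
    rw [hDe]; exact inter_subset_left
  have hpos : 0 < (volume D).toReal := ENNReal.toReal_pos hDpos.ne' hDc.measure_lt_top.ne
  have hlim := phi_lim μ hReg hr (C := C) (fun x hx y hy => by rw [hGH x hx, hGH y hy]; exact hC x hx y hy)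
    hk hB hchar D hDm hDc (fun x hx => by rw [hDe] at hx; exact hx.2)
    (fun x hx h => by rw [hDe]; exact ⟨Ioo_subset_Icc_self hx, h⟩) hnu hpos
  rw [Cstar_sq hp0 hp1] at hlim
  exact final_core μ hp0 hpos (gs_pos hp0 hp1) (sin_pi_div_pos _ (by linarith)) hlim
end

end

/-- Small ball asymptotics for the multifractional Brownian motion, case `Leb(D) > 0`. -/
theorem mBM_small_ball_posD
    (H : ℝ → ℝ) (r : ℝ) (hr : 0 < r) (hHol : HolderOn H r (Icc 0 1))
    (hrange : ∀ x ∈ Icc (0:ℝ) 1, 0 < H x ∧ H x < 1)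
    (Hmin : ℝ) (hHmin : IsLeast (H '' Icc 0 1) Hmin)
    (D : Set ℝ) (hD : D = {x | x ∈ Icc (0:ℝ) 1 ∧ H x = Hmin})
    -- Assumption 1
    (d : ℝ → ℝ) (c₁ c₂ C₀ κ : ℝ) (hc₁ : 0 < c₁) (hc₂ : 0 < c₂) (hC₀ : 0 < C₀) (hκ : 0 < κ)
    (hd₁ : ∀ x ∈ Icc (0:ℝ) 1, c₁ * infDist x D ≤ d x ∧ d x ≤ c₂ * infDist x D)
    (hd₂ : ContDiffOn ℝ (⊤ : ℕ∞) d (Icc 0 1 \ D))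
    (hd₃ : ∀ n : ℕ, 1 ≤ n → ∃ Cn : ℝ, ∀ x ∈ Icc (0:ℝ) 1 \ D,
      |iteratedDerivWithin n d (Icc 0 1 \ D) x| ≤ Cn * d x ^ ((1:ℝ) - n))
    (hhd : ∀ x ∈ Icc (0:ℝ) 1, H x - Hmin ≤ C₀ * d x ^ κ)
    -- Assumption 2
    (h₀ h₁ : ℝ → ℝ) (β : ℝ) (hβ : 0 < β)
    (hsplit : ∀ x ∈ Icc (0:ℝ) 1, H x - Hmin = h₀ x + h₁ x)
    (hh₀Hol : HolderOn h₀ β (Icc 0 1)) (hh₁Hol : HolderOn h₁ β (Icc 0 1))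
    (hh₀sm : ContDiffOn ℝ (⊤ : ℕ∞) h₀ (Icc 0 1 \ D))
    (hh₀der : ∀ n : ℕ, 1 ≤ n → ∃ Cn : ℝ, ∀ x ∈ Icc (0:ℝ) 1 \ D,
      |iteratedDerivWithin n h₀ (Icc 0 1 \ D) x| ≤ Cn * h₀ x * d x ^ (-(n:ℝ)))
    (τ δ₀ C' : ℝ) (hτ : 0 < τ) (hδ₀ : 0 < δ₀) (hC' : 0 < C')
    (hh₁sm : ∀ x ∈ Icc (0:ℝ) 1, h₀ x < δ₀ → |h₁ x| ≤ C' * h₀ x ^ (1 + τ))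
    -- Assumption 3
    (σ s₀ : ℝ) (φ : ℝ → ℝ) (hσ : 0 < σ) (hs₀ : 0 < s₀)
    (hφm : Measurable φ) (hφpos : ∀ u : ℝ, 0 < u → 0 < φ u)
    (hφslow : ∀ c : ℝ, 0 < c → Tendsto (fun u => φ (c * u) / φ u) atTop (nhds 1))
    (hmeas : ∀ s : ℝ, 0 < s → s < s₀ →
      (volume {x | x ∈ Icc (0:ℝ) 1 ∧ 0 < H x - Hmin ∧ H x - Hmin < s}).toReal = s ^ σ * φ (1 / s))
    -- τ-condition: Leb(D) > 0
    (hDpos : 0 < volume D)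
    (hτD : max 0 ((1 - σ) / 2) < τ)
    -- the Gaussian measure
    [MeasurableSpace (Lp ℝ 2 (volume.restrict (Ioo (0:ℝ) 1)))]
    [BorelSpace (Lp ℝ 2 (volume.restrict (Ioo (0:ℝ) 1)))]
    (μ : Measure (Lp ℝ 2 (volume.restrict (Ioo (0:ℝ) 1)))) [IsProbabilityMeasure μ]
    (hGauss : ∀ L : Lp ℝ 2 (volume.restrict (Ioo (0:ℝ) 1)) →L[ℝ] ℝ,
      ∃ v : ℝ≥0, μ.map L = ProbabilityTheory.gaussianReal 0 v)
    (hCov : ∀ u v : Lp ℝ 2 (volume.restrict (Ioo (0:ℝ) 1)),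
      ∫ f, (@inner ℝ _ _ u f) * (@inner ℝ _ _ v f) ∂μ =
        ∫ x in Ioo (0:ℝ) 1, ∫ y in Ioo (0:ℝ) 1, GmBM H x y * u x * v y) :
    Tendsto (fun ε : ℝ =>
        ε ^ (1 / Hmin) * Real.log (μ {f | ‖f‖ ≤ ε}).toReal)
      (nhdsWithin 0 (Ioi 0))
      (nhds (-(Hmin * (volume D).toReal /
          ((2 * Hmin + 1) * Real.sin (Real.pi / (2 * Hmin + 1))) *
        (Real.Gamma (2 * Hmin + 1) * Real.sin (Real.pi * Hmin) * (volume D).toReal /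
            ((2 * Hmin + 1) * Real.sin (Real.pi / (2 * Hmin + 1)))) ^ (1 / (2 * Hmin))))) := by
  exact main_core H r hr hHol hrange Hmin hHmin D hD hDpos μ hGauss hCov
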